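/- There exists a function f : ℕ × ℕ → ℕ with the following property: for every prime p, every natural number n, every natural number m, every finite p-soluble group G, and every automorphism φ of G of order p^n, if for every φ-invariant elementary abelian p'-section A/B of G the fixed-point subgroup C_{A/B}(φ) has order at most m, then the p-length of G is at most f(p^n, m). -/

import Mathlib

/-- A normal series of `G` (each term normal in `G`) each of whose factors is either a
`p`-group or a `p'`-group. -/
def IsPPrimePSeries (p : ℕ) {G : Type*} [Group G] (H : ℕ → Subgroup G) (k : ℕ) : Prop :=
  H 0 = ⊥ ∧ H k = ⊤ ∧ (∀ i, (H i).Normal) ∧ (∀ i, H i ≤ H (i + 1)) ∧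
    ∀ i < k, (∃ j : ℕ, Nat.card (H (i + 1) ⧸ (H i).subgroupOf (H (i + 1))) = p ^ j) ∨
      ¬ p ∣ Nat.card (H (i + 1) ⧸ (H i).subgroupOf (H (i + 1)))

/-- A finite group is `p`-soluble iff it has a normal series each of whose factors is a
`p`-group or a `p'`-group. -/
def IsPSoluble (p : ℕ) (G : Type*) [Group G] : Prop :=
  ∃ (k : ℕ) (H : ℕ → Subgroup G), IsPPrimePSeries p H k

/-- The `p`-length of `G` is at most `N`: there is a normal series with `p`- or `p'`-factors
having at most `N` factors of order divisible by `p` (i.e. at most `N` nontrivial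
`p`-factors). -/
def PLengthLE (p : ℕ) (G : Type*) [Group G] (N : ℕ) : Prop :=
  ∃ (k : ℕ) (H : ℕ → Subgroup G), IsPPrimePSeries p H k ∧
    ((Finset.range k).filter
      (fun i => p ∣ Nat.card (H (i + 1) ⧸ (H i).subgroupOf (H (i + 1))))).card ≤ N

/-- The subgroup `A` is invariant under the automorphism `φ`. -/
def PhiInvariant {G : Type*} [Group G] (φ : MulAut G) (A : Subgroup G) : Prop :=
  A.map φ.toMonoidHom = A

/-- `B ⊴ A` and the section `A/B` is an elementary abelian `r`-group for some prime
`r ≠ p`. -/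
def IsElemAbelianPPrimeSection (p : ℕ) {G : Type*} [Group G] (A B : Subgroup G) : Prop :=
  B ≤ A ∧ (∀ a ∈ A, ∀ b ∈ B, a * b * a⁻¹ ∈ B) ∧
    ∃ r : ℕ, r.Prime ∧ r ≠ p ∧
      (∀ a ∈ A, ∀ b ∈ A, a⁻¹ * b⁻¹ * a * b ∈ B) ∧ (∀ a ∈ A, a ^ r ∈ B)

/-- The number of fixed points of the automorphism induced by `φ` on the section `A/B`
(a coset `aB` is fixed iff `a⁻¹ · φ(a) ∈ B`). -/
noncomputable def sectionFixedCard {G : Type*} [Group G] (φ : MulAut G) (A B : Subgroup G) : ℕ :=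
  Nat.card {x : A ⧸ B.subgroupOf A // ∃ a : A, QuotientGroup.mk a = x ∧ (a : G)⁻¹ * φ a ∈ B}


namespace PLen

/-- `p`-elements -/
def IsPEl {G : Type*} [Group G] (p : ℕ) (x : G) : Prop := ∃ k : ℕ, x ^ (p ^ k) = 1
/-- elements of order prime to `p` -/
def IsQEl {G : Type*} [Group G] (p : ℕ) (x : G) : Prop := ∃ k : ℕ, Nat.Coprime p k ∧ x ^ k = 1

/-- subgroup generated by the `p`-elements -/
def Rp {G : Type*} [Group G] (p : ℕ) (H : Subgroup G) : Subgroup G :=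
  Subgroup.closure {x | x ∈ H ∧ IsPEl p x}
/-- subgroup generated by the elements of order prime to `p` -/
def Rq {G : Type*} [Group G] (p : ℕ) (H : Subgroup G) : Subgroup G :=
  Subgroup.closure {x | x ∈ H ∧ IsQEl p x}
/-- one step of the lower `p`-series -/
def DD {G : Type*} [Group G] (p : ℕ) (H : Subgroup G) : Subgroup G := Rq p (Rp p H)
/-- iterated lower `p`-series -/
def DI {G : Type*} [Group G] (p : ℕ) (k : ℕ) (H : Subgroup G) : Subgroup G := (DD p)^[k] H
/-- working version of `p`-solubility -/
def PSol (p : ℕ) (G : Type*) [Group G] : Prop := ∃ k, DI p k (⊤ : Subgroup G) = ⊥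

section
variable {G G' : Type*} [Group G] [Group G'] {p : ℕ}

theorem IsPEl.map (f : G →* G') {x : G} (h : IsPEl p x) : IsPEl p (f x) := by
  obtain ⟨k, hk⟩ := h; exact ⟨k, by rw [← map_pow, hk, map_one]⟩
theorem IsQEl.map (f : G →* G') {x : G} (h : IsQEl p x) : IsQEl p (f x) := by
  obtain ⟨k, h1, hk⟩ := h; exact ⟨k, h1, by rw [← map_pow, hk, map_one]⟩

theorem eq_one_of_p_q {x : G} (h1 : IsPEl p x) (h2 : IsQEl p x) : x = 1 := by
  obtain ⟨k, hk⟩ := h1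
  obtain ⟨j, hj, hj1⟩ := h2
  have h := Nat.dvd_gcd (orderOf_dvd_of_pow_eq_one hk) (orderOf_dvd_of_pow_eq_one hj1)
  rw [Nat.Coprime.gcd_eq_one (Nat.Coprime.pow_left k hj)] at h
  exact orderOf_eq_one_iff.1 (Nat.dvd_one.1 h)

theorem Rp_le (H : Subgroup G) : Rp p H ≤ H := (Subgroup.closure_le _).2 fun _ h => h.1
theorem Rq_le (H : Subgroup G) : Rq p H ≤ H := (Subgroup.closure_le _).2 fun _ h => h.1
theorem Rp_mono {H K : Subgroup G} (h : H ≤ K) : Rp p H ≤ Rp p K :=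
  Subgroup.closure_mono fun _ hx => ⟨h hx.1, hx.2⟩
theorem Rq_mono {H K : Subgroup G} (h : H ≤ K) : Rq p H ≤ Rq p K :=
  Subgroup.closure_mono fun _ hx => ⟨h hx.1, hx.2⟩
theorem DD_le (H : Subgroup G) : DD p H ≤ H := (Rq_le _).trans (Rp_le _)
theorem DD_mono {H K : Subgroup G} (h : H ≤ K) : DD p H ≤ DD p K := Rq_mono (Rp_mono h)
theorem DI_zero (H : Subgroup G) : DI p 0 H = H := rfl
theorem DI_succ (k : ℕ) (H : Subgroup G) : DI p (k + 1) H = DI p k (DD p H) :=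
  Function.iterate_succ_apply _ _ _
theorem DI_succ' (k : ℕ) (H : Subgroup G) : DI p (k + 1) H = DD p (DI p k H) :=
  Function.iterate_succ_apply' _ _ _
theorem DI_add (j k : ℕ) (H : Subgroup G) : DI p (j + k) H = DI p j (DI p k H) :=
  Function.iterate_add_apply _ _ _ _
theorem DI_mono (k : ℕ) {H K : Subgroup G} (h : H ≤ K) : DI p k H ≤ DI p k K := by
  induction k with
  | zero => exact h
  | succ k ih => rw [DI_succ', DI_succ']; exact DD_mono ih
theorem DI_le (k : ℕ) (H : Subgroup G) : DI p k H ≤ H := by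
  induction k with
  | zero => exact le_rfl
  | succ k ih => rw [DI_succ']; exact (DD_le _).trans ih
theorem DI_anti {j k : ℕ} (h : j ≤ k) (H : Subgroup G) : DI p k H ≤ DI p j H := by
  obtain ⟨i, rfl⟩ := Nat.exists_eq_add_of_le h
  rw [add_comm, DI_add]; exact DI_le _ _

theorem exists_lift_p [Finite G] (hp : p.Prime) (f : G →* G') (x : G) (h : IsPEl p (f x)) :
    ∃ n : ℕ, IsPEl p (x ^ n) ∧ f (x ^ n) = f x := by
  obtain ⟨k, hk⟩ := h
  obtain ⟨a, m, hm, ho⟩ := Nat.exists_eq_pow_mul_and_not_dvd (orderOf_pos x).ne' p hp.ne_one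
  have hc : Nat.Coprime (p ^ k) m := Nat.Coprime.pow_left _ ((Nat.Prime.coprime_iff_not_dvd hp).2 hm)
  obtain ⟨u, hu1, hu2⟩ := Nat.chineseRemainder hc 1 0
  refine ⟨u, ⟨a, ?_⟩, ?_⟩
  · rw [← pow_mul]
    apply orderOf_dvd_iff_pow_eq_one.1
    rw [ho, mul_comm]
    exact Nat.mul_dvd_mul ((Nat.modEq_zero_iff_dvd).1 hu2) dvd_rfl
  · rw [map_pow]
    have : f x ^ u = f x ^ 1 := pow_eq_pow_iff_modEq.2 (hu1.of_dvd (orderOf_dvd_of_pow_eq_one hk))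
    rw [this, pow_one]

theorem exists_lift_q [Finite G] (hp : p.Prime) (f : G →* G') (x : G) (h : IsQEl p (f x)) :
    ∃ n : ℕ, IsQEl p (x ^ n) ∧ f (x ^ n) = f x := by
  obtain ⟨k, hk0, hk⟩ := h
  obtain ⟨a, m, hm, ho⟩ := Nat.exists_eq_pow_mul_and_not_dvd (orderOf_pos x).ne' p hp.ne_one
  have hc : Nat.Coprime k (p ^ a) := (Nat.Coprime.pow_left _ hk0).symm
  obtain ⟨u, hu1, hu2⟩ := Nat.chineseRemainder hc 1 0
  refine ⟨u, ⟨m, (Nat.Prime.coprime_iff_not_dvd hp).2 hm, ?_⟩, ?_⟩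
  · rw [← pow_mul]
    apply orderOf_dvd_iff_pow_eq_one.1
    rw [ho]
    exact Nat.mul_dvd_mul ((Nat.modEq_zero_iff_dvd).1 hu2) dvd_rfl
  · rw [map_pow]
    have : f x ^ u = f x ^ 1 := pow_eq_pow_iff_modEq.2 (hu1.of_dvd (orderOf_dvd_of_pow_eq_one hk))
    rw [this, pow_one]

theorem Rp_map [Finite G] (hp : p.Prime) (f : G →* G') (H : Subgroup G) :
    Rp p (H.map f) = (Rp p H).map f := by
  apply le_antisymm
  · refine (Subgroup.closure_le _).2 ?_
    rintro _ ⟨⟨x, hx, rfl⟩, h⟩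
    obtain ⟨n, h1, h2⟩ := exists_lift_p hp f x h
    exact ⟨x ^ n, Subgroup.subset_closure ⟨H.pow_mem hx n, h1⟩, h2⟩
  · rw [Rp, MonoidHom.map_closure]
    refine (Subgroup.closure_le _).2 ?_
    rintro _ ⟨x, ⟨hx, h⟩, rfl⟩
    exact Subgroup.subset_closure ⟨⟨x, hx, rfl⟩, h.map f⟩

theorem Rq_map [Finite G] (hp : p.Prime) (f : G →* G') (H : Subgroup G) :
    Rq p (H.map f) = (Rq p H).map f := by
  apply le_antisymm
  · refine (Subgroup.closure_le _).2 ?_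
    rintro _ ⟨⟨x, hx, rfl⟩, h⟩
    obtain ⟨n, h1, h2⟩ := exists_lift_q hp f x h
    exact ⟨x ^ n, Subgroup.subset_closure ⟨H.pow_mem hx n, h1⟩, h2⟩
  · rw [Rq, MonoidHom.map_closure]
    refine (Subgroup.closure_le _).2 ?_
    rintro _ ⟨x, ⟨hx, h⟩, rfl⟩
    exact Subgroup.subset_closure ⟨⟨x, hx, rfl⟩, h.map f⟩

theorem DD_map [Finite G] (hp : p.Prime) (f : G →* G') (H : Subgroup G) :
    DD p (H.map f) = (DD p H).map f := by
  rw [DD, DD, Rp_map hp, Rq_map hp]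

theorem DI_map [Finite G] (hp : p.Prime) (f : G →* G') (k : ℕ) (H : Subgroup G) :
    DI p k (H.map f) = (DI p k H).map f := by
  induction k with
  | zero => rfl
  | succ k ih => rw [DI_succ', DI_succ', ih, DD_map hp]

theorem DI_bot (k : ℕ) : DI p k (⊥ : Subgroup G) = ⊥ := le_bot_iff.1 (DI_le _ _)

theorem PSol.of_surj [Finite G] (hp : p.Prime) (f : G →* G') (hf : Function.Surjective f)
    (h : PSol p G) : PSol p G' := by
  obtain ⟨k, hk⟩ := h
  refine ⟨k, ?_⟩
  rw [← Subgroup.map_top_of_surjective f hf, DI_map hp, hk, Subgroup.map_bot]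

theorem PSol.of_inj [Finite G] (hp : p.Prime) (f : G →* G') (hf : Function.Injective f)
    (h : PSol p G') : PSol p G := by
  obtain ⟨k, hk⟩ := h
  refine ⟨k, ?_⟩
  have h1 : (DI p k (⊤ : Subgroup G)).map f ≤ ⊥ := by
    rw [← DI_map hp, ← hk]; exact DI_mono _ le_top
  exact (Subgroup.map_eq_bot_iff_of_injective _ hf).1 (le_bot_iff.1 h1)

theorem PSol.subgroup [Finite G] (hp : p.Prime) (h : PSol p G) (H : Subgroup G) : PSol p H :=
  h.of_inj hp H.subtype H.subtype_injective

theorem PSol.quot [Finite G] (hp : p.Prime) (h : PSol p G) (N : Subgroup G) [N.Normal] :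
    PSol p (G ⧸ N) := h.of_surj hp (QuotientGroup.mk' N) (QuotientGroup.mk'_surjective N)

theorem PSol.DI_sub [Finite G] (h : PSol p G) (H : Subgroup G) (hH : DD p H = H) : H = ⊥ := by
  obtain ⟨k, hk⟩ := h
  have h1 : ∀ j, DI p j H = H := by
    intro j
    induction j with
    | zero => rfl
    | succ j ih => rw [DI_succ, hH, ih]
  have := DI_mono (p := p) k (le_top : H ≤ ⊤)
  rw [h1, hk] at this
  exact le_bot_iff.1 this

theorem PSol.DI_card [Finite G] (h : PSol p G) (H : Subgroup G) :
    DI p (Nat.card H) H = ⊥ := by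
  have key : ∀ n (H : Subgroup G), Nat.card H ≤ n → DI p n H = ⊥ := by
    intro n
    induction n with
    | zero => intro H hH; have := Nat.card_pos (α := H); omega
    | succ n ih =>
      intro H hH
      rw [DI_succ]
      by_cases hD : DD p H = H
      · have := h.DI_sub H hD
        rw [hD, this, DI_bot]
      · apply ih
        have hlt : DD p H < H := lt_of_le_of_ne (DD_le H) hD
        have : Nat.card (DD p H) < Nat.card H := by
          by_contra hcon
          exact hD (Subgroup.eq_of_le_of_card_ge hlt.le (by omega))
        omega
  exact key _ H le_rfl

theorem PSol.DI_of_card_le [Finite G] (h : PSol p G) (H : Subgroup G) {n : ℕ}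
    (hn : Nat.card H ≤ n) : DI p n H = ⊥ :=
  le_bot_iff.1 ((DI_anti hn H).trans (h.DI_card H).le)

/-- a bounded image forces a bounded term of the series into the kernel -/
theorem PSol.DI_le_ker [Finite G] [Finite G'] (hp : p.Prime) (h : PSol p G) (H : Subgroup G)
    (f : H →* G') {n : ℕ}
    (hn : Nat.card G' ≤ n) : ∀ x (hx : x ∈ H), x ∈ DI p n H → f ⟨x, hx⟩ = 1 := by
  intro x hx hxD
  have h1 : PSol p f.range := (h.subgroup hp H).of_surj hp f.rangeRestrict f.rangeRestrict_surjective
  have h2 : DI p n (⊤ : Subgroup f.range) = ⊥ := by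
    apply h1.DI_of_card_le
    have e : Nat.card (⊤ : Subgroup f.range) = Nat.card f.range := Subgroup.card_top
    rw [e]
    exact (Nat.card_le_card_of_injective _ f.range.subtype_injective).trans hn
  have h3 : DI p n H = (DI p n (⊤ : Subgroup H)).map H.subtype := by
    rw [← DI_map hp, ← MonoidHom.range_eq_map, Subgroup.range_subtype]
  rw [h3] at hxD
  obtain ⟨y, hy, rfl⟩ := hxD
  have h4 : f.rangeRestrict y ∈ (DI p n (⊤ : Subgroup f.range)) := by
    rw [← Subgroup.map_top_of_surjective f.rangeRestrict f.rangeRestrict_surjective, DI_map hp]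
    exact ⟨y, hy, rfl⟩
  rw [h2, Subgroup.mem_bot] at h4
  have := congrArg Subtype.val h4
  simpa using this

/-- action version -/
theorem PSol.DI_fix [Finite G] (hp : p.Prime) (h : PSol p G) (H : Subgroup G) {α : Type*}
    (act : G → α → α) (act_one : ∀ a, act 1 a = a) (act_mul : ∀ x y a, act (x * y) a = act x (act y a))
    (F : Set α) (hF : F.Finite) (hinv : ∀ x ∈ H, ∀ a ∈ F, act x a ∈ F) {M : ℕ} (hM : F.ncard ≤ M) :
    ∀ x ∈ DI p (M.factorial) H, ∀ a ∈ F, act x a = a := by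
  classical
  haveI : Finite F := hF
  let f : H →* Equiv.Perm F :=
    { toFun := fun x =>
        { toFun := fun a => ⟨act x a, hinv x x.2 a a.2⟩
          invFun := fun a => ⟨act (x⁻¹ : H) a, hinv _ (x⁻¹).2 a a.2⟩
          left_inv := fun a => by
            apply Subtype.ext
            simp only [Subgroup.coe_inv]
            rw [← act_mul, inv_mul_cancel, act_one]
          right_inv := fun a => by
            apply Subtype.ext
            simp only [Subgroup.coe_inv]
            rw [← act_mul, mul_inv_cancel, act_one] }
      map_one' := by ext a; simp [act_one]
      map_mul' := by intro x y; ext a; simp [act_mul] }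
  intro x hx a ha
  have hc : Nat.card (Equiv.Perm F) ≤ M.factorial := by
    rw [Nat.card_perm]
    exact Nat.factorial_le hM
  have := h.DI_le_ker hp H f hc x (DI_le _ _ hx) hx
  have := congrArg (fun g => ((g ⟨a, ha⟩ : F) : α)) this
  simpa [f] using this

theorem conj_DI [Finite G] (hp : p.Prime) (k : ℕ) (H : Subgroup G) (g : G)
    (hg : H.map (MulAut.conj g).toMonoidHom = H) :
    (DI p k H).map (MulAut.conj g).toMonoidHom = DI p k H := by
  rw [← DI_map hp, hg]

end
end PLen


namespace PLen
section
variable {Y V : Type} [Group Y] [AddCommGroup V] [DistribMulAction Y V]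

/-- fixed points of one element -/
def fx (V : Type) [AddCommGroup V] [DistribMulAction Y V] (x : Y) : AddSubgroup V where
  carrier := {v | x • v = v}
  zero_mem' := smul_zero x
  add_mem' := fun {a b} ha hb => by
    show x • (a + b) = a + b
    rw [smul_add, show x • a = a from ha, show x • b = b from hb]
  neg_mem' := fun {a} ha => by
    show x • (-a) = -a
    rw [smul_neg, show x • a = a from ha]

theorem mem_fx {x : Y} {v : V} : v ∈ fx V x ↔ x • v = v := Iff.rfl

/-- conjugates of `d` by elements of `R` -/
def cl (R : Subgroup Y) (d : Y) : Set Y := (fun x => x * d * x⁻¹) '' (R : Set Y)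

/-- invariance -/
def Inv (R : Subgroup Y) (W : AddSubgroup V) : Prop := ∀ x ∈ R, ∀ w ∈ W, x • w ∈ W

/-- elements acting trivially on `W/W2` -/
def tk (R : Subgroup Y) (W W2 : AddSubgroup V) (hW : Inv R W) (hW2 : Inv R W2) : Subgroup Y where
  carrier := {x | x ∈ R ∧ ∀ w ∈ W, x • w - w ∈ W2}
  one_mem' := ⟨R.one_mem, fun w _ => by simp⟩
  mul_mem' := fun {a b} ha hb => ⟨R.mul_mem ha.1 hb.1, fun w hw => by
    have h1 := ha.2 _ (hW b hb.1 w hw)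
    have h2 := hb.2 w hw
    have := W2.add_mem h1 h2
    rwa [smul_smul, sub_add_sub_cancel] at this⟩
  inv_mem' := fun {a} ha => ⟨R.inv_mem ha.1, fun w hw => by
    have h1 := ha.2 _ (hW a⁻¹ (R.inv_mem ha.1) w hw)
    rw [smul_inv_smul] at h1
    have := W2.neg_mem h1
    rwa [neg_sub] at this⟩

theorem mem_tk {R : Subgroup Y} {W W2 : AddSubgroup V} {hW : Inv R W} {hW2 : Inv R W2} {x : Y} :
    x ∈ tk R W W2 hW hW2 ↔ x ∈ R ∧ ∀ w ∈ W, x • w - w ∈ W2 := Iff.rfl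

theorem tk_index [Finite V] (R : Subgroup Y) (W W2 : AddSubgroup V) (hW : Inv R W)
    (hW2 : Inv R W2) {q : ℕ} (hq : W2.relIndex W ≤ q) :
    (tk R W W2 hW hW2).relIndex R ≤ q ^ q ∧ (tk R W W2 hW hW2).relIndex R ≠ 0 := by
  classical
  set T := tk R W W2 hW hW2 with hT
  let Q := W ⧸ W2.addSubgroupOf W
  haveI : Finite Q := inferInstanceAs (Finite (W ⧸ W2.addSubgroupOf W))
  have hQ : Nat.card Q ≤ q := hq
  let F : R → (Q → Q) := fun x c => QuotientAddGroup.mk ⟨(x : Y) • (c.out : V), hW x x.2 _ c.out.2⟩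
  have key : ∀ x y : R, F x = F y → x⁻¹ * y ∈ T.subgroupOf R := by
    intro x y hxy
    rw [Subgroup.mem_subgroupOf]
    refine ⟨(x⁻¹ * y).2, fun w hw => ?_⟩
    have h0 := congrFun hxy (QuotientAddGroup.mk (⟨w, hw⟩ : W) : Q)
    obtain ⟨o, ho⟩ : ∃ o, o = (QuotientAddGroup.mk (⟨w, hw⟩ : W) : Q).out := ⟨_, rfl⟩
    have h1 : (QuotientAddGroup.mk o : Q) = QuotientAddGroup.mk (⟨w, hw⟩ : W) := by
      rw [ho]; exact Quotient.out_eq _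
    simp only [F, ← ho] at h0
    have h2 := (QuotientAddGroup.eq).1 h0
    have h3 := (QuotientAddGroup.eq).1 h1
    rw [AddSubgroup.mem_addSubgroupOf] at h2 h3
    simp only [AddSubgroup.coe_add, AddSubgroup.coe_neg] at h2 h3
    have h4 := hW2 ((x : Y)⁻¹) (R.inv_mem x.2) _ h2
    rw [smul_add, smul_neg, inv_smul_smul, smul_smul] at h4
    have h5 := hW2 ((x : Y)⁻¹ * y) (x⁻¹ * y).2 _ h3
    rw [smul_add, smul_neg] at h5
    have := W2.add_mem (W2.sub_mem h4 h3) h5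
    have e : (-(o : V) + (((x : Y)⁻¹ * y)) • (o : V) - (-(o : V) + w)) + (-(((x : Y)⁻¹ * y) • (o : V)) + ((x : Y)⁻¹ * y) • w) = ((x : Y)⁻¹ * y) • w - w := by abel
    rw [e] at this
    simpa using this
  let G : R ⧸ T.subgroupOf R → (Q → Q) := fun c => F c.out
  have hG : Function.Injective G := by
    intro a b hab
    have := key _ _ hab
    have h2 := (QuotientGroup.eq).2 this
    rw [← QuotientGroup.out_eq' a, ← QuotientGroup.out_eq' b]; exact h2
  haveI : Finite (R ⧸ T.subgroupOf R) := Finite.of_injective G hG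
  constructor
  · have h1 := Nat.card_le_card_of_injective G hG
    rw [Nat.card_fun] at h1
    have hpos : 0 < Nat.card Q := Nat.card_pos
    calc T.relIndex R = Nat.card (R ⧸ T.subgroupOf R) := rfl
      _ ≤ _ := h1
      _ ≤ q ^ Nat.card Q := Nat.pow_le_pow_left hQ _
      _ ≤ q ^ q := Nat.pow_le_pow_right (by omega) hQ
  · have : 0 < Nat.card (R ⧸ T.subgroupOf R) := Nat.card_pos
    exact this.ne'

theorem coprime_trivial [Finite V] {x : Y} {s : ℕ} (hs : x ^ s = 1) (hc : Nat.Coprime s (Nat.card V))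
    {w : V} (h : x • (x • w - w) = x • w - w) : x • w = w := by
  have h1 : ∀ j : ℕ, x ^ j • w = w + j • (x • w - w) := by
    intro j
    induction j with
    | zero => simp
    | succ j ih =>
      have e : x • (j • (x • w - w)) = j • (x • w - w) := by
        rw [smul_comm, h]
      rw [pow_succ', mul_smul, ih, smul_add, e, succ_nsmul]; abel
  have h2 := h1 s
  rw [hs, one_smul] at h2
  have h3 : s • (x • w - w) = 0 := by simpa using h2.symm
  have h4 := Nat.dvd_gcd (addOrderOf_dvd_of_nsmul_eq_zero h3) (addOrderOf_dvd_natCard (x • w - w))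
  rw [hc.gcd_eq_one, Nat.dvd_one, AddMonoid.addOrderOf_eq_one_iff] at h4
  exact sub_eq_zero.1 h4

theorem fx_inv (x : Y) : fx V x⁻¹ = fx V x := by
  ext v
  rw [mem_fx, mem_fx, inv_smul_eq_iff, eq_comm]

theorem fx_mul_le (x y : Y) : fx V x ⊓ fx V y ≤ fx V (x * y) := by
  rintro v ⟨h1, h2⟩
  show (x * y) • v = v
  rw [mul_smul, show y • v = v from h2, show x • v = v from h1]

theorem fx_one : fx V (1 : Y) = ⊤ := by
  ext v; simp [mem_fx]

theorem relIndex_ne_zero' [Finite V] (A B : AddSubgroup V) : A.relIndex B ≠ 0 :=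
  AddSubgroup.index_ne_zero_of_finite

theorem relIndex_le_of_le' [Finite V] {A A' : AddSubgroup V} (h : A ≤ A') (B : AddSubgroup V) :
    A'.relIndex B ≤ A.relIndex B :=
  Nat.le_of_dvd (Nat.pos_of_ne_zero (relIndex_ne_zero' _ _)) (AddSubgroup.relIndex_dvd_of_le_left B h)

theorem ix_mul [Finite V] (W : AddSubgroup V) (x y : Y) :
    (fx V (x * y)).relIndex W ≤ (fx V x).relIndex W * (fx V y).relIndex W :=
  (relIndex_le_of_le' (fx_mul_le x y) W).trans (AddSubgroup.relIndex_inf_le ..)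

theorem ix_conj [Finite V] (W : AddSubgroup V) (x y : Y) (h : ∀ w, x • w ∈ W ↔ w ∈ W) :
    (fx V (x * y * x⁻¹)).relIndex W = (fx V y).relIndex W := by
  have e : (fx V (x * y * x⁻¹)) = (fx V y).map (DistribMulAction.toAddMonoidHom V x) := by
    ext v
    rw [mem_fx]
    constructor
    · intro hv
      refine ⟨x⁻¹ • v, ?_, by simp⟩
      show y • x⁻¹ • v = x⁻¹ • v
      rw [eq_inv_smul_iff, smul_smul, smul_smul]; exact hv
    · rintro ⟨u, hu, rfl⟩
      simp only [DistribMulAction.toAddMonoidHom_apply]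
      rw [mul_smul, inv_smul_smul, mul_smul, show y • u = u from hu]
  have e2 : W = W.map (DistribMulAction.toAddMonoidHom V x) := by
    ext v
    constructor
    · intro hv
      refine ⟨x⁻¹ • v, (h _).1 (by simpa using hv), by simp⟩
    · rintro ⟨u, hu, rfl⟩
      exact (h u).2 hu
  conv_lhs => rw [e, e2]
  exact AddSubgroup.relIndex_map_map_of_injective _ _ (MulAction.injective x)
end

section
variable {Y : Type} [Group Y]

/-- a `p`-group acting on a finite set of size prime to `p` has a fixed point -/
theorem pfix {p : ℕ} (hp : p.Prime) [Finite Y] (S : Subgroup Y) (hS : IsPGroup p S) {α : Type*}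
    (act : Y → α → α) (act_one : ∀ a, act 1 a = a) (act_mul : ∀ x y a, act (x * y) a = act x (act y a))
    (F : Set α) (hF : F.Finite) (hinv : ∀ x ∈ S, ∀ a ∈ F, act x a ∈ F) (hM : ¬ p ∣ F.ncard) :
    ∃ a ∈ F, ∀ x ∈ S, act x a = a := by
  haveI := Fact.mk hp
  haveI : Finite F := hF
  letI : MulAction S F :=
    { smul := fun x a => ⟨act x a, hinv x x.2 a a.2⟩
      one_smul := fun a => Subtype.ext (act_one a)
      mul_smul := fun x y a => Subtype.ext (act_mul x y a) }
  obtain ⟨a, ha⟩ := hS.nonempty_fixed_point_of_prime_not_dvd_card F hM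
  exact ⟨a, a.2, fun x hx => congrArg Subtype.val (ha ⟨x, hx⟩)⟩

theorem coset_fix {p : ℕ} (hp : p.Prime) [Finite Y] (S T : Subgroup Y) (hS : IsPGroup p S)
    (hT : ¬ p ∣ Nat.card T) (hST : ∀ x ∈ S, ∀ t ∈ T, x * t * x⁻¹ ∈ T) (s : Y)
    (hs : ∀ x ∈ S, s⁻¹ * (x * s * x⁻¹) ∈ T) : ∃ t ∈ T, ∀ x ∈ S, x * (s * t) * x⁻¹ = s * t := by
  obtain ⟨a, ⟨t, ht, rfl⟩, h⟩ := pfix hp S hS (fun x a => x * a * x⁻¹) (fun a => by simp)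
    (fun x y a => by simp only [mul_inv_rev, mul_assoc]) ((fun t => s * t) '' (T : Set Y)) (Set.toFinite _)
    (by
      rintro x hx _ ⟨t, ht, rfl⟩
      refine ⟨s⁻¹ * (x * s * x⁻¹) * (x * t * x⁻¹), T.mul_mem (hs x hx) (hST x hx t ht), ?_⟩
      group)
    (by
      rw [Set.ncard_image_of_injective _ (mul_right_injective s)]; exact hT)
  exact ⟨t, ht, h⟩

theorem isPGroup_zpowers {p k : ℕ} {d : Y} (hd : d ^ p ^ k = 1) : IsPGroup p (Subgroup.zpowers d) := by
  rintro ⟨x, hx⟩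
  obtain ⟨i, rfl⟩ := Subgroup.mem_zpowers_iff.1 hx
  refine ⟨k, Subtype.ext ?_⟩
  simp only [Subgroup.coe_pow, Subgroup.coe_one]
  rw [← zpow_natCast, ← zpow_mul, mul_comm, zpow_mul, zpow_natCast, hd, one_zpow]

/-- conj action on subgroups -/
def cj (x : Y) (H : Subgroup Y) : Subgroup Y := H.map (MulAut.conj x).toMonoidHom

theorem mem_cj {x y : Y} {H : Subgroup Y} : y ∈ cj x H ↔ x⁻¹ * y * x ∈ H := by
  constructor
  · rintro ⟨h, hh, rfl⟩
    have : x⁻¹ * (x * h * x⁻¹) * x = h := by group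
    simpa [this] using hh
  · intro h
    refine ⟨_, h, ?_⟩
    show x * (x⁻¹ * y * x) * x⁻¹ = y
    group

theorem cj_one (H : Subgroup Y) : cj 1 H = H := by ext; simp [mem_cj]
theorem cj_mul (x y : Y) (H : Subgroup Y) : cj (x * y) H = cj x (cj y H) := by
  ext; simp [mem_cj, mul_assoc]
theorem cj_card (x : Y) (H : Subgroup Y) : Nat.card (cj x H) = Nat.card H :=
  Nat.card_congr ((H.equivMapOfInjective _ (MulAut.conj x).injective).symm.toEquiv)

theorem cj_mono {x : Y} {H K : Subgroup Y} (h : H ≤ K) : cj x H ≤ cj x K := Subgroup.map_mono h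

theorem cj_eq_of_inv [Finite Y] {x : Y} {H : Subgroup Y} (h : ∀ y ∈ H, x * y * x⁻¹ ∈ H) : cj x H = H := by
  apply Subgroup.eq_of_le_of_card_ge
  · rintro _ ⟨y, hy, rfl⟩; exact h y hy
  · rw [cj_card]

theorem mem_of_cj_eq {x : Y} {H : Subgroup Y} (h : cj x H = H) : ∀ y ∈ H, x * y * x⁻¹ ∈ H := by
  intro y hy
  rw [← h, mem_cj]
  have : x⁻¹ * (x * y * x⁻¹) * x = y := by group
  rwa [this]

/-- Sylow subgroup of a subgroup -/
def IsSyl (r : ℕ) (Q R : Subgroup Y) : Prop := R ≤ Q ∧ IsPGroup r R ∧ ¬ r ∣ R.relIndex Q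

theorem isSyl_iff [Finite Y] {r : ℕ} (hr : r.Prime) (Q R : Subgroup Y) :
    IsSyl r Q R ↔ ∃ S : Sylow r Q, R = (S : Subgroup Q).map Q.subtype := by
  haveI := Fact.mk hr
  constructor
  · rintro ⟨h1, h2, h3⟩
    have h4 : IsPGroup r (R.subgroupOf Q) := h2.of_equiv (Subgroup.subgroupOfEquivOfLe h1).symm
    refine ⟨h4.toSylow h3, ?_⟩
    show R = (R.subgroupOf Q).map Q.subtype
    rw [Subgroup.subgroupOf_map_subtype, inf_eq_left.2 h1]
  · rintro ⟨S, rfl⟩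
    refine ⟨Subgroup.map_subtype_le _, S.2.map _, ?_⟩
    have e : ((S : Subgroup Q).map Q.subtype).relIndex Q = (S : Subgroup Q).index := by
      rw [Subgroup.relIndex, Subgroup.subgroupOf, Subgroup.comap_map_eq_self_of_injective Q.subtype_injective]
    rw [e]
    exact S.not_dvd_index

theorem exists_inv_syl {p r : ℕ} (hp : p.Prime) (hr : r.Prime) [Finite Y] (S Q : Subgroup Y)
    (hS : IsPGroup p S) (hQ : ¬ p ∣ Nat.card Q) (hSQ : ∀ x ∈ S, ∀ t ∈ Q, x * t * x⁻¹ ∈ Q) :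
    ∃ R, IsSyl r Q R ∧ ∀ x ∈ S, ∀ t ∈ R, x * t * x⁻¹ ∈ R := by
  haveI := Fact.mk hr
  obtain ⟨R, hR, h⟩ := pfix hp S hS cj cj_one cj_mul {R | IsSyl r Q R} (Set.toFinite _)
    (by
      rintro x hx R ⟨h1, h2, h3⟩
      have hxQ : cj x Q = Q := cj_eq_of_inv (hSQ x hx)
      refine ⟨?_, h2.map _, ?_⟩
      · rw [← hxQ]; exact cj_mono h1
      · have : (cj x R).relIndex (cj x Q) = R.relIndex Q :=
          Subgroup.relIndex_map_map_of_injective _ _ (MulAut.conj x).injective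
        rw [hxQ] at this
        rwa [this])
    (by
      have e : {R | IsSyl r Q R} = Set.range (fun S : Sylow r Q => (S : Subgroup Q).map Q.subtype) := by
        ext R
        simp only [Set.mem_setOf_eq, isSyl_iff hr, Set.mem_range, eq_comm]
      rw [e]
      have e2 : (Set.range (fun S : Sylow r Q => (S : Subgroup Q).map Q.subtype)).ncard = Nat.card (Sylow r Q) := by
        rw [← Set.image_univ, Set.ncard_image_of_injective, Set.ncard_univ]
        intro S T h
        exact Sylow.ext (Subgroup.map_injective Q.subtype_injective h)
      rw [e2]
      intro h
      have := (h.trans (Sylow.card_dvd_index (default : Sylow r Q))).trans (Subgroup.index_dvd_card _)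
      exact hQ this)
  exact ⟨R, hR, fun x hx => mem_of_cj_eq (h x hx)⟩

theorem syl_conj {r : ℕ} (hr : r.Prime) [Finite Y] {Q R R' : Subgroup Y} (h : IsSyl r Q R) (h' : IsSyl r Q R') :
    ∃ g ∈ Q, cj g R = R' := by
  haveI := Fact.mk hr
  obtain ⟨S, rfl⟩ := (isSyl_iff hr _ _).1 h
  obtain ⟨S', rfl⟩ := (isSyl_iff hr _ _).1 h'
  obtain ⟨g, hg⟩ := MulAction.exists_smul_eq Q S S'
  refine ⟨g, g.2, ?_⟩
  rw [← hg]
  ext y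
  rw [mem_cj]
  constructor
  · rintro ⟨a, ha, hay⟩
    refine ⟨g * a * g⁻¹, ?_, ?_⟩
    · exact ⟨a, ha, rfl⟩
    · simp only [Subgroup.coe_subtype] at hay
      simp [hay, mul_assoc]
  · rintro ⟨_, ⟨a, ha, rfl⟩, rfl⟩
    refine ⟨a, ha, ?_⟩
    simp [mul_assoc]
end
end PLen


namespace PLen
section
variable {Y V : Type} [Group Y] [AddCommGroup V] [DistribMulAction Y V]

theorem cl_ncard_le_of_sub [Finite Y] (R R2 : Subgroup Y) (d : Y) (h : R2 ≤ R) {q g : ℕ}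
    (h1 : R2.relIndex R ≤ q) (h2 : (cl R2 d).ncard ≤ g) : (cl R d).ncard ≤ q * g := by
  classical
  have e : cl R d ⊆ ⋃ c : R ⧸ R2.subgroupOf R, (fun y => (c.out : Y) * y * (c.out : Y)⁻¹) '' cl R2 d := by
    rintro _ ⟨x, hx, rfl⟩
    let c : R ⧸ R2.subgroupOf R := QuotientGroup.mk ⟨x, hx⟩
    have hc : (QuotientGroup.mk c.out : R ⧸ R2.subgroupOf R) = QuotientGroup.mk ⟨x, hx⟩ :=
      QuotientGroup.out_eq' c
    have h3 := (QuotientGroup.eq).1 hc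
    rw [Subgroup.mem_subgroupOf] at h3
    refine Set.mem_iUnion.2 ⟨c, ((c.out : Y)⁻¹ * x) * d * ((c.out : Y)⁻¹ * x)⁻¹, ⟨_, h3, rfl⟩, ?_⟩
    simp only; group
  haveI : Fintype (R ⧸ R2.subgroupOf R) := Fintype.ofFinite _
  calc (cl R d).ncard ≤ _ := Set.ncard_le_ncard e (Set.toFinite _)
    _ ≤ ∑ c : R ⧸ R2.subgroupOf R, ((fun y => (c.out : Y) * y * (c.out : Y)⁻¹) '' cl R2 d).ncard := by
        have := Finset.set_ncard_biUnion_le (Finset.univ : Finset (R ⧸ R2.subgroupOf R))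
          (fun c => (fun y => (c.out : Y) * y * (c.out : Y)⁻¹) '' cl R2 d)
        simpa using this
    _ ≤ ∑ c : R ⧸ R2.subgroupOf R, g := Finset.sum_le_sum fun c _ => (Set.ncard_image_le (Set.toFinite _)).trans h2
    _ = Nat.card (R ⧸ R2.subgroupOf R) * g := by simp [Nat.card_eq_fintype_card]
    _ ≤ q * g := Nat.mul_le_mul_right _ h1

/-- central-type element -/
theorem exists_central {r : ℕ} [Finite Y] (hr : r.Prime) (R : Subgroup Y) (hR : IsPGroup r R) (d : Y)
    (hd : ∀ x ∈ R, d * x * d⁻¹ ∈ R) (hgen : ∀ H : Subgroup Y, (∀ x ∈ R, x * d * x⁻¹ * d⁻¹ ∈ H) → R ≤ H)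
    (hne : R ≠ ⊥) :
    ∃ z ∈ R, z ≠ 1 ∧ (∀ x ∈ R, x * z = z * x) ∧ ∃ a ∈ R,
      (z = a * d * a⁻¹ * d⁻¹ ∨ ∃ u ∈ R, z = (a * d * a⁻¹ * d⁻¹) * u * (a * d * a⁻¹ * d⁻¹)⁻¹ * u⁻¹) := by
  haveI := Fact.mk hr
  by_cases hall : ∀ a ∈ R, (∀ g ∈ R, ∀ h ∈ R, (a * g * a⁻¹ * g⁻¹) * h = h * (a * g * a⁻¹ * g⁻¹)) → a * d = d * a
  · exfalso
    -- the center
    have hcomm : ∀ x ∈ R, ∀ y ∈ R, x * y = y * x := by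
      by_contra hcon
      push Not at hcon
      obtain ⟨x0, hx0, y0, hy0, hxy⟩ := hcon
      haveI hnt : Nontrivial (R ⧸ Subgroup.center R) := by
        rw [QuotientGroup.nontrivial_iff]
        intro ht
        have : (⟨x0, hx0⟩ : R) ∈ Subgroup.center R := by rw [ht]; trivial
        have := Subgroup.mem_center_iff.1 this ⟨y0, hy0⟩
        exact hxy (congrArg Subtype.val this).symm
      haveI := (hR.to_quotient (Subgroup.center R)).center_nontrivial
      obtain ⟨⟨c, hc⟩, hc1⟩ := exists_ne (1 : Subgroup.center (R ⧸ Subgroup.center R))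
      obtain ⟨a, rfl⟩ := QuotientGroup.mk_surjective c
      have hac : a ∉ Subgroup.center R := by
        intro h
        apply hc1
        apply Subtype.ext
        exact (QuotientGroup.eq_one_iff _).2 h
      have hcen : ∀ g : R, a * g * a⁻¹ * g⁻¹ ∈ Subgroup.center R := by
        intro g
        have h := Subgroup.mem_center_iff.1 hc (QuotientGroup.mk g)
        rw [← QuotientGroup.eq_one_iff]
        show (a : R ⧸ Subgroup.center R) * g * (a : R ⧸ Subgroup.center R)⁻¹ * (g : R ⧸ Subgroup.center R)⁻¹ = 1
        rw [← h]; group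
      have hcen' : ∀ g ∈ R, ∀ h ∈ R, ((a : Y) * g * (a : Y)⁻¹ * g⁻¹) * h = h * (a * g * (a : Y)⁻¹ * g⁻¹) := by
        intro g hg h hh
        have := Subgroup.mem_center_iff.1 (hcen ⟨g, hg⟩) ⟨h, hh⟩
        exact (congrArg Subtype.val this).symm
      have had : (a : Y) * d = d * a := hall a a.2 hcen'
      have hzd : ∀ g ∈ R, ((a : Y) * g * (a : Y)⁻¹ * g⁻¹) * d = d * (a * g * (a : Y)⁻¹ * g⁻¹) := by
        intro g hg
        apply hall _ (R.mul_mem (R.mul_mem (R.mul_mem a.2 hg) (R.inv_mem a.2)) (R.inv_mem hg))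
        intro g' hg' h hh
        generalize hkk : (a : Y) * g * (a : Y)⁻¹ * g⁻¹ = k
        have := hcen' g hg g' hg'
        rw [hkk] at this
        rw [this]
        group
      -- a commutes with generators
      have : R ≤ Subgroup.centralizer {(a : Y)} := by
        apply hgen
        intro x hx
        rw [Subgroup.mem_centralizer_singleton_iff]
        set k := (a : Y) * x * (a : Y)⁻¹ * x⁻¹ with hk
        have e1 : (a : Y) * x = k * x * a := by rw [hk]; group
        have e2 : (a : Y) * x⁻¹ = x⁻¹ * k⁻¹ * a := by rw [hk]; group
        have e3 : k * d = d * k := hzd x hx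
        have e4 : (a : Y) * d⁻¹ = d⁻¹ * a := by
          rw [mul_inv_eq_iff_eq_mul, mul_assoc, had]; group
        have e5 : k * x = x * k := hcen' x hx x hx
        have : (a : Y) * (x * d * x⁻¹ * d⁻¹) = x * d * x⁻¹ * d⁻¹ * a := by
          calc (a : Y) * (x * d * x⁻¹ * d⁻¹) = ((a : Y) * x) * d * x⁻¹ * d⁻¹ := by group
            _ = x * k * ((a : Y) * d) * x⁻¹ * d⁻¹ := by rw [e1, e5]; group
            _ = x * (k * d) * ((a : Y) * x⁻¹) * d⁻¹ := by rw [had]; group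
            _ = x * d * k * x⁻¹ * k⁻¹ * (a * d⁻¹) := by rw [e3, e2]; group
            _ = x * d * ((x⁻¹ * (x * k) * x⁻¹)) * k⁻¹ * (a * d⁻¹) := by group
            _ = x * d * x⁻¹ * d⁻¹ * a := by rw [← e5, e4]; group
        exact this.symm
      apply hac
      rw [Subgroup.mem_center_iff]
      intro g
      have := Subgroup.mem_centralizer_singleton_iff.1 (this g.2)
      exact Subtype.ext this
    apply hne
    rw [eq_bot_iff]
    apply hgen
    intro x hx
    have h1 := hall x hx (fun g hg h hh => by
      rw [hcomm x hx g hg]; simp)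
    rw [Subgroup.mem_bot, h1]; group
  · push Not at hall
    obtain ⟨a, ha, hZ, hne'⟩ := hall
    set y := a * d * a⁻¹ * d⁻¹ with hy
    have hyR : y ∈ R := by
      have := R.mul_mem ha (hd _ (R.inv_mem ha))
      have e : a * (d * a⁻¹ * d⁻¹) = y := by rw [hy]; group
      rwa [e] at this
    have hy1 : y ≠ 1 := by
      intro h
      apply hne'
      have : a * d = y * d * a := by rw [hy]; group
      rw [this, h]; group
    by_cases hc : ∀ x ∈ R, x * y = y * x
    · exact ⟨y, hyR, hy1, hc, a, ha, Or.inl rfl⟩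
    · push Not at hc
      obtain ⟨u, hu, huy⟩ := hc
      refine ⟨y * u * y⁻¹ * u⁻¹, R.mul_mem (R.mul_mem (R.mul_mem hyR hu) (R.inv_mem hyR)) (R.inv_mem hu),
        ?_, ?_, a, ha, Or.inr ⟨u, hu, rfl⟩⟩
      · intro h
        apply huy
        have : y * u = (y * u * y⁻¹ * u⁻¹) * u * y := by group
        rw [this, h]; group
      · -- y in Z_2
        let Z : Subgroup Y := R ⊓ Subgroup.centralizer (R : Set Y)
        have hZm : ∀ x, x ∈ Z ↔ x ∈ R ∧ ∀ h ∈ R, h * x = x * h := by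
          intro x
          rw [Subgroup.mem_inf, Subgroup.mem_centralizer_iff]; rfl
        have hd' : ∀ x ∈ R, d⁻¹ * x * d ∈ R := by
          intro x hx
          have h := cj_eq_of_inv hd
          rw [← h, mem_cj] at hx; exact hx
        have hconj : ∀ x ∈ Z, d * x * d⁻¹ ∈ Z := by
          intro x hx
          rw [hZm] at hx ⊢
          refine ⟨hd x hx.1, fun h hh => ?_⟩
          have := hx.2 _ (hd' h hh)
          calc h * (d * x * d⁻¹) = d * ((d⁻¹ * h * d) * x) * d⁻¹ := by group
            _ = _ := by rw [this]; group
        have haZ : ∀ g ∈ R, a * g * a⁻¹ * g⁻¹ ∈ Z := by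
          intro g hg
          rw [hZm]
          exact ⟨R.mul_mem (R.mul_mem (R.mul_mem ha hg) (R.inv_mem ha)) (R.inv_mem hg), fun h hh => (hZ g hg h hh).symm⟩
        have key : y * u * y⁻¹ * u⁻¹ ∈ Z := by
          -- with b = d a⁻¹ d⁻¹ ; y = a b
          have hb : ∀ g ∈ R, (d * a * d⁻¹) * g * (d * a * d⁻¹)⁻¹ * g⁻¹ ∈ Z := by
            intro g hg
            have := hconj _ (haZ _ (hd' g hg))
            have e : d * (a * (d⁻¹ * g * d) * a⁻¹ * (d⁻¹ * g * d)⁻¹) * d⁻¹ = (d * a * d⁻¹) * g * (d * a * d⁻¹)⁻¹ * g⁻¹ := by group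
            rwa [e] at this
          set b := d * a * d⁻¹ with hbdef
          have hyb : y = a * b⁻¹ := by rw [hy, hbdef]; group
          have hbR : b ∈ R := hd a ha
          -- [b⁻¹,u]
          have h1 := hb (b⁻¹ * u * b) (R.mul_mem (R.mul_mem (R.inv_mem hbR) hu) hbR)
          have h2 : b⁻¹ * u * b * u⁻¹ ∈ Z := by
            have e : b * (b⁻¹ * u * b) * b⁻¹ * (b⁻¹ * u * b)⁻¹ = (b⁻¹ * u * b * u⁻¹)⁻¹ := by group
            rw [e] at h1
            exact (Subgroup.inv_mem_iff _).1 h1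
          have h3 := haZ u hu
          have h4 : y * u * y⁻¹ * u⁻¹ = (a * (b⁻¹ * u * b * u⁻¹) * a⁻¹) * (a * u * a⁻¹ * u⁻¹) := by
            rw [hyb]; group
          rw [h4, ((hZm _).1 h2).2 a ha]
          have e : b⁻¹ * u * b * u⁻¹ * a * a⁻¹ = b⁻¹ * u * b * u⁻¹ := by group
          rw [e]
          exact Z.mul_mem h2 h3
        exact ((hZm _).1 key).2

theorem strict_ix [Finite V] {H W W2 : AddSubgroup V} (hle : W2 ≤ W) (h : H.relIndex W ≤ H.relIndex W2) :
    W ≤ (H ⊓ W) ⊔ W2 := by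
  have h1 : (H ⊓ W).relIndex ((H ⊓ W) ⊔ W2) * ((H ⊓ W) ⊔ W2).relIndex W = (H ⊓ W).relIndex W :=
    AddSubgroup.relIndex_mul_relIndex _ _ _ le_sup_left (sup_le inf_le_right hle)
  have h2 : (H ⊓ W).relIndex ((H ⊓ W) ⊔ W2) = (H ⊓ W).relIndex W2 := by
    rw [sup_comm]; exact AddSubgroup.relIndex_sup_right _ _
  have h3 : (H ⊓ W).relIndex W = H.relIndex W := AddSubgroup.inf_relIndex_right _ _
  have h4 : (H ⊓ W).relIndex W2 = H.relIndex W2 := by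
    rw [← AddSubgroup.inf_relIndex_right (H ⊓ W) W2, inf_assoc, inf_eq_right.2 hle, AddSubgroup.inf_relIndex_right]
  rw [h2, h3, h4] at h1
  have h5 : H.relIndex W2 ≠ 0 := relIndex_ne_zero' _ _
  have h6 : ((H ⊓ W) ⊔ W2).relIndex W ≠ 0 := relIndex_ne_zero' _ _
  have : ((H ⊓ W) ⊔ W2).relIndex W = 1 := by
    have : 0 < H.relIndex W2 := Nat.pos_of_ne_zero h5
    nlinarith [Nat.pos_of_ne_zero h6]
  exact AddSubgroup.relIndex_eq_one.1 this

end

theorem lemLr {p : ℕ} (hp : p.Prime) (N : ℕ) : ∃ g : ℕ, ∀ (Y V : Type) [Group Y] [Finite Y] [AddCommGroup V] [Finite V]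
    [DistribMulAction Y V] (r : ℕ) (hr : r.Prime) (hrp : r ≠ p) (hrV : Nat.Coprime r (Nat.card V)) (d : Y) (hdp : d ^ p = 1)
    (n : ℕ) (R : Subgroup Y) (hn : Nat.card R ≤ n) (hR : IsPGroup r R) (hd : ∀ x ∈ R, d * x * d⁻¹ ∈ R) (W : AddSubgroup V) (hRW : Inv R W)
    (hdW : ∀ w ∈ W, d • w ∈ W) (hf : ∀ x ∈ R, (∀ w ∈ W, x • w = w) → x = 1)
    (hN : (fx V d).relIndex W ≤ N), (cl R d).ncard ≤ g := by
  induction N with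
  | zero =>
    refine ⟨0, ?_⟩
    intro Y V _ _ _ _ _ r hr hrp hrV d hdp n R hn hR hd W hRW hdW hf hN
    exact absurd (Nat.le_zero.1 hN) (relIndex_ne_zero' _ _)
  | succ N ihN =>
    obtain ⟨g, hg⟩ := ihN
    let q := ((N + 1) ^ 4) ^ p
    refine ⟨q ^ q * g + 1, ?_⟩
    intro Y V _ _ _ _ _ r hr hrp hrV d hdp n
    induction n with
    | zero => intro R hn; have := Nat.card_pos (α := R); omega
    | succ n ihn =>
    intro R hn hR hd W hRW hdW hf hN
    have hpr : ¬ p ∣ Nat.card R := by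
      haveI := Fact.mk hr
      obtain ⟨k, hk⟩ := IsPGroup.iff_card.1 hR
      rw [hk]
      intro h
      exact hrp ((Nat.prime_dvd_prime_iff_eq hp hr).1 (hp.dvd_of_dvd_pow h)).symm
    set R3 : Subgroup Y := Subgroup.closure {y | ∃ x ∈ R, y = x * d * x⁻¹ * d⁻¹} with hR3
    have hR3R : R3 ≤ R := by
      rw [hR3, Subgroup.closure_le]
      rintro _ ⟨x, hx, rfl⟩
      have := R.mul_mem hx (hd _ (R.inv_mem hx))
      have e : x * (d * x⁻¹ * d⁻¹) = x * d * x⁻¹ * d⁻¹ := by group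
      rwa [e] at this
    have hd3 : ∀ x ∈ R3, d * x * d⁻¹ ∈ R3 := by
      intro x hx
      have : R3 ≤ R3.comap (MulAut.conj d).toMonoidHom := by
        conv_lhs => rw [hR3]
        rw [Subgroup.closure_le]
        rintro _ ⟨x, hx, rfl⟩
        apply Subgroup.subset_closure
        refine ⟨d * x * d⁻¹, hd x hx, ?_⟩
        show d * (x * d * x⁻¹ * d⁻¹) * d⁻¹ = _
        group
      exact this hx
    by_cases h3 : R3 = R
    · by_cases hbot : R = ⊥
      · have : cl R d ⊆ {d} := by
          rw [hbot]
          rintro _ ⟨x, hx, rfl⟩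
          have : x = 1 := hx
          simp [this]
        have := Set.ncard_le_ncard this (Set.toFinite _)
        rw [Set.ncard_singleton] at this
        omega
      have hgen : ∀ H : Subgroup Y, (∀ x ∈ R, x * d * x⁻¹ * d⁻¹ ∈ H) → R ≤ H := by
        intro H hH
        rw [← h3, hR3, Subgroup.closure_le]
        rintro _ ⟨x, hx, rfl⟩
        exact hH x hx
      obtain ⟨z, hzR, hz1, hzc, a, ha, hza⟩ := exists_central hr R hR d hd hgen hbot
      have stab : ∀ x ∈ R, ∀ w, x • w ∈ W ↔ w ∈ W := by
        intro x hx w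
        refine ⟨fun h => ?_, hRW x hx w⟩
        have := hRW _ (R.inv_mem hx) _ h
        rwa [inv_smul_smul] at this
      have hdinv : d⁻¹ = d ^ (p - 1) := by
        rw [inv_eq_iff_mul_eq_one, ← pow_succ', Nat.sub_add_cancel hp.one_le, hdp]
      have hdpw : ∀ k : ℕ, ∀ w ∈ W, d ^ k • w ∈ W := by
        intro k
        induction k with
        | zero => intro w hw; simpa using hw
        | succ k ih => intro w hw; rw [pow_succ', mul_smul]; exact hdW _ (ih w hw)
      have stabd : ∀ k : ℕ, ∀ w, d ^ k • w ∈ W ↔ w ∈ W := by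
        intro k w
        refine ⟨fun h => ?_, hdpw k w⟩
        have := hdpw ((p - 1) * k) _ h
        rwa [pow_mul, ← hdinv, smul_smul, inv_pow, inv_mul_cancel, one_smul] at this
      have ixy : (fx V (a * d * a⁻¹ * d⁻¹)).relIndex W ≤ (N + 1) ^ 2 := by
        refine (ix_mul W _ _).trans ?_
        rw [ix_conj W a d (stab a ha), fx_inv, sq]
        exact Nat.mul_le_mul hN hN
      have ixz : (fx V z).relIndex W ≤ (N + 1) ^ 4 := by
        rcases hza with rfl | ⟨u, hu, rfl⟩
        · exact ixy.trans (Nat.pow_le_pow_right (by omega) (by omega))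
        · have e : (a * d * a⁻¹ * d⁻¹) * u * (a * d * a⁻¹ * d⁻¹)⁻¹ * u⁻¹ = (a * d * a⁻¹ * d⁻¹) * (u * (a * d * a⁻¹ * d⁻¹)⁻¹ * u⁻¹) := by group
          rw [e]
          refine (ix_mul W _ _).trans ?_
          rw [ix_conj W u _ (stab u hu), fx_inv, show 4 = 2 + 2 from rfl, pow_add]
          exact Nat.mul_le_mul ixy ixy
      let W2 : AddSubgroup V := W ⊓ ⨅ i : Fin p, fx V (d ^ (i : ℕ) * z * (d ^ (i : ℕ))⁻¹)
      have hpmod : ∀ i : ℕ, d ^ i = d ^ (i % p) := by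
        intro i
        conv_lhs => rw [← Nat.mod_add_div i p, pow_add, pow_mul, hdp, one_pow, mul_one]
      have memW2 : ∀ w, w ∈ W2 ↔ w ∈ W ∧ ∀ i : ℕ, (d ^ i * z * (d ^ i)⁻¹) • w = w := by
        intro w
        simp only [W2, AddSubgroup.mem_inf, AddSubgroup.mem_iInf, mem_fx]
        refine and_congr Iff.rfl ⟨fun h i => ?_, fun h i => h i⟩
        rw [hpmod i]; exact h ⟨i % p, Nat.mod_lt _ hp.pos⟩
      have hW2W : W2 ≤ W := inf_le_left
      have hidx : W2.relIndex W ≤ q := by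
        have h1 : W2.relIndex W = (⨅ i : Fin p, fx V (d ^ (i : ℕ) * z * (d ^ (i : ℕ))⁻¹)).relIndex W := by
          show (W ⊓ _).relIndex W = _
          rw [inf_comm, AddSubgroup.inf_relIndex_right]
        rw [h1]
        refine (AddSubgroup.relIndex_iInf_le _).trans ?_
        calc _ ≤ ∏ i : Fin p, (N + 1) ^ 4 := Finset.prod_le_prod' fun i _ => by
              rw [ix_conj W _ _ (stabd i)]; exact ixz
          _ = q := by simp [q]
      have hdR : ∀ i : ℕ, ∀ x ∈ R, d ^ i * x * (d ^ i)⁻¹ ∈ R := by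
        intro i
        induction i with
        | zero => intro x hx; simpa using hx
        | succ i ih =>
          intro x hx
          have := hd _ (ih x hx)
          have e : d * (d ^ i * x * (d ^ i)⁻¹) * d⁻¹ = d ^ (i + 1) * x * (d ^ (i + 1))⁻¹ := by
            rw [pow_succ']; group
          rwa [e] at this
      have hdR' : ∀ i : ℕ, ∀ x ∈ R, (d ^ i)⁻¹ * x * d ^ i ∈ R := by
        intro i x hx
        have := hdR ((p - 1) * i) x hx
        rw [pow_mul, ← hdinv, inv_pow, inv_inv] at this
        exact this
      have hW2R : Inv R W2 := by
        intro x hx w hw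
        rw [memW2] at hw ⊢
        refine ⟨hRW x hx w hw.1, fun i => ?_⟩
        have hc := hzc _ (hdR' i x hx)
        have e : (d ^ i * z * (d ^ i)⁻¹) * x = x * (d ^ i * z * (d ^ i)⁻¹) := by
          calc (d ^ i * z * (d ^ i)⁻¹) * x = d ^ i * (z * ((d ^ i)⁻¹ * x * d ^ i)) * (d ^ i)⁻¹ := by group
            _ = _ := by rw [← hc]; group
        rw [smul_smul, e, mul_smul, hw.2 i]
      have hW2d : ∀ w ∈ W2, d • w ∈ W2 := by
        intro w hw
        rw [memW2] at hw ⊢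
        refine ⟨hdW w hw.1, fun i => ?_⟩
        have h1 := hw.2 ((p - 1) + i)
        rw [pow_add, ← hdinv] at h1
        have e : d⁻¹ * d ^ i * z * (d⁻¹ * d ^ i)⁻¹ = d⁻¹ * ((d ^ i * z * (d ^ i)⁻¹) * d) := by group
        rw [e, mul_smul, inv_smul_eq_iff] at h1
        rw [smul_smul]; exact h1
      have hcopR : ∀ x ∈ R, (∀ w ∈ W, x • w - w ∈ W2) → (∀ w ∈ W2, x • w = w) → x = 1 := by
        intro x hx h1 h2
        apply hf x hx
        intro w hw
        obtain ⟨k, hk⟩ := hR ⟨x, hx⟩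
        have hk' : x ^ r ^ k = 1 := congrArg Subtype.val hk
        exact coprime_trivial hk' (Nat.Coprime.pow_left _ hrV) (h2 _ (h1 w hw))
      have hlt : (fx V d).relIndex W2 < (fx V d).relIndex W := by
        by_contra hcon
        push Not at hcon
        have hle := strict_ix hW2W hcon
        have hdt : ∀ w ∈ W, d • w - w ∈ W2 := by
          intro w hw
          obtain ⟨h, hh, w2, hw2, rfl⟩ := AddSubgroup.mem_sup.1 (hle hw)
          have e : d • (h + w2) - (h + w2) = d • w2 - w2 := by
            rw [smul_add, show d • h = h from hh.1]; abel
          rw [e]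
          exact W2.sub_mem (hW2d _ hw2) hw2
        have hRt : R ≤ tk R W W2 hRW hW2R := by
          apply hgen
          intro x hx
          refine ⟨?_, fun w hw => ?_⟩
          · have := R.mul_mem hx (hd _ (R.inv_mem hx))
            have e : x * (d * x⁻¹ * d⁻¹) = x * d * x⁻¹ * d⁻¹ := by group
            rwa [e] at this
          · have hw' : d⁻¹ • w ∈ W := by rw [hdinv]; exact hdpw _ _ hw
            have a1 := hdt _ hw'
            rw [smul_inv_smul] at a1
            have a2 := hdt _ (hRW _ (R.inv_mem hx) _ hw')
            have a3 := hW2R x hx _ a2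
            rw [smul_sub, smul_inv_smul, smul_smul, smul_smul, smul_smul] at a3
            have := W2.sub_mem a3 a1
            rwa [sub_sub_sub_cancel_right] at this
        apply hz1
        apply hcopR z hzR (hRt hzR).2
        intro w hw
        have := ((memW2 w).1 hw).2 0
        simpa using this
      set R2 := tk R W W2 hRW hW2R with hR2
      have hR2R : R2 ≤ R := fun x hx => hx.1
      have hcl2 : (cl R2 d).ncard ≤ g := by
        refine hg Y V r hr hrp hrV d hdp _ R2 le_rfl (hR.to_le hR2R) ?_ W2 (fun x hx => hW2R x (hR2R hx)) hW2d ?_ (by omega)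
        · intro x hx
          refine ⟨hd x hx.1, fun w hw => ?_⟩
          have hw' : d⁻¹ • w ∈ W := by rw [hdinv]; exact hdpw _ _ hw
          have a1 := hW2d _ (hx.2 _ hw')
          rw [smul_sub, smul_inv_smul, smul_smul, smul_smul] at a1
          exact a1
        · intro x hx h2
          exact hcopR x hx.1 hx.2 h2
      have := cl_ncard_le_of_sub R R2 d hR2R (tk_index R W W2 hRW hW2R hidx).1 hcl2
      omega
    · -- reduce to R3
      have hclsub : cl R d ⊆ cl R3 d := by
        rintro _ ⟨s, hs, rfl⟩
        -- coset R3 s is d-invariant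
        have hp3 : ¬ p ∣ Nat.card R3 := fun h => hpr (h.trans (Subgroup.card_dvd_of_le hR3R))
        have hin : ∀ x ∈ Subgroup.zpowers d, ∀ t ∈ R3, x * t * x⁻¹ ∈ R3 := by
          intro x hx
          have h1 : Subgroup.zpowers d ≤ Subgroup.normalizer (R3 : Set Y) := by
            rw [Subgroup.zpowers_le]
            have := cj_eq_of_inv hd3
            rw [Subgroup.mem_normalizer_iff]
            intro h
            constructor
            · exact hd3 h
            · intro hh
              rw [← this, mem_cj] at hh
              have e : d⁻¹ * (d * h * d⁻¹) * d = h := by group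
              rwa [e] at hh
          intro t ht
          exact (Subgroup.mem_normalizer_iff.1 (h1 hx) t).1 ht
        have hsx : ∀ x ∈ Subgroup.zpowers d, s⁻¹⁻¹ * (x * s⁻¹ * x⁻¹) ∈ R3 := by
          intro x hx
          obtain ⟨k, rfl⟩ : ∃ k : ℕ, d ^ k = x := mem_powers_iff_mem_zpowers.2 hx
          clear hx
          induction k with
          | zero => simp
          | succ k ih =>
            have a1 : s * d * s⁻¹ * d⁻¹ ∈ R3 := Subgroup.subset_closure ⟨s, hs, rfl⟩
            have a2 := hd3 _ ih
            have := R3.mul_mem a1 a2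
            have e : s * d * s⁻¹ * d⁻¹ * (d * (s⁻¹⁻¹ * (d ^ k * s⁻¹ * (d ^ k)⁻¹)) * d⁻¹) = s⁻¹⁻¹ * (d ^ (k + 1) * s⁻¹ * (d ^ (k + 1))⁻¹) := by
              rw [pow_succ']; group
            rwa [e] at this
        obtain ⟨t, ht, hfix⟩ := coset_fix hp (Subgroup.zpowers d) R3 (isPGroup_zpowers (p := p) (k := 1) (by rw [pow_one]; exact hdp))
          hp3 hin s⁻¹ hsx
        have h1 := hfix d (Subgroup.mem_zpowers d)
        -- s⁻¹ t commutes with d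
        refine ⟨t, ht, ?_⟩
        show t * d * t⁻¹ = s * d * s⁻¹
        have h2 : d * (s⁻¹ * t) = s⁻¹ * t * d := by
          rw [mul_inv_eq_iff_eq_mul] at h1; exact h1
        calc t * d * t⁻¹ = s * (s⁻¹ * t * d) * t⁻¹ := by group
          _ = _ := by rw [← h2]; group
      refine (Set.ncard_le_ncard hclsub (Set.toFinite _)).trans ?_
      refine ihn R3 ?_ (hR.to_le hR3R) hd3 W (fun x hx => hRW x (hR3R hx)) hdW (fun x hx => hf x (hR3R hx)) hN
      by_contra hcon
      exact h3 (Subgroup.eq_of_le_of_card_ge hR3R (by omega))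
end PLen


namespace PLen
section
variable {Y : Type} [Group Y]

theorem card_mul_relIndex' {H K : Subgroup Y} (h : H ≤ K) : Nat.card H * H.relIndex K = Nat.card K := by
  rw [← Subgroup.card_mul_index (H.subgroupOf K), Nat.card_congr (Subgroup.subgroupOfEquivOfLe h).toEquiv]; rfl

theorem cl_ncard (R : Subgroup Y) (d : Y) : (cl R d).ncard = (Subgroup.centralizer {d}).relIndex R := by
  have key : ∀ x y : Y, x * d * x⁻¹ = y * d * y⁻¹ ↔ x⁻¹ * y ∈ Subgroup.centralizer {d} := by
    intro x y
    rw [Subgroup.mem_centralizer_singleton_iff]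
    constructor
    · intro h
      calc x⁻¹ * y * d = x⁻¹ * (y * d * y⁻¹) * y := by group
        _ = _ := by rw [← h]; group
    · intro h
      calc x * d * x⁻¹ = x * (d * (x⁻¹ * y)) * y⁻¹ := by group
        _ = _ := by rw [← h]; group
  let f : R ⧸ (Subgroup.centralizer {d}).subgroupOf R → cl R d :=
    fun c => ⟨(c.out : Y) * d * (c.out : Y)⁻¹, ⟨_, c.out.2, rfl⟩⟩
  have hf : Function.Bijective f := by
    constructor
    · intro a b hab
      have := (key _ _).1 (congrArg Subtype.val hab)
      rw [← QuotientGroup.out_eq' a, ← QuotientGroup.out_eq' b]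
      apply (QuotientGroup.eq).2
      rw [Subgroup.mem_subgroupOf]
      exact this
    · rintro ⟨_, x, hx, rfl⟩
      refine ⟨QuotientGroup.mk ⟨x, hx⟩, Subtype.ext ?_⟩
      simp only [f]
      rw [key]
      have := (QuotientGroup.eq).1 (QuotientGroup.out_eq' (QuotientGroup.mk (⟨x, hx⟩ : R) : R ⧸ (Subgroup.centralizer {d}).subgroupOf R))
      rw [Subgroup.mem_subgroupOf] at this
      exact this
  have := Nat.card_congr (Equiv.ofBijective f hf)
  exact this.symm

theorem cl_mul_card (R : Subgroup Y) (d : Y) :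
    (cl R d).ncard * Nat.card (Subgroup.centralizer {d} ⊓ R : Subgroup Y) = Nat.card R := by
  rw [cl_ncard, ← Subgroup.inf_relIndex_right, mul_comm]
  exact card_mul_relIndex' inf_le_right

theorem cl_nonempty (R : Subgroup Y) (d : Y) : d ∈ cl R d := ⟨1, R.one_mem, by simp⟩
end

theorem lemL {p : ℕ} (hp : p.Prime) (N : ℕ) : ∃ g : ℕ, ∀ (Y V : Type) [Group Y] [Finite Y] [AddCommGroup V] [Finite V]
    [DistribMulAction Y V] (a : ℕ) (hV : Nat.card V = p ^ a) (d : Y) (hdp : d ^ p = 1)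
    (Q : Subgroup Y) (hQ : ¬ p ∣ Nat.card Q) (hd : ∀ x ∈ Q, d * x * d⁻¹ ∈ Q)
    (hf : ∀ x ∈ Q, (∀ w : V, x • w = w) → x = 1)
    (hN : (fx V d).index ≤ N), (cl Q d).ncard ≤ g := by
  obtain ⟨g, hg⟩ := lemLr hp N
  refine ⟨g.factorial, ?_⟩
  intro Y V _ _ _ _ _ a hV d hdp Q hQ hd hf hN
  apply Nat.le_of_dvd (Nat.factorial_pos _)
  rw [Nat.dvd_iff_prime_pow_dvd_dvd]
  intro r k hr hk
  by_cases hrp : r = p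
  · subst hrp
    rcases Nat.eq_zero_or_pos k with rfl | hk0
    · simp
    · exfalso
      apply hQ
      rw [← cl_mul_card Q d]
      exact ((dvd_pow_self r hk0.ne').trans hk).mul_right _
  apply Nat.dvd_factorial (pow_pos hr.pos _)
  have hz : ∀ x ∈ Subgroup.zpowers d, ∀ t ∈ Q, x * t * x⁻¹ ∈ Q := by
    intro x hx
    obtain ⟨k, rfl⟩ : ∃ k : ℕ, d ^ k = x := mem_powers_iff_mem_zpowers.2 hx
    clear hx
    induction k with
    | zero => intro t ht; simpa using ht
    | succ k ih =>
      intro t ht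
      have := hd _ (ih t ht)
      have e : d * (d ^ k * t * (d ^ k)⁻¹) * d⁻¹ = d ^ (k + 1) * t * (d ^ (k + 1))⁻¹ := by
        rw [pow_succ']; group
      rwa [e] at this
  obtain ⟨R, ⟨hRQ, hRr, hRi⟩, hRd⟩ := exists_inv_syl hp hr (Subgroup.zpowers d) Q
    (isPGroup_zpowers (p := p) (k := 1) (by rw [pow_one]; exact hdp)) hQ hz
  have h1 := hg Y V r hr hrp (by
    rw [hV]; exact Nat.Coprime.pow_right _ ((Nat.coprime_primes hr hp).2 hrp)) d hdp _ R le_rfl hRr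
    (hRd d (Subgroup.mem_zpowers d)) ⊤ (fun _ _ _ _ => trivial) (fun _ _ => trivial)
    (fun x hx h => hf x (hRQ hx) (fun w => h w trivial)) (by rw [AddSubgroup.relIndex_top_right]; exact hN)
  refine le_trans ?_ h1
  have hc1 := cl_mul_card Q d
  have hc2 := cl_mul_card R d
  have hdiv : r ^ k * Nat.card (Subgroup.centralizer {d} ⊓ R : Subgroup Y) ∣ Nat.card R * R.relIndex Q := by
    rw [card_mul_relIndex' hRQ, ← hc1]
    exact Nat.mul_dvd_mul hk (Subgroup.card_dvd_of_le (inf_le_inf_left _ hRQ))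
  haveI := Fact.mk hr
  obtain ⟨b, hb⟩ := IsPGroup.iff_card.1 (hRr.to_le (inf_le_right : Subgroup.centralizer {d} ⊓ R ≤ R))
  have hcop : Nat.Coprime (r ^ k * Nat.card (Subgroup.centralizer {d} ⊓ R : Subgroup Y)) (R.relIndex Q) := by
    rw [hb, ← pow_add]
    exact Nat.Coprime.pow_left _ ((Nat.Prime.coprime_iff_not_dvd hr).2 hRi)
  have hdiv2 := hcop.dvd_of_dvd_mul_right hdiv
  rw [← hc2] at hdiv2
  have hpos : 0 < Nat.card (Subgroup.centralizer {d} ⊓ R : Subgroup Y) := Nat.card_pos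
  have := Nat.dvd_of_mul_dvd_mul_right hpos hdiv2
  refine Nat.le_of_dvd ?_ this
  exact (Set.ncard_pos (Set.toFinite _)).2 ⟨d, cl_nonempty R d⟩
end PLen


namespace PLen
section
variable {X : Type} [Group X] [Finite X] {p : ℕ}

theorem isQEl_of_mem {N : Subgroup X} (hp : p.Prime) (hN : ¬ p ∣ Nat.card N) {x : X} (hx : x ∈ N) : IsQEl p x := by
  refine ⟨Nat.card N, (Nat.Prime.coprime_iff_not_dvd hp).2 hN, ?_⟩
  have := pow_card_eq_one' (x := (⟨x, hx⟩ : N))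
  exact congrArg Subtype.val this

theorem isPEl_of_mem {N : Subgroup X} (hN : IsPGroup p N) {x : X} (hx : x ∈ N) : IsPEl p x := by
  obtain ⟨k, hk⟩ := hN ⟨x, hx⟩
  exact ⟨k, congrArg Subtype.val hk⟩

theorem isPGroup_of_isPEl {N : Subgroup X} (h : ∀ x ∈ N, IsPEl p x) : IsPGroup p N := by
  rintro ⟨x, hx⟩
  obtain ⟨k, hk⟩ := h x hx
  exact ⟨k, Subtype.ext hk⟩

theorem pprime_of {N : Subgroup X} (hp : p.Prime) (h : ∀ x ∈ N, IsPEl p x → x = 1) : ¬ p ∣ Nat.card N := by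
  intro hd
  haveI := Fact.mk hp
  obtain ⟨x, hx⟩ := exists_prime_orderOf_dvd_card' p hd
  have h1 : (x : X) = 1 := h x x.2 ⟨1, by
    have := pow_orderOf_eq_one x
    rw [hx] at this
    rw [pow_one]; exact congrArg Subtype.val this⟩
  have : x = 1 := Subtype.ext h1
  rw [this, orderOf_one] at hx
  exact hp.one_lt.ne hx

theorem pprime_of_isQEl {N : Subgroup X} (hp : p.Prime) (h : ∀ x ∈ N, IsQEl p x) : ¬ p ∣ Nat.card N :=
  pprime_of hp fun x hx hx2 => eq_one_of_p_q hx2 (h x hx)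

theorem pgroup_of {N : Subgroup X} (hp : p.Prime) (h : ∀ x ∈ N, IsQEl p x → x = 1) : IsPGroup p N := by
  apply isPGroup_of_isPEl
  intro x hx
  obtain ⟨a, m, hm, ho⟩ := Nat.exists_eq_pow_mul_and_not_dvd (orderOf_pos x).ne' p hp.ne_one
  refine ⟨a, h _ (N.pow_mem hx _) ⟨m, (Nat.Prime.coprime_iff_not_dvd hp).2 hm, ?_⟩⟩
  rw [← pow_mul, ← ho, pow_orderOf_eq_one]

theorem normal_of_cj {N : Subgroup X} (h : ∀ g, cj g N = N) : N.Normal :=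
  ⟨fun n hn g => mem_of_cj_eq (h g) n hn⟩

theorem cj_of_normal {N : Subgroup X} (h : N.Normal) (g : X) : cj g N = N :=
  cj_eq_of_inv fun y hy => h.conj_mem y hy g

theorem Rp_normal (hp : p.Prime) {N : Subgroup X} (h : N.Normal) : (Rp p N).Normal := by
  apply normal_of_cj
  intro g
  have := Rp_map hp (MulAut.conj g).toMonoidHom N
  rw [show N.map (MulAut.conj g).toMonoidHom = N from cj_of_normal h g] at this
  exact this.symm
theorem Rq_normal (hp : p.Prime) {N : Subgroup X} (h : N.Normal) : (Rq p N).Normal := by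
  apply normal_of_cj
  intro g
  have := Rq_map hp (MulAut.conj g).toMonoidHom N
  rw [show N.map (MulAut.conj g).toMonoidHom = N from cj_of_normal h g] at this
  exact this.symm
theorem DI_normal (hp : p.Prime) {N : Subgroup X} (h : N.Normal) (k : ℕ) : (DI p k N).Normal := by
  induction k with
  | zero => exact h
  | succ k ih => rw [DI_succ']; exact Rq_normal hp (Rp_normal hp ih)

theorem Rp_bot_iff (hp : p.Prime) {N : Subgroup X} : Rp p N = ⊥ ↔ ∀ x ∈ N, IsPEl p x → x = 1 := by
  rw [Rp, eq_bot_iff, Subgroup.closure_le]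
  exact ⟨fun h x h1 h2 => h ⟨h1, h2⟩, fun h x hx => h x hx.1 hx.2⟩
theorem Rq_bot_iff (hp : p.Prime) {N : Subgroup X} : Rq p N = ⊥ ↔ ∀ x ∈ N, IsQEl p x → x = 1 := by
  rw [Rq, eq_bot_iff, Subgroup.closure_le]
  exact ⟨fun h x h1 h2 => h ⟨h1, h2⟩, fun h x hx => h x hx.1 hx.2⟩

theorem exists_minimal_pq (hp : p.Prime) (h : PSol p X) (C : Subgroup X) (hC : C.Normal) (hne : C ≠ ⊥) :
    ∃ N : Subgroup X, N.Normal ∧ N ≤ C ∧ N ≠ ⊥ ∧ (IsPGroup p N ∨ ¬ p ∣ Nat.card N) := by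
  have hex : ∃ k, DI p k C = ⊥ := ⟨_, h.DI_card C⟩
  classical
  have hk := Nat.find_spec hex
  have hk0 : Nat.find hex ≠ 0 := by
    intro h0
    rw [h0] at hk
    exact hne hk
  obtain ⟨k, hk1⟩ := Nat.exists_eq_succ_of_ne_zero hk0
  have hTne : DI p k C ≠ ⊥ := Nat.find_min hex (by omega)
  rw [hk1, Nat.succ_eq_add_one, DI_succ'] at hk
  have hTn := DI_normal hp hC k
  set T := DI p k C
  by_cases hR : Rp p T = ⊥
  · exact ⟨T, hTn, DI_le _ _, hTne, Or.inr (pprime_of hp ((Rp_bot_iff hp).1 hR))⟩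
  · exact ⟨Rp p T, Rp_normal hp hTn, (Rp_le _).trans (DI_le _ _), hR, Or.inl (pgroup_of hp ((Rq_bot_iff hp).1 hk))⟩

theorem exists_largest (P : Subgroup X → Prop) (h0 : P ⊥)
    (hsup : ∀ A B : Subgroup X, A.Normal → B.Normal → P A → P B → P (A ⊔ B)) :
    ∃ M : Subgroup X, M.Normal ∧ P M ∧ ∀ N : Subgroup X, N.Normal → P N → N ≤ M := by
  obtain ⟨M, ⟨h1, h2⟩, h3⟩ := Set.exists_max_image {M : Subgroup X | M.Normal ∧ P M} (fun M => Nat.card M)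
    (Set.toFinite _) ⟨⊥, inferInstance, h0⟩
  refine ⟨M, h1, h2, fun N hN hPN => ?_⟩
  have h4 : (M ⊔ N).Normal := by haveI := h1; haveI := hN; infer_instance
  have h5 := h3 (M ⊔ N) ⟨h4, hsup M N h1 hN h2 hPN⟩
  have h6 : M = M ⊔ N := Subgroup.eq_of_le_of_card_ge le_sup_left h5
  rw [h6]; exact le_sup_right

theorem exists_Op (hp : p.Prime) : ∃ M : Subgroup X, M.Normal ∧ IsPGroup p M ∧
    ∀ N : Subgroup X, N.Normal → IsPGroup p N → N ≤ M := by
  apply exists_largest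
  · exact IsPGroup.of_bot
  · intro A B hA hB h1 h2
    haveI := hB
    exact h1.to_sup_of_normal_right h2

theorem card_sup_dvd (A B : Subgroup X) (hA : A.Normal) : Nat.card (A ⊔ B : Subgroup X) ∣ Nat.card A * Nat.card B := by
  have h1 : Nat.card A * A.relIndex (A ⊔ B) = Nat.card (A ⊔ B : Subgroup X) := card_mul_relIndex' le_sup_left
  rw [← h1, sup_comm, Subgroup.relIndex_sup_right]
  exact Nat.mul_dvd_mul_left _ (Subgroup.relIndex_dvd_card _ _)

theorem exists_Oq (hp : p.Prime) : ∃ M : Subgroup X, M.Normal ∧ ¬ p ∣ Nat.card M ∧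
    ∀ N : Subgroup X, N.Normal → ¬ p ∣ Nat.card N → N ≤ M := by
  apply exists_largest
  · simpa using hp.one_lt.ne'
  · intro A B hA hB h1 h2 h
    rcases (hp.dvd_mul).1 (h.trans (card_sup_dvd A B hA)) with h | h
    exacts [h1 h, h2 h]

theorem central_ext (M Z : Subgroup X) (hZM : Z ≤ M) (hc : ∀ z ∈ Z, ∀ x ∈ M, x * z = z * x)
    (hcop : Nat.Coprime (Nat.card Z) (Z.relIndex M)) :
    ∃ S : Subgroup X, S ≤ M ∧ Nat.card S = Z.relIndex M ∧
      ∀ x ∈ M, Nat.Coprime (orderOf x) (Nat.card Z) → x ∈ S := by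
  haveI : (Z.subgroupOf M).Normal := by
    constructor
    intro n hn g
    rw [Subgroup.mem_subgroupOf] at hn ⊢
    have := hc n hn g g.2
    simp only [Subgroup.coe_mul, Subgroup.coe_inv]
    rw [this]; simpa using hn
  have hcard : Nat.card (Z.subgroupOf M) = Nat.card Z := Nat.card_congr (Subgroup.subgroupOfEquivOfLe hZM).toEquiv
  obtain ⟨S, hS⟩ := Subgroup.exists_right_complement'_of_coprime (N := Z.subgroupOf M) (by rw [hcard]; exact hcop)
  refine ⟨S.map M.subtype, Subgroup.map_subtype_le _, ?_, ?_⟩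
  · rw [Nat.card_congr (S.equivMapOfInjective _ M.subtype_injective).symm.toEquiv]
    have h1 := hS.card_mul
    have h2 := Subgroup.card_mul_index (Z.subgroupOf M)
    rw [← h2] at h1
    exact Nat.eq_of_mul_eq_mul_left Nat.card_pos h1
  · intro x hx ho
    obtain ⟨⟨z, s⟩, hzs⟩ := hS.surjective ⟨x, hx⟩
    have hzs' : ((z : M) : X) * ((s : M) : X) = x := congrArg Subtype.val hzs
    have hz : ((z : M) : X) ∈ Z := Subgroup.mem_subgroupOf.1 z.2
    have hcm : Commute ((z : M) : X) ((s : M) : X) := (hc _ hz _ (s : M).2).symm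
    have h1 : ((z : M) : X) ^ orderOf x * ((s : M) : X) ^ orderOf x = 1 := by
      rw [← hcm.mul_pow, hzs', pow_orderOf_eq_one]
    have h2 : (z : M) ^ orderOf x = ((s : M) ^ orderOf x)⁻¹ := by
      rw [eq_inv_iff_mul_eq_one]; exact Subtype.ext h1
    have h3 : (z : M) ^ orderOf x ∈ Z.subgroupOf M ⊓ S :=
      ⟨Subgroup.pow_mem _ z.2 _, by rw [h2]; exact S.inv_mem (S.pow_mem s.2 _)⟩
    rw [hS.disjoint.eq_bot, Subgroup.mem_bot] at h3
    have h4 : (z : M) ^ Nat.card Z = 1 := by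
      have := pow_card_eq_one' (x := (⟨z.1, z.2⟩ : Z.subgroupOf M))
      rw [hcard] at this
      exact congrArg Subtype.val this
    have h5 : (z : M) = 1 := by
      have := Nat.dvd_gcd (orderOf_dvd_of_pow_eq_one h3) (orderOf_dvd_of_pow_eq_one h4)
      rw [ho.gcd_eq_one] at this
      exact orderOf_eq_one_iff.1 (Nat.dvd_one.1 this)
    refine ⟨s, s.2, ?_⟩
    rw [← hzs', h5]; simp

theorem card_comap_mk (Q : Subgroup X) [Q.Normal] (N : Subgroup (X ⧸ Q)) :
    Nat.card (N.comap (QuotientGroup.mk' Q)) = Nat.card Q * Nat.card N := by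
  have h1 : Q ≤ N.comap (QuotientGroup.mk' Q) := by
    intro x hx
    have : (QuotientGroup.mk' Q) x = 1 := (QuotientGroup.eq_one_iff x).2 hx
    rw [Subgroup.mem_comap, this]; exact N.one_mem
  rw [← card_mul_relIndex' h1]
  congr 1
  have := Subgroup.relIndex_ker (QuotientGroup.mk' Q) (K := N.comap (QuotientGroup.mk' Q))
  rw [QuotientGroup.ker_mk', Subgroup.map_comap_eq_self_of_surjective (QuotientGroup.mk'_surjective Q)] at this
  exact this

/-- common part of the two Hall-Higman lemmas -/
theorem HH_aux (hp : p.Prime) (h : PSol p X) (Q : Subgroup X) (hQ : Q.Normal)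
    (hC : ¬ Subgroup.centralizer (Q : Set X) ≤ Q) :
    ∃ M : Subgroup X, M.Normal ∧ ¬ M ≤ Q ∧ M ≤ Subgroup.centralizer (Q : Set X) ∧
      (M ⊔ Q).Normal ∧
      ((Nat.card (M ⊔ Q : Subgroup X) = Nat.card Q * (M ⊓ Q).relIndex M)) ∧
      ((∃ k, (M ⊓ Q).relIndex M = p ^ k) ∨ ¬ p ∣ (M ⊓ Q).relIndex M) := by
  haveI := hQ
  set C := Subgroup.centralizer (Q : Set X) with hCdef
  have hCn : C.Normal := by
    rw [hCdef]; infer_instance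
  have hne : C.map (QuotientGroup.mk' Q) ≠ ⊥ := by
    intro hb
    apply hC
    rw [Subgroup.map_eq_bot_iff, QuotientGroup.ker_mk'] at hb
    exact hb
  obtain ⟨N, hN, hNC, hNne, hNp⟩ := exists_minimal_pq hp (h.quot hp Q) (C.map (QuotientGroup.mk' Q))
    (hCn.map _ (QuotientGroup.mk'_surjective Q)) hne
  haveI := hN
  haveI := hCn
  let M := N.comap (QuotientGroup.mk' Q) ⊓ C
  have hMn : M.Normal := inferInstance
  have hMmap : M.map (QuotientGroup.mk' Q) = N := by
    apply le_antisymm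
    · rintro _ ⟨x, hx, rfl⟩; exact hx.1
    · intro y hy
      obtain ⟨c, hc, rfl⟩ := hNC hy
      exact ⟨c, ⟨hy, hc⟩, rfl⟩
  have hidx : (M ⊓ Q).relIndex M = Nat.card N := by
    have := Subgroup.relIndex_ker (QuotientGroup.mk' Q) (K := M)
    rw [QuotientGroup.ker_mk', hMmap] at this
    rw [inf_comm, Subgroup.inf_relIndex_right, this]
  have hsup : M ⊔ Q = N.comap (QuotientGroup.mk' Q) := by
    rw [← hMmap, Subgroup.comap_map_eq, QuotientGroup.ker_mk']
  refine ⟨M, hMn, ?_, inf_le_right, ?_, ?_, ?_⟩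
  · intro hle
    apply hNne
    rw [← hMmap, Subgroup.map_eq_bot_iff, QuotientGroup.ker_mk']
    exact hle
  · rw [hsup]; infer_instance
  · rw [hsup, hidx, card_comap_mk]
  · rw [hidx]
    rcases hNp with h1 | h1
    · haveI := Fact.mk hp
      exact Or.inl (IsPGroup.iff_card.1 h1)
    · exact Or.inr h1

theorem inf_card_dvd (M Q : Subgroup X) : Nat.card (M ⊓ Q : Subgroup X) ∣ Nat.card Q :=
  Subgroup.card_dvd_of_le inf_le_right

theorem HH1 (hp : p.Prime) (h : PSol p X) (hOp : ∀ N : Subgroup X, N.Normal → IsPGroup p N → N = ⊥)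
    (Q : Subgroup X) (hQ : Q.Normal) (hQp : ¬ p ∣ Nat.card Q)
    (hmax : ∀ N : Subgroup X, N.Normal → ¬ p ∣ Nat.card N → N ≤ Q) :
    Subgroup.centralizer (Q : Set X) ≤ Q := by
  by_contra hC
  obtain ⟨M, hM, hMQ, hMC, hsn, hcard, hk | hk⟩ := HH_aux hp h Q hQ hC
  · obtain ⟨k, hk⟩ := hk
    have hZ : ¬ p ∣ Nat.card (M ⊓ Q : Subgroup X) := fun hd => hQp (hd.trans (inf_card_dvd M Q))
    have hcopZ : Nat.Coprime (Nat.card (M ⊓ Q : Subgroup X)) p := ((Nat.Prime.coprime_iff_not_dvd hp).2 hZ).symm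
    obtain ⟨S, hSM, hScard, hS⟩ := central_ext M (M ⊓ Q) inf_le_left
      (fun z hz x hx => (Subgroup.mem_centralizer_iff.1 (hMC hx) z hz.2).symm)
      (by rw [hk]; exact Nat.Coprime.pow_right _ hcopZ)
    have hSp : IsPGroup p S := IsPGroup.of_card (by rw [hScard, hk])
    have h1 : Rp p M ≤ S := by
      refine (Subgroup.closure_le _).2 ?_
      rintro x ⟨hx, j, hj⟩
      exact hS x hx (Nat.Coprime.coprime_dvd_left (orderOf_dvd_of_pow_eq_one hj) (Nat.Coprime.pow_left _ hcopZ.symm))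
    have h2 := hOp _ (Rp_normal hp hM) (hSp.to_le h1)
    have h3 := pprime_of hp ((Rp_bot_iff hp).1 h2)
    exact hMQ (hmax M hM h3)
  · apply hMQ
    refine le_sup_left.trans (hmax (M ⊔ Q) hsn ?_)
    rw [hcard]
    intro hd
    rcases (hp.dvd_mul).1 hd with hd | hd
    exacts [hQp hd, hk hd]

theorem HH2 (hp : p.Prime) (h : PSol p X) (hOq : ∀ N : Subgroup X, N.Normal → ¬ p ∣ Nat.card N → N = ⊥)
    (P : Subgroup X) (hP : P.Normal) (hPp : IsPGroup p P)
    (hmax : ∀ N : Subgroup X, N.Normal → IsPGroup p N → N ≤ P) :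
    Subgroup.centralizer (P : Set X) ≤ P := by
  haveI := Fact.mk hp
  by_contra hC
  obtain ⟨M, hM, hMQ, hMC, hsn, hcard, hk | hk⟩ := HH_aux hp h P hP hC
  · apply hMQ
    refine le_sup_left.trans (hmax (M ⊔ P) hsn ?_)
    obtain ⟨k, hk⟩ := hk
    obtain ⟨j, hj⟩ := IsPGroup.iff_card.1 hPp
    exact IsPGroup.of_card (n := j + k) (by rw [hcard, hk, hj, pow_add])
  · obtain ⟨j, hj⟩ := IsPGroup.iff_card.1 (hPp.to_le (inf_le_right : M ⊓ P ≤ P))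
    have hcop : Nat.Coprime p ((M ⊓ P).relIndex M) := (Nat.Prime.coprime_iff_not_dvd hp).2 hk
    obtain ⟨S, hSM, hScard, hS⟩ := central_ext M (M ⊓ P) inf_le_left
      (fun z hz x hx => (Subgroup.mem_centralizer_iff.1 (hMC hx) z hz.2).symm)
      (by rw [hj]; exact Nat.Coprime.pow_left _ hcop)
    have h1 : Rq p M ≤ S := by
      refine (Subgroup.closure_le _).2 ?_
      rintro x ⟨hx, i, hi, hxi⟩
      refine hS x hx (Nat.Coprime.coprime_dvd_left (orderOf_dvd_of_pow_eq_one hxi) ?_)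
      rw [hj]
      exact Nat.Coprime.pow_right _ hi.symm
    have h2 := hOq _ (Rq_normal hp hM) (fun hd => by
      have := hd.trans (Subgroup.card_dvd_of_le h1)
      rw [hScard] at this
      exact hk this)
    have h3 := pgroup_of hp ((Rq_bot_iff hp).1 h2)
    exact hMQ (hmax M hM h3)
end
end PLen


namespace PLen

theorem center_ne_bot {X : Type} [Group X] [Finite X] {p : ℕ} (hp : p.Prime) (P : Subgroup X) (hP : IsPGroup p P) (hne : P ≠ ⊥) :
    P ⊓ Subgroup.centralizer (P : Set X) ≠ ⊥ := by
  haveI := Fact.mk hp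
  haveI : Nontrivial P := (Subgroup.nontrivial_iff_ne_bot P).2 hne
  haveI := hP.center_nontrivial
  obtain ⟨⟨c, hc⟩, hc1⟩ := exists_ne (1 : Subgroup.center P)
  intro h
  apply hc1
  have : (c : X) ∈ P ⊓ Subgroup.centralizer (P : Set X) := by
    refine ⟨c.2, Subgroup.mem_centralizer_iff.2 ?_⟩
    intro h hh
    exact congrArg Subtype.val (Subgroup.mem_center_iff.1 hc ⟨h, hh⟩)
  rw [h, Subgroup.mem_bot] at this
  apply Subtype.ext; apply Subtype.ext; exact this

/-- the permutation module -/
@[reducible] def permMod (X Ω : Type) [Group X] [MulAction X Ω] (p : ℕ) : DistribMulAction X (Ω → ZMod p) where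
  smul x f := fun ω => f (x⁻¹ • ω)
  one_smul f := by funext ω; show f ((1 : X)⁻¹ • ω) = f ω; simp
  mul_smul x y f := by
    funext ω; show f ((x * y)⁻¹ • ω) = f (y⁻¹ • x⁻¹ • ω); simp [mul_smul]
  smul_zero x := by funext ω; rfl
  smul_add x f g := by funext ω; rfl

theorem permP {p : ℕ} (hp : p.Prime) (c : ℕ) : ∃ M : ℕ, ∀ (X Ω : Type) [Group X] [Finite X] [MulAction X Ω] [Finite Ω]
    (hX : PSol p X) (hf : ∀ x : X, (∀ ω : Ω, x • ω = ω) → x = 1)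
    (hprim : ∀ F : Subgroup X, F.Normal → F ≠ ⊥ → ∀ ω ω' : Ω, ∃ x ∈ F, x • ω = ω')
    (d : X) (hd1 : d ≠ 1) (hdp : d ^ p = 1) (hc : {ω : Ω | d • ω ≠ ω}.ncard ≤ c), Nat.card Ω ≤ M := by
  classical
  haveI := Fact.mk hp
  obtain ⟨g, hg⟩ := lemL hp (p ^ c)
  refine ⟨2 * c + g * c, ?_⟩
  intro X Ω _ _ _ _ hX hf hprim d hd1 hdp hc
  haveI : Fintype Ω := Fintype.ofFinite Ω
  by_cases hOp : ∀ N : Subgroup X, N.Normal → IsPGroup p N → N = ⊥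
  · obtain ⟨Q, hQ, hQp, hQmax⟩ := exists_Oq (X := X) hp
    have hQne : Q ≠ ⊥ := by
      obtain ⟨N, hN, -, hNne, hN2⟩ := exists_minimal_pq hp hX ⊤ inferInstance (by
        intro h
        apply hd1
        have : d ∈ (⊤ : Subgroup X) := trivial
        rw [h] at this; exact this)
      rintro rfl
      rcases hN2 with h1 | h1
      · exact hNne (hOp N hN h1)
      · exact hNne (le_bot_iff.1 (hQmax N hN h1))
    letI := permMod X Ω p
    have hcl := hg X (Ω → ZMod p) (Fintype.card Ω) (by simp [Nat.card_eq_fintype_card, ZMod.card]) d hdp Q hQp (fun x hx => hQ.conj_mem x hx d)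
      (by
        intro x hx h
        apply hf
        intro ω
        have h1 := congrFun (h (Pi.single ω 1)) (x • ω)
        have h2 : (Pi.single ω 1 : Ω → ZMod p) (x⁻¹ • x • ω) = (Pi.single ω 1 : Ω → ZMod p) (x • ω) := h1
        rw [inv_smul_smul, Pi.single_eq_same] at h2
        by_contra hne
        rw [Pi.single_eq_of_ne hne] at h2
        exact one_ne_zero h2)
      (by
        let S : Set Ω := {ω : Ω | d • ω ≠ ω}
        let res : (Ω → ZMod p) →+ (S → ZMod p) :=
          { toFun := fun f s => f s, map_zero' := rfl, map_add' := fun _ _ => rfl }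
        have hle : res.ker ≤ fx (Ω → ZMod p) d := by
          intro f hf
          have hf' : ∀ ω, d • ω ≠ ω → f ω = 0 := fun ω hω => congrFun hf ⟨ω, hω⟩
          show d • f = f
          funext ω
          show f (d⁻¹ • ω) = f ω
          by_cases h : d • ω = ω
          · rw [show d⁻¹ • ω = ω by rw [inv_smul_eq_iff, h]]
          · rw [hf' ω h, hf' (d⁻¹ • ω)]
            rw [smul_inv_smul]
            intro h2
            apply h
            rw [eq_inv_smul_iff] at h2
            exact h2
        have h1 : (fx (Ω → ZMod p) d).index ≤ res.ker.index :=
          Nat.le_of_dvd (Nat.pos_of_ne_zero AddSubgroup.index_ne_zero_of_finite) (AddSubgroup.index_dvd_of_le hle)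
        refine h1.trans ?_
        rw [AddSubgroup.index_ker]
        refine (Nat.card_le_card_of_injective (fun x : res.range => (x : S → ZMod p)) Subtype.val_injective).trans ?_
        rw [Nat.card_fun]
        simp only [Nat.card_eq_fintype_card, ZMod.card]
        rw [← Nat.card_eq_fintype_card]
        exact Nat.pow_le_pow_right hp.pos hc)
    let Sg : Set Ω := ⋃ e ∈ (Set.toFinite (cl Q d)).toFinset, {ω : Ω | e • ω ≠ ω}
    have hSg : Sg = Set.univ := by
      obtain ⟨ω0, hω0⟩ : ∃ ω0 : Ω, d • ω0 ≠ ω0 := by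
        by_contra hcon
        push Not at hcon
        exact hd1 (hf d hcon)
      ext ω
      simp only [Set.mem_univ, iff_true]
      obtain ⟨x, hx, rfl⟩ := hprim Q hQ hQne ω0 ω
      simp only [Sg, Set.mem_iUnion, Set.Finite.mem_toFinset]
      refine ⟨x * d * x⁻¹, ⟨x, hx, rfl⟩, ?_⟩
      show (x * d * x⁻¹) • x • ω0 ≠ x • ω0
      rw [mul_smul, inv_smul_smul, mul_smul]
      intro h
      exact hω0 (smul_left_cancel _ h)
    have h2 : Sg.ncard ≤ g * c := by
      refine (Finset.set_ncard_biUnion_le _ _).trans ?_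
      refine (Finset.sum_le_card_nsmul _ _ c ?_).trans ?_
      · intro e he
        rw [Set.Finite.mem_toFinset] at he
        obtain ⟨x, hx, rfl⟩ := he
        refine le_trans ?_ hc
        have : {ω : Ω | (x * d * x⁻¹) • ω ≠ ω} ⊆ (fun ω => x • ω) '' {ω : Ω | d • ω ≠ ω} := by
          intro ω hω
          refine ⟨x⁻¹ • ω, ?_, by simp⟩
          intro h
          apply hω
          show (x * d * x⁻¹) • ω = ω
          rw [mul_smul, mul_smul]
          rw [h, smul_inv_smul]
        exact (Set.ncard_le_ncard this (Set.toFinite _)).trans (Set.ncard_image_le (Set.toFinite _))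
      · rw [smul_eq_mul, ← Set.ncard_eq_toFinset_card]
        exact Nat.mul_le_mul_right _ hcl
    rw [hSg, Set.ncard_univ] at h2
    omega
  · push Not at hOp
    obtain ⟨P, hP, hPp, hPne⟩ := hOp
    haveI := hP
    set Z := P ⊓ Subgroup.centralizer (P : Set X) with hZ
    have hZne : Z ≠ ⊥ := center_ne_bot hp P hPp hPne
    have hZn : Z.Normal := by rw [hZ]; infer_instance
    have hZab : ∀ x ∈ Z, ∀ y ∈ Z, x * y = y * x := by
      intro x hx y hy
      exact Subgroup.mem_centralizer_iff.1 hy.2 x hx.1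
    have htr := hprim Z hZn hZne
    have hreg : ∀ y ∈ Z, ∀ ω : Ω, y • ω = ω → y = 1 := by
      intro y hy ω h
      apply hf
      intro ω'
      obtain ⟨x, hx, rfl⟩ := htr ω ω'
      rw [smul_smul, hZab y hy x hx, mul_smul, h]
    obtain ⟨ω1, hω1⟩ : ∃ ω0 : Ω, d • ω0 ≠ ω0 := by
      by_contra hcon
      push Not at hcon
      exact hd1 (hf d hcon)
    have hfix : {ω : Ω | d • ω = ω}.ncard ≤ {ω : Ω | d • ω ≠ ω}.ncard := by
      by_cases hne : ∃ ω0 : Ω, d • ω0 = ω0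
      · obtain ⟨ω0, hω0⟩ := hne
        obtain ⟨z, hz, hzω⟩ := htr ω0 ω1
        refine Set.ncard_le_ncard_of_injOn (fun ω => z • ω) ?_ (fun a _ b _ h => smul_left_cancel _ h) (Set.toFinite _)
        intro ω hω h
        have hω' : d • ω = ω := hω
        have h' : d • z • ω = z • ω := h
        apply hω1
        have e1 : (z⁻¹ * (d * z * d⁻¹)) • ω = ω := by
          have : d⁻¹ • ω = ω := by rw [inv_smul_eq_iff, hω']
          rw [mul_smul, mul_smul, this, mul_smul, h', inv_smul_smul]
        have e2 := hreg _ (Z.mul_mem (Z.inv_mem hz) (hZn.conj_mem z hz d)) ω e1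
        have e3 : d * z = z * d := by
          rw [inv_mul_eq_one] at e2
          conv_rhs => rw [e2]
          group
        rw [← hzω, smul_smul, e3, mul_smul, hω0]
      · have : {ω : Ω | d • ω = ω} = ∅ := by
          ext ω; simp only [Set.mem_empty_iff_false, iff_false]
          intro h; exact hne ⟨ω, h⟩
        rw [this]; simp
    have hun : (Set.univ : Set Ω) = {ω : Ω | d • ω = ω} ∪ {ω : Ω | d • ω ≠ ω} := by
      ext ω; simp [em]
    have h1 := Set.ncard_union_le {ω : Ω | d • ω = ω} {ω : Ω | d • ω ≠ ω}
    rw [← hun, Set.ncard_univ] at h1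
    omega

theorem permT {p : ℕ} (hp : p.Prime) (c : ℕ) : ∃ M : ℕ, ∀ (X Ω : Type) [Group X] [Finite X] [MulAction X Ω] [Finite Ω]
    (hX : PSol p X) (htr : ∀ ω ω' : Ω, ∃ x : X, x • ω = ω') (D : Set X) (hD : Subgroup.closure D = ⊤)
    (hdp : ∀ d ∈ D, d ^ p = 1) (hc : ∀ d ∈ D, {ω : Ω | d • ω ≠ ω}.ncard ≤ c), Nat.card Ω ≤ M := by
  classical
  obtain ⟨M, hM⟩ := permP hp c
  refine ⟨c * M + 1, ?_⟩
  intro X Ω _ _ _ _ hX htr D hD hdp hc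
  haveI : Fintype Ω := Fintype.ofFinite Ω
  rcases isEmpty_or_nonempty Ω with h0 | ⟨⟨ω0⟩⟩
  · simp
  rcases eq_top_or_exists_le_coatom (MulAction.stabilizer X ω0) with htop | ⟨K, hK, hSK⟩
  · have : Subsingleton Ω := by
      constructor
      intro a b
      have h : ∀ a : Ω, a = ω0 := by
        intro a
        obtain ⟨x, rfl⟩ := htr ω0 a
        have : x ∈ MulAction.stabilizer X ω0 := by rw [htop]; trivial
        exact this
      rw [h a, h b]
    have := Finite.card_le_one_iff_subsingleton.2 this
    omega
  choose y hy using htr ω0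
  let π : Ω → X ⧸ K := fun ω => (y ω : X ⧸ K)
  have hπ' : ∀ x : X, ∀ ω, x • ω0 = ω → π ω = (x : X ⧸ K) := by
    intro x ω h
    apply QuotientGroup.eq.2
    apply hSK
    show ((y ω)⁻¹ * x) • ω0 = ω0
    rw [mul_smul, h, inv_smul_eq_iff, hy]
  have hπ : ∀ (x : X) (ω : Ω), π (x • ω) = x • π ω := by
    intro x ω
    rw [hπ' (x * y ω) (x • ω) (by rw [mul_smul, hy])]
    rfl
  have hπs : Function.Surjective π := by
    intro C
    obtain ⟨x, rfl⟩ := QuotientGroup.mk_surjective C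
    exact ⟨x • ω0, hπ' x _ rfl⟩
  -- some d moves some coset
  obtain ⟨d, hdD, C, hdC⟩ : ∃ d ∈ D, ∃ C : X ⧸ K, d • C ≠ C := by
    by_contra hcon
    push Not at hcon
    apply hK.1
    rw [eq_top_iff, ← hD, Subgroup.closure_le]
    intro d hd
    have := hcon d hd ((1 : X) : X ⧸ K)
    have h2 : ((d * 1 : X) : X ⧸ K) = ((1 : X) : X ⧸ K) := this
    rw [mul_one, eq_comm, QuotientGroup.eq] at h2
    simpa using h2
  let f : X →* Equiv.Perm (X ⧸ K) := MulAction.toPermHom X (X ⧸ K)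
  have hfapp : ∀ x (C : X ⧸ K), f x C = x • C := fun _ _ => rfl
  have hcosets : Nat.card (X ⧸ K) ≤ M := by
    apply hM f.range (X ⧸ K) (hX.of_surj hp f.rangeRestrict f.rangeRestrict_surjective) ?_ ?_ ⟨f d, ⟨d, rfl⟩⟩ ?_ ?_ ?_
    · rintro ⟨x, hx⟩ h
      apply Subtype.ext
      ext C
      exact h C
    · intro F hF hFne
      -- preimage
      let F' : Subgroup X := F.comap f.rangeRestrict
      haveI hF' : F'.Normal := hF.comap _
      have hnot : ¬ F' ≤ K := by
        intro hle
        apply hFne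
        rw [eq_bot_iff]
        rintro ⟨_, x, rfl⟩ hx
        have hx' : x ∈ F' := hx
        rw [Subgroup.mem_bot]
        apply Subtype.ext
        ext C
        obtain ⟨y, rfl⟩ := QuotientGroup.mk_surjective C
        show ((x * y : X) : X ⧸ K) = (y : X ⧸ K)
        rw [eq_comm, QuotientGroup.eq]
        apply hle
        have := hF'.conj_mem x hx' y⁻¹
        simpa [mul_assoc] using this
      have htop : F' ⊔ K = ⊤ := by
        apply hK.2
        exact lt_of_le_of_ne le_sup_right (fun h => hnot (by rw [h]; exact le_sup_left))
      have hb : ∀ C : X ⧸ K, ∃ x ∈ F', x • ((1 : X) : X ⧸ K) = C := by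
        intro C
        obtain ⟨y, rfl⟩ := QuotientGroup.mk_surjective C
        have : y ∈ F' ⊔ K := by rw [htop]; trivial
        obtain ⟨a, ha, k, hk, rfl⟩ := Subgroup.mem_sup_of_normal_left.1 this
        refine ⟨a, ha, ?_⟩
        show ((a * 1 : X) : X ⧸ K) = _
        rw [mul_one, QuotientGroup.eq]
        simpa using hk
      intro C C'
      obtain ⟨a, ha, rfl⟩ := hb C
      obtain ⟨b, hb, rfl⟩ := hb C'
      refine ⟨f.rangeRestrict (b * a⁻¹), F'.mul_mem hb (F'.inv_mem ha), ?_⟩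
      show (b * a⁻¹) • a • ((1:X) : X ⧸ K) = b • ((1:X) : X ⧸ K)
      rw [mul_smul, inv_smul_smul]
    · intro h
      apply hdC
      have := congrArg (fun g => (g : Equiv.Perm (X ⧸ K)) C) (congrArg Subtype.val h)
      exact this
    · apply Subtype.ext
      show f d ^ p = 1
      rw [← map_pow, hdp d hdD, map_one]
    · refine le_trans ?_ (hc d hdD)
      have : {ω : X ⧸ K | d • ω ≠ ω} ⊆ π '' {ω : Ω | d • ω ≠ ω} := by
        intro C hC
        obtain ⟨ω, rfl⟩ := hπs C
        refine ⟨ω, ?_, rfl⟩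
        intro h
        apply hC
        show d • π ω = π ω
        rw [← hπ]
        rw [show d • ω = ω from h]
      exact (Set.ncard_le_ncard this (Set.toFinite _)).trans (Set.ncard_image_le (Set.toFinite _))
  -- fibers
  haveI : Fintype (X ⧸ K) := Fintype.ofFinite _
  have hfib : ∀ C' ∈ (Finset.univ : Finset Ω).image π, ((Finset.univ : Finset Ω).filter (fun ω => π ω = C')).card ≤ c := by
    intro C' _
    obtain ⟨a, rfl⟩ := QuotientGroup.mk_surjective C
    obtain ⟨b, rfl⟩ := QuotientGroup.mk_surjective C'
    refine le_trans ?_ (hc d hdD)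
    rw [← Set.ncard_coe_finset]
    refine Set.ncard_le_ncard_of_injOn (fun ω => (a * b⁻¹) • ω) ?_ (fun a _ b _ h => smul_left_cancel _ h) (Set.toFinite _)
    intro ω hω
    have hω' : π ω = (b : X ⧸ K) := by simpa using hω
    intro h
    apply hdC
    have h2 : π ((a * b⁻¹) • ω) = (a : X ⧸ K) := by
      rw [hπ, hω']
      show ((a * b⁻¹ * b : X) : X ⧸ K) = a
      simp
    rw [← h2, ← hπ]
    rw [show d • (a * b⁻¹) • ω = (a * b⁻¹) • ω from h]
  have h1 := Finset.card_le_mul_card_image (Finset.univ : Finset Ω) c hfib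
  have h2 : ((Finset.univ : Finset Ω).image π).card ≤ M := by
    refine le_trans ?_ hcosets
    rw [Nat.card_eq_fintype_card]
    exact Finset.card_le_univ _
  rw [Nat.card_eq_fintype_card, ← Finset.card_univ]
  have := Nat.mul_le_mul_left c h2
  omega

theorem permG {p : ℕ} (hp : p.Prime) (c : ℕ) : ∃ b : ℕ, ∀ (X Ω : Type) [Group X] [Finite X] [MulAction X Ω] [Finite Ω]
    (hX : PSol p X) (D : Set X) (hD : Subgroup.closure D = ⊤)
    (hdp : ∀ d ∈ D, d ^ p = 1) (hc : ∀ d ∈ D, {ω : Ω | d • ω ≠ ω}.ncard ≤ c),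
    ∀ x ∈ DI p b (⊤ : Subgroup X), ∀ ω : Ω, x • ω = ω := by
  obtain ⟨M, hM⟩ := permT hp c
  refine ⟨M.factorial, ?_⟩
  intro X Ω _ _ _ _ hX D hD hdp hc x hx ω
  have h1 : Nat.card (MulAction.orbit X ω) ≤ M := by
    apply hM X (MulAction.orbit X ω) hX (fun a b => MulAction.exists_smul_eq X a b) D hD hdp
    intro d hd
    refine le_trans ?_ (hc d hd)
    refine Set.ncard_le_ncard_of_injOn Subtype.val ?_ Subtype.val_injective.injOn (Set.toFinite _)
    rintro ⟨a, ha⟩ h h2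
    apply h
    exact Subtype.ext h2
  exact hX.DI_fix hp ⊤ (fun x (a : Ω) => x • a) (one_smul X) (fun x y a => mul_smul x y a) (MulAction.orbit X ω)
    (Set.toFinite _) (fun x _ a ha => by
      obtain ⟨y, rfl⟩ := ha
      exact ⟨x * y, mul_smul _ _ _⟩) h1 x hx ω (MulAction.mem_orbit_self ω)
end PLen


namespace PLen

theorem DD_eq_bot_of_pprime {X : Type} [Group X] [Finite X] {p : ℕ} (hp : p.Prime) {Q : Subgroup X} (hQ : ¬ p ∣ Nat.card Q) :
    DD p Q = ⊥ := by
  have : Rp p Q = ⊥ := (Rp_bot_iff hp).2 fun x hx h => eq_one_of_p_q h (isQEl_of_mem hp hQ hx)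
  unfold DD
  rw [this]
  exact le_bot_iff.1 (Rq_le _)

/-- minimal invariant subgroups -/
def Mn {Y V : Type} [Group Y] [AddCommGroup V] [DistribMulAction Y V] (Q : Subgroup Y) (S : AddSubgroup V) : Prop :=
  S ≠ ⊥ ∧ Inv Q S ∧ ∀ T ≤ S, Inv Q T → T ≠ ⊥ → T = S

/-- pointwise stabiliser -/
def pst {Y V : Type} [Group Y] [AddCommGroup V] [DistribMulAction Y V] (Q : Subgroup Y) (S : AddSubgroup V) : Subgroup Y where
  carrier := {x | x ∈ Q ∧ ∀ v ∈ S, x • v = v}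
  one_mem' := ⟨Q.one_mem, fun v _ => one_smul _ v⟩
  mul_mem' := fun {a b} ha hb => ⟨Q.mul_mem ha.1 hb.1, fun v hv => by rw [mul_smul, hb.2 v hv, ha.2 v hv]⟩
  inv_mem' := fun {a} ha => ⟨Q.inv_mem ha.1, fun v hv => by rw [inv_smul_eq_iff, ha.2 v hv]⟩

/-- translate of a subgroup -/
def tr {Y V : Type} [Group Y] [AddCommGroup V] [DistribMulAction Y V] (x : Y) (S : AddSubgroup V) : AddSubgroup V where
  carrier := {v | x⁻¹ • v ∈ S}
  zero_mem' := by show x⁻¹ • (0:V) ∈ S; rw [smul_zero]; exact S.zero_mem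
  add_mem' := fun {a b} ha hb => by show x⁻¹ • (a + b) ∈ S; rw [smul_add]; exact S.add_mem ha hb
  neg_mem' := fun {a} ha => by show x⁻¹ • (-a) ∈ S; rw [smul_neg]; exact S.neg_mem ha

section
variable {Y V : Type} [Group Y] [AddCommGroup V] [DistribMulAction Y V]

theorem mem_pst {Q : Subgroup Y} {S : AddSubgroup V} {x : Y} : x ∈ pst Q S ↔ x ∈ Q ∧ ∀ v ∈ S, x • v = v := Iff.rfl
theorem mem_tr {S : AddSubgroup V} {x : Y} {v : V} : v ∈ tr x S ↔ x⁻¹ • v ∈ S := Iff.rfl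
theorem tr_tr (x y : Y) (S : AddSubgroup V) : tr x (tr y S) = tr (x * y) S := by
  ext v; simp [mem_tr, mul_smul]
theorem tr_one (S : AddSubgroup V) : tr (1 : Y) S = S := by ext v; simp [mem_tr]
theorem tr_bot (x : Y) : tr x (⊥ : AddSubgroup V) = ⊥ := by
  ext v; simp only [mem_tr, AddSubgroup.mem_bot]
  exact smul_eq_zero_iff_eq _

theorem Mn.tr {Q : Subgroup Y} [hQ : Q.Normal] {S : AddSubgroup V} (h : Mn Q S) (x : Y) : Mn Q (tr x S) := by
  refine ⟨?_, ?_, ?_⟩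
  · intro h1
    apply h.1
    rw [← tr_one (Y := Y) S, ← inv_mul_cancel x, ← tr_tr, h1, tr_bot]
  · intro y hy v hv
    rw [mem_tr] at hv ⊢
    have := h.2.1 _ (hQ.conj_mem y hy x⁻¹) _ hv
    rw [smul_smul] at this ⊢
    simpa [mul_assoc] using this
  · intro T hT hTi hTne
    have := h.2.2 (PLen.tr x⁻¹ T) ?_ ?_ ?_
    · rw [← this, tr_tr, mul_inv_cancel, tr_one]
    · intro v hv
      rw [mem_tr, inv_inv] at hv
      have := hT hv
      rwa [mem_tr, inv_smul_smul] at this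
    · intro y hy v hv
      rw [mem_tr, inv_inv] at hv ⊢
      have := hTi _ (hQ.conj_mem y hy x) _ hv
      rw [smul_smul] at this ⊢
      simpa [mul_assoc] using this
    · intro h1
      apply hTne
      rw [← tr_one (Y := Y) T, ← mul_inv_cancel x, ← tr_tr, h1, tr_bot]

theorem pst_tr {Q : Subgroup Y} [hQ : Q.Normal] (S : AddSubgroup V) (x : Y) : pst Q (tr x S) = cj x (pst Q S) := by
  ext y
  rw [mem_cj, mem_pst, mem_pst]
  constructor
  · rintro ⟨h1, h2⟩
    refine ⟨by simpa using hQ.conj_mem y h1 x⁻¹, fun v hv => ?_⟩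
    have := h2 (x • v) (by rw [mem_tr, inv_smul_smul]; exact hv)
    rw [mul_smul, mul_smul, this, inv_smul_smul]
  · rintro ⟨h1, h2⟩
    refine ⟨by simpa [mul_assoc] using hQ.conj_mem _ h1 x, fun v hv => ?_⟩
    have := h2 _ hv
    rw [mul_smul, smul_inv_smul, mul_smul, inv_smul_eq_iff, smul_inv_smul] at this
    exact this

theorem exists_Mn [Finite V] (Q : Subgroup Y) (W : AddSubgroup V) (hW : Inv Q W) (hne : W ≠ ⊥) : ∃ S ≤ W, Mn Q S := by
  have : ∀ n : ℕ, ∀ W : AddSubgroup V, Nat.card W ≤ n → Inv Q W → W ≠ ⊥ → ∃ S ≤ W, Mn Q S := by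
    intro n
    induction n with
    | zero =>
      intro W h _ _
      have := Nat.card_pos (α := W); omega
    | succ n ih =>
      intro W hn hW hne
      by_cases h : ∀ T ≤ W, Inv Q T → T ≠ ⊥ → T = W
      · exact ⟨W, le_rfl, hne, hW, h⟩
      · push Not at h
        obtain ⟨T, hT, hTi, hTne, hTW⟩ := h
        have hlt : Nat.card T < Nat.card W := by
          have : (T : Set V) ⊂ W := lt_of_le_of_ne hT (fun h => hTW (SetLike.coe_injective h))
          exact Set.ncard_lt_ncard this (Set.toFinite _)
        obtain ⟨S, hS, hS2⟩ := ih T (by omega) hTi hTne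
        exact ⟨S, hS.trans hT, hS2⟩
  exact this _ W le_rfl hW hne
end

theorem fix_ne_bot {Y V : Type} [Group Y] [AddCommGroup V] [DistribMulAction Y V] [Finite Y] [Finite V] {p a : ℕ} (hp : p.Prime)
    (hV : Nat.card V = p ^ a) (hne : Nontrivial V) (N : Subgroup Y) (hN : IsPGroup p N) : ∃ v : V, v ≠ 0 ∧ ∀ x ∈ N, x • v = v := by
  obtain ⟨v, hv, h⟩ := pfix hp N hN (fun x (v : V) => x • v) (one_smul Y) (fun x y a => mul_smul x y a) {v : V | v ≠ 0} (Set.toFinite _)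
    (fun x _ v hv => by
      show x • v ≠ 0
      rw [Ne, smul_eq_zero_iff_eq]; exact hv) (by
      have h1 : ({v : V | v ≠ 0}).ncard + 1 = p ^ a := by
        have := Set.ncard_add_ncard_compl ({(0 : V)} : Set V)
        rw [hV, Set.ncard_singleton] at this
        rw [show {v : V | v ≠ 0} = ({(0:V)} : Set V)ᶜ by ext; simp]
        omega
      intro hd
      have ha : a ≠ 0 := by
        rintro rfl
        rw [pow_zero] at hV
        have := (Nat.card_eq_one_iff_unique.1 hV).1
        exact not_subsingleton V this
      have h2 : p ∣ p ^ a := dvd_pow_self p ha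
      rw [← h1, Nat.dvd_add_right hd] at h2
      exact hp.one_lt.ne' (Nat.dvd_one.1 h2))
  exact ⟨v, hv, h⟩

theorem T_irr {p : ℕ} (hp : p.Prime) (N : ℕ) : ∃ b : ℕ, ∀ (X V : Type) [Group X] [Finite X] [AddCommGroup V] [Finite V]
    [DistribMulAction X V] (a : ℕ) (hV : Nat.card V = p ^ a) (hX : PSol p X) (D : Set X) (hD : Subgroup.closure D = ⊤)
    (hdp : ∀ d ∈ D, d ^ p = 1) (hN : ∀ d ∈ D, (fx V d).index ≤ N)
    (hirr : ∀ W : AddSubgroup V, Inv (⊤ : Subgroup X) W → W ≠ ⊥ → W = ⊤)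
    (hf : ∀ x : X, (∀ v : V, x • v = v) → x = 1), DI p b (⊤ : Subgroup X) = ⊥ := by
  classical
  obtain ⟨g1, hg1⟩ := lemL hp N
  obtain ⟨b2, hb2⟩ := permG hp (2 ^ (N ^ g1))
  set N' := N ^ g1 with hN'
  refine ⟨1 + ((N' ^ N').factorial + b2), ?_⟩
  intro X V _ _ _ _ _ a hV hX D hD hdp hN hirr hf
  rcases subsingleton_or_nontrivial V with hsub | hnt
  · rw [eq_bot_iff]
    intro x _
    exact hf x fun v => Subsingleton.elim _ _
  have hOp : ∀ N : Subgroup X, N.Normal → IsPGroup p N → N = ⊥ := by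
    intro P hP hPp
    obtain ⟨v, hv, hvf⟩ := fix_ne_bot hp hV hnt P hPp
    let W : AddSubgroup V := ⨅ x ∈ P, fx V x
    have hWm : ∀ w, w ∈ W ↔ ∀ x ∈ P, x • w = w := by
      intro w; simp [W, AddSubgroup.mem_iInf, mem_fx]
    have := hirr W (by
      intro x _ w hw
      rw [hWm] at hw ⊢
      intro y hy
      have := hw _ (hP.conj_mem y hy x⁻¹)
      rw [mul_smul, mul_smul, inv_smul_eq_iff, inv_inv] at this
      exact this) (by
      intro h
      have : v ∈ W := (hWm v).2 hvf
      rw [h] at this; exact hv this)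
    rw [eq_bot_iff]
    intro x hx
    apply hf
    intro w
    have hw : w ∈ W := by rw [this]; trivial
    exact (hWm w).1 hw x hx
  obtain ⟨Q, hQ, hQp, hQmax⟩ := exists_Oq (X := X) hp
  have hCQ := HH1 hp hX hOp Q hQ hQp hQmax
  let C : X → AddSubgroup V := fun d => ⨅ e : (Set.toFinite (cl Q d)).toFinset, fx V (e : X)
  have hCm : ∀ d v, v ∈ C d ↔ ∀ e ∈ cl Q d, e • v = v := by
    intro d v
    simp only [C, AddSubgroup.mem_iInf, mem_fx]
    constructor
    · intro h e he; exact h ⟨e, by simpa using he⟩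
    · rintro h ⟨e, he⟩; exact h e (by simpa using he)
  have hCi : ∀ d, Inv Q (C d) := by
    intro d x hx v hv
    rw [hCm] at hv ⊢
    rintro _ ⟨y, hy, rfl⟩
    have := hv (x⁻¹ * y * d * (x⁻¹ * y)⁻¹) ⟨x⁻¹ * y, Q.mul_mem (Q.inv_mem hx) hy, rfl⟩
    rw [show x⁻¹ * y * d * (x⁻¹ * y)⁻¹ = x⁻¹ * (y * d * y⁻¹) * x by group] at this
    rw [mul_smul, mul_smul, inv_smul_eq_iff] at this
    exact this
  have hdC : ∀ d, ∀ v ∈ C d, d • v = v := by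
    intro d v hv
    exact (hCm d v).1 hv d ⟨1, Q.one_mem, by simp⟩
  have hCx : ∀ d ∈ D, (C d).index ≤ N' := by
    intro d hd
    have hcl := hg1 X V a hV d (hdp d hd) Q hQp (fun x hx => hQ.conj_mem x hx d) (fun x _ h => hf x h) (hN d hd)
    have h1 : (C d).index ≤ ∏ e : (Set.toFinite (cl Q d)).toFinset, (fx V (e : X)).index :=
      AddSubgroup.index_iInf_le _
    refine h1.trans ?_
    refine (Finset.prod_le_pow_card _ _ N ?_).trans ?_
    · rintro ⟨e, he⟩ _
      rw [Set.Finite.mem_toFinset] at he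
      obtain ⟨x, hx, rfl⟩ := he
      have := ix_conj (⊤ : AddSubgroup V) x d (by simp)
      rw [AddSubgroup.relIndex_top_right, AddSubgroup.relIndex_top_right] at this
      show (fx V (x * d * x⁻¹)).index ≤ N
      rw [this]; exact hN d hd
    · have hNpos : 0 < N := lt_of_lt_of_le (Nat.pos_of_ne_zero AddSubgroup.index_ne_zero_of_finite) (hN d hd)
      rw [Finset.card_univ, Fintype.card_coe, ← Set.ncard_eq_toFinset_card]
      exact Nat.pow_le_pow_right hNpos hcl
  -- the set Ω
  let Ω := {k : Subgroup X // ∃ S : AddSubgroup V, Mn Q S ∧ k = pst Q S}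
  letI : MulAction X Ω :=
    { smul := fun x k => ⟨cj x k.1, by
        obtain ⟨S, hS, hk⟩ := k.2
        exact ⟨tr x S, hS.tr x, by rw [pst_tr, hk]⟩⟩
      one_smul := fun k => Subtype.ext (cj_one _)
      mul_smul := fun x y k => Subtype.ext (cj_mul _ _ _) }
  have hsm : ∀ (x : X) (k : Ω), ((x • k : Ω) : Subgroup X) = cj x k.1 := fun _ _ => rfl
  have hcount : ∀ d ∈ D, {k : Ω | d • k ≠ k}.ncard ≤ 2 ^ N' := by
    intro d hd
    haveI : Fintype (V ⧸ C d) := Fintype.ofFinite _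
    choose S hS hkS using fun k : Ω => k.2
    have hmv : ∀ k : Ω, d • k ≠ k → S k ⊓ C d = ⊥ := by
      intro k hk
      by_contra hne
      apply hk
      have := (hS k).2.2 (S k ⊓ C d) inf_le_left (fun x hx v hv => ⟨(hS k).2.1 x hx v hv.1, hCi d x hx v hv.2⟩) hne
      have hle : S k ≤ C d := by rw [← this]; exact inf_le_right
      apply Subtype.ext
      rw [hsm, hkS k, ← pst_tr]
      congr 1
      ext v
      rw [mem_tr]
      constructor
      · intro h
        have h2 := hdC d _ (hle h)
        rw [smul_inv_smul] at h2
        rw [h2]; exact h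
      · intro h
        have h2 := hdC d _ (hle h)
        rw [show d⁻¹ • v = v by rw [inv_smul_eq_iff, h2]]; exact h
    have hchar : ∀ k : Ω, d • k ≠ k → ∀ x, x ∈ k.1 ↔ x ∈ Q ∧ ∀ v : V, (v : V ⧸ C d) ∈ (fun v : V => (v : V ⧸ C d)) '' (S k : Set V) → x • v - v ∈ C d := by
      intro k hk x
      have hz := hmv k hk
      rw [hkS k, mem_pst]
      constructor
      · rintro ⟨h1, h2⟩
        refine ⟨h1, ?_⟩
        rintro v ⟨s, hs, hsv⟩
        have hsv' := QuotientAddGroup.eq.1 hsv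
        have e : x • v - v = x • (-s + v) - (-s + v) := by
          rw [smul_add, smul_neg, h2 s hs]; abel
        rw [e]
        exact (C d).sub_mem (hCi d x h1 _ hsv') hsv'
      · rintro ⟨h1, h2⟩
        refine ⟨h1, fun v hv => ?_⟩
        have h3 := h2 v ⟨v, hv, rfl⟩
        have h4 : x • v - v ∈ S k ⊓ C d := ⟨(S k).sub_mem ((hS k).2.1 x h1 v hv) hv, h3⟩
        rw [hz, AddSubgroup.mem_bot] at h4
        exact sub_eq_zero.1 h4
    have h1 : {k : Ω | d • k ≠ k}.ncard ≤ (Set.univ : Set (Set (V ⧸ C d))).ncard := by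
      refine Set.ncard_le_ncard_of_injOn (fun k => (fun v : V => (v : V ⧸ C d)) '' (S k : Set V)) (fun _ _ => trivial) ?_ (Set.toFinite _)
      intro k hk k' hk' h
      apply Subtype.ext
      ext x
      rw [hchar k hk, hchar k' hk']
      have h' : (fun v : V => (v : V ⧸ C d)) '' (S k : Set V) = (fun v : V => (v : V ⧸ C d)) '' (S k' : Set V) := h
      rw [h']
    refine h1.trans ?_
    rw [Set.ncard_univ, Nat.card_eq_fintype_card, Fintype.card_set]
    apply Nat.pow_le_pow_right (by norm_num)
    rw [← Nat.card_eq_fintype_card]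
    exact hCx d hd
  have hfixΩ := hb2 X Ω hX D hD hdp hcount
  set E2 := DI p b2 (⊤ : Subgroup X) with hE2
  by_cases htriv : ∃ S : AddSubgroup V, Mn Q S ∧ ∀ d ∈ D, S ≤ C d
  · obtain ⟨S, hS, hSC⟩ := htriv
    have hall : ∀ x : X, ∀ s ∈ S, x • s = s := by
      intro x
      have hx : x ∈ pst (⊤ : Subgroup X) S := by
        have : (⊤ : Subgroup X) ≤ pst (⊤ : Subgroup X) S := by
          conv_lhs => rw [← hD]
          rw [Subgroup.closure_le]
          intro d hd
          exact ⟨trivial, fun v hv => hdC d v (hSC d hd hv)⟩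
        exact this trivial
      exact hx.2
    have hST : S = ⊤ := hirr S (fun x _ w hw => by rw [hall x w hw]; exact hw) hS.1
    rw [eq_bot_iff]
    intro x _
    apply hf
    intro v
    exact hall x v (by rw [hST]; trivial)
  push Not at htriv
  have hidx : ∀ S : AddSubgroup V, Mn Q S → (pst Q S).relIndex Q ≤ N' ^ N' := by
    intro S hS
    obtain ⟨d, hd, hSd⟩ := htriv S hS
    have hz : C d ⊓ S = ⊥ := by
      by_contra hne
      apply hSd
      have := hS.2.2 (C d ⊓ S) inf_le_right (fun x hx v hv => ⟨hCi d x hx v hv.1, hS.2.1 x hx v hv.2⟩) hne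
      rw [← this]; exact inf_le_left
    have hcard : (⊥ : AddSubgroup V).relIndex S ≤ N' := by
      refine le_trans ?_ (hCx d hd)
      rw [← hz, AddSubgroup.inf_relIndex_right, ← AddSubgroup.relIndex_top_right]
      exact AddSubgroup.relIndex_le_of_le_right le_top (by
        rw [AddSubgroup.relIndex_top_right]; exact AddSubgroup.index_ne_zero_of_finite)
    have hb : Inv Q (⊥ : AddSubgroup V) := by
      intro x hx w hw
      rw [AddSubgroup.mem_bot] at hw ⊢
      rw [hw, smul_zero]
    have := (tk_index Q S ⊥ hS.2.1 hb hcard).1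
    have e : tk Q S ⊥ hS.2.1 hb = pst Q S := by
      ext x
      rw [mem_tk, mem_pst]
      simp only [AddSubgroup.mem_bot, sub_eq_zero]
    rwa [e] at this
  have hcomm : ∀ x ∈ DI p (N' ^ N').factorial E2, ∀ q ∈ Q, ∀ S : AddSubgroup V, Mn Q S → q⁻¹ * (x * q * x⁻¹) ∈ pst Q S := by
    intro x hx q hq S hS
    set k := pst Q S with hk
    have hkf : ∀ y ∈ E2, cj y k = k := by
      intro y hy
      have := hfixΩ y hy ⟨k, S, hS, hk⟩
      exact congrArg Subtype.val this
    let co : X → Set X := fun q => {g | q⁻¹ * g ∈ k}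
    have hact : ∀ y ∈ E2, ∀ q : X, {g | y⁻¹ * g * y ∈ co q} = co (y * q * y⁻¹) := by
      intro y hy q
      ext g
      show q⁻¹ * (y⁻¹ * g * y) ∈ k ↔ (y * q * y⁻¹)⁻¹ * g ∈ k
      conv_rhs => rw [← hkf y hy]
      rw [mem_cj]
      rw [show y⁻¹ * ((y * q * y⁻¹)⁻¹ * g) * y = q⁻¹ * (y⁻¹ * g * y) by group]
    have hF : (co '' (Q : Set X)).ncard ≤ N' ^ N' := by
      refine le_trans ?_ (hidx S hS)
      let fn : Q ⧸ k.subgroupOf Q → Set X := fun c => co (c.out : X)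
      have hsub : co '' (Q : Set X) ⊆ Set.range fn := by
        rintro _ ⟨q, hq, rfl⟩
        refine ⟨QuotientGroup.mk ⟨q, hq⟩, ?_⟩
        have h1 := Quotient.out_eq (QuotientGroup.mk ⟨q, hq⟩ : Q ⧸ k.subgroupOf Q)
        obtain ⟨o, ho⟩ : ∃ o, o = (QuotientGroup.mk ⟨q, hq⟩ : Q ⧸ k.subgroupOf Q).out := ⟨_, rfl⟩
        rw [← ho] at h1
        have h2 := QuotientGroup.eq.1 h1
        rw [Subgroup.mem_subgroupOf] at h2
        have h3 : (o : X)⁻¹ * q ∈ k := h2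
        show co ((QuotientGroup.mk ⟨q, hq⟩ : Q ⧸ k.subgroupOf Q).out : X) = co q
        rw [← ho]
        ext g
        show (o : X)⁻¹ * g ∈ k ↔ q⁻¹ * g ∈ k
        rw [show (o : X)⁻¹ * g = ((o : X)⁻¹ * q) * (q⁻¹ * g) by group]
        exact Subgroup.mul_mem_cancel_left k h3
      refine (Set.ncard_le_ncard hsub (Set.toFinite _)).trans ?_
      rw [← Set.image_univ]
      refine (Set.ncard_image_le (Set.toFinite _)).trans ?_
      rw [Set.ncard_univ]
      exact le_rfl
    have := hX.DI_fix hp E2 (fun y (A : Set X) => {g | y⁻¹ * g * y ∈ A}) (by intro A; simp) (by intro y z A; simp [mul_assoc])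
      (co '' (Q : Set X)) (Set.toFinite _) (by
        rintro y hy _ ⟨q, hq, rfl⟩
        exact ⟨y * q * y⁻¹, hQ.conj_mem q hq y, (hact y hy q).symm⟩) hF x hx (co q) ⟨q, hq, rfl⟩
    have h2 : {g | x⁻¹ * g * x ∈ co q} = co q := this
    rw [hact x (DI_le _ _ hx) q] at h2
    have h3 : x * q * x⁻¹ ∈ co (x * q * x⁻¹) := by
      show (x * q * x⁻¹)⁻¹ * (x * q * x⁻¹) ∈ k
      rw [inv_mul_cancel]; exact k.one_mem
    rw [h2] at h3
    exact h3
  have hI : ∀ y : X, (∀ S : AddSubgroup V, Mn Q S → y ∈ pst Q S) → y = 1 := by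
    intro y hy
    let W : AddSubgroup V := AddSubgroup.closure {v | ∃ S : AddSubgroup V, Mn Q S ∧ v ∈ S}
    have hWt : W = ⊤ := by
      apply hirr
      · intro x _ w hw
        induction hw using AddSubgroup.closure_induction with
        | mem v hv =>
          obtain ⟨S, hS, hv⟩ := hv
          exact AddSubgroup.subset_closure ⟨tr x S, hS.tr x, by rw [mem_tr, inv_smul_smul]; exact hv⟩
        | zero => rw [smul_zero]; exact W.zero_mem
        | add a b _ _ ha hb => rw [smul_add]; exact W.add_mem ha hb
        | neg a _ ha => rw [smul_neg]; exact W.neg_mem ha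
      · obtain ⟨S, -, hS⟩ := exists_Mn Q (⊤ : AddSubgroup V) (fun _ _ _ _ => trivial) top_ne_bot
        intro h
        apply hS.1
        rw [eq_bot_iff, ← h]
        intro v hv
        exact AddSubgroup.subset_closure ⟨S, hS, hv⟩
    apply hf
    intro v
    have hv : v ∈ W := by rw [hWt]; trivial
    have hle : W ≤ fx V y := by
      rw [AddSubgroup.closure_le]
      rintro v ⟨S, hS, hv⟩
      exact (hy S hS).2 v hv
    exact hle hv
  have hle : DI p ((N' ^ N').factorial + b2) (⊤ : Subgroup X) ≤ Q := by
    rw [DI_add]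
    intro x hx
    apply hCQ
    rw [Subgroup.mem_centralizer_iff]
    intro q hq
    have := hI _ (fun S hS => hcomm x hx q hq S hS)
    rw [inv_mul_eq_one] at this
    conv_lhs => rw [this]
    group
  rw [DI_add, DI_succ, DI_zero, eq_bot_iff]
  exact (DD_mono hle).trans (le_of_eq (DD_eq_bot_of_pprime hp hQp))

/-- restricted action -/
@[reducible] def subAct {X V : Type} [Group X] [AddCommGroup V] [DistribMulAction X V] (W : AddSubgroup V) (h : Inv (⊤ : Subgroup X) W) :
    DistribMulAction X W where
  smul x w := ⟨x • (w : V), h x trivial w w.2⟩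
  one_smul w := Subtype.ext (one_smul X (w : V))
  mul_smul x y w := Subtype.ext (mul_smul x y (w : V))
  smul_zero x := Subtype.ext (smul_zero x)
  smul_add x v w := Subtype.ext (smul_add x (v : V) w)

/-- quotient action -/
@[reducible] def quoAct {X V : Type} [Group X] [AddCommGroup V] [DistribMulAction X V] (W : AddSubgroup V) (h : Inv (⊤ : Subgroup X) W) :
    DistribMulAction X (V ⧸ W) where
  smul x w := QuotientAddGroup.map W W (DistribSMul.toAddMonoidHom V x) (fun v hv => h x trivial v hv) w
  one_smul w := by
    obtain ⟨v, rfl⟩ := QuotientAddGroup.mk_surjective w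
    show ((((1 : X) • v : V)) : V ⧸ W) = v
    rw [one_smul]
  mul_smul x y w := by
    obtain ⟨v, rfl⟩ := QuotientAddGroup.mk_surjective w
    show ((((x * y) • v : V)) : V ⧸ W) = ((x • y • v : V) : V ⧸ W)
    rw [mul_smul]
  smul_zero x := map_zero _
  smul_add x v w := map_add _ _ _

/-- faithful image acting -/
@[reducible] def imgAct (X V : Type) [Group X] [AddCommGroup V] [DistribMulAction X V] :
    DistribMulAction (MulAction.toPermHom X V).range V where
  smul g w := (g : Equiv.Perm V) w
  one_smul w := rfl
  mul_smul x y w := rfl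
  smul_zero x := by
    obtain ⟨_, y, rfl⟩ := x
    exact smul_zero y
  smul_add x v w := by
    obtain ⟨_, y, rfl⟩ := x
    exact smul_add y v w

theorem lemT0 {p : ℕ} (hp : p.Prime) (N : ℕ) : ∃ b : ℕ, ∀ (n : ℕ) (X V : Type) [Group X] [Finite X] [AddCommGroup V] [Finite V]
    [DistribMulAction X V] (a : ℕ) (hn : Nat.card V ≤ n) (hV : Nat.card V = p ^ a) (hX : PSol p X) (D : Set X) (hD : Subgroup.closure D = ⊤)
    (hdp : ∀ d ∈ D, d ^ p = 1) (hN : ∀ d ∈ D, (fx V d).index ≤ N), ∀ x ∈ DI p b (⊤ : Subgroup X), IsQEl p x → ∀ v : V, x • v = v := by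
  obtain ⟨b, hb⟩ := T_irr hp N
  refine ⟨b, ?_⟩
  intro n
  induction n with
  | zero =>
    intro X V _ _ _ _ _ a hn
    have := Nat.card_pos (α := V); omega
  | succ n ih =>
    intro X V _ _ _ _ _ a hn hV hX D hD hdp hN x hx hxq v
    rcases subsingleton_or_nontrivial V with hsub | hnt
    · exact Subsingleton.elim _ _
    obtain ⟨W, -, hW⟩ := exists_Mn (⊤ : Subgroup X) (⊤ : AddSubgroup V) (fun _ _ _ _ => trivial) top_ne_bot
    have hWcard : Nat.card W ∣ p ^ a := by rw [← hV]; exact AddSubgroup.card_addSubgroup_dvd_card W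
    obtain ⟨a1, -, ha1⟩ := (Nat.dvd_prime_pow hp).1 hWcard
    have hmul := W.card_mul_index
    have hQcard : Nat.card (V ⧸ W) ∣ p ^ a := by rw [← hV]; exact AddSubgroup.index_dvd_card W
    obtain ⟨a2, -, ha2⟩ := (Nat.dvd_prime_pow hp).1 hQcard
    have hW1 : 2 ≤ Nat.card W := by
      have h1 := Nat.card_pos (α := W)
      have h2 : Nat.card W ≠ 1 := fun h => hW.1 (AddSubgroup.eq_bot_of_card_eq _ h)
      omega
    have hlt : Nat.card (V ⧸ W) ≤ n := by
      have h1 : Nat.card W * Nat.card (V ⧸ W) = Nat.card V := hmul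
      have h2 := Nat.card_pos (α := V ⧸ W)
      nlinarith
    -- action on V/W
    have hq : ∀ v : V, x • v - v ∈ W := by
      intro v
      letI := quoAct W hW.2.1
      have := ih X (V ⧸ W) a2 hlt ha2 hX D hD hdp (by
        intro d hd
        refine le_trans ?_ (hN d hd)
        have hle : fx V d ≤ (fx (V ⧸ W) d).comap (QuotientAddGroup.mk' W) := by
          intro v hv
          show (((d • v : V)) : V ⧸ W) = v
          rw [show d • v = v from hv]
        rw [← AddSubgroup.index_comap_of_surjective _ (QuotientAddGroup.mk'_surjective W)]
        exact Nat.le_of_dvd (Nat.pos_of_ne_zero AddSubgroup.index_ne_zero_of_finite) (AddSubgroup.index_dvd_of_le hle)) x hx hxq (v : V ⧸ W)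
      have h2 : (((x • v : V)) : V ⧸ W) = (v : V ⧸ W) := this
      have h3 := QuotientAddGroup.eq.1 h2.symm
      rwa [neg_add_eq_sub] at h3
    have hWf : ∀ w ∈ W, x • w = w := by
      letI := subAct W hW.2.1
      let f := MulAction.toPermHom X W
      letI : DistribMulAction f.range W := imgAct X W
      have hfr : ∀ (y : X) (w : W), (f.rangeRestrict y) • w = y • w := fun _ _ => rfl
      have hDI := hb f.range W a1 ha1 (hX.of_surj hp f.rangeRestrict f.rangeRestrict_surjective) (f.rangeRestrict '' D) (by
        rw [← MonoidHom.map_closure, hD, ← MonoidHom.range_eq_map]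
        exact MonoidHom.range_eq_top.2 f.rangeRestrict_surjective) (by
        rintro _ ⟨d, hd, rfl⟩
        rw [← map_pow, hdp d hd, map_one]) (by
        rintro _ ⟨d, hd, rfl⟩
        refine le_trans ?_ (hN d hd)
        have : fx W (f.rangeRestrict d) = (fx V d).addSubgroupOf W := by
          ext w
          rw [AddSubgroup.mem_addSubgroupOf, mem_fx, mem_fx, hfr]
          exact Subtype.ext_iff
        rw [this, ← (fx V d).relIndex_top_right]
        exact AddSubgroup.relIndex_le_of_le_right (H := fx V d) (K := W) (L := ⊤) le_top (by
          rw [AddSubgroup.relIndex_top_right]; exact AddSubgroup.index_ne_zero_of_finite)) (by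
        intro T hT hTne
        have hT2 : ∀ y : X, ∀ t ∈ T, y • t ∈ T := fun y t ht => hT (f.rangeRestrict y) trivial t ht
        have := hW.2.2 (T.map W.subtype) (by rintro _ ⟨t, ht, rfl⟩; exact t.2) (by
          rintro y _ _ ⟨t, ht, rfl⟩
          exact ⟨y • t, hT2 y t ht, rfl⟩) (by
          intro h
          apply hTne
          rw [eq_bot_iff]
          intro t ht
          have : (t : V) ∈ T.map W.subtype := ⟨t, ht, rfl⟩
          rw [h, AddSubgroup.mem_bot] at this
          exact Subtype.ext this)
        rw [eq_top_iff]
        intro t _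
        have ht : (t : V) ∈ T.map W.subtype := by rw [this]; exact t.2
        obtain ⟨s, hs, hst⟩ := ht
        rwa [← Subtype.ext (a1 := s) (a2 := t) hst]) (by
        rintro ⟨_, y, rfl⟩ h
        apply Subtype.ext
        ext w
        exact congrArg Subtype.val (h w))
      intro w hw
      have : f.rangeRestrict x ∈ DI p b (⊤ : Subgroup f.range) := by
        have e : (⊤ : Subgroup f.range) = (⊤ : Subgroup X).map f.rangeRestrict := by
          rw [← MonoidHom.range_eq_map]
          exact (MonoidHom.range_eq_top.2 f.rangeRestrict_surjective).symm
        rw [e, DI_map hp]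
        exact ⟨x, hx, rfl⟩
      rw [hDI, Subgroup.mem_bot] at this
      have h2 := hfr x ⟨w, hw⟩
      rw [this, one_smul] at h2
      exact (congrArg Subtype.val h2).symm
    obtain ⟨s, hs, hs1⟩ := hxq
    exact coprime_trivial hs1 (by rw [hV]; exact (Nat.Coprime.pow_left a hs).symm) (hWf _ (hq v))

theorem lemT {p : ℕ} (hp : p.Prime) (N : ℕ) : ∃ b : ℕ, ∀ (X V : Type) [Group X] [Finite X] [AddCommGroup V] [Finite V]
    [DistribMulAction X V] (a : ℕ) (hV : Nat.card V = p ^ a) (hX : PSol p X) (D : Set X) (hD : Subgroup.closure D = ⊤)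
    (hdp : ∀ d ∈ D, d ^ p = 1) (hN : ∀ d ∈ D, (fx V d).index ≤ N), ∀ x ∈ DI p b (⊤ : Subgroup X), ∀ v : V, x • v = v := by
  obtain ⟨b, hb⟩ := lemT0 hp N
  refine ⟨b + 1, ?_⟩
  intro X V _ _ _ _ _ a hV hX D hD hdp hN x hx
  have hle : DI p (b + 1) (⊤ : Subgroup X) ≤ pst (⊤ : Subgroup X) (⊤ : AddSubgroup V) := by
    rw [DI_succ']
    unfold DD Rq
    rw [Subgroup.closure_le]
    rintro y ⟨hy, hyq⟩
    exact ⟨trivial, fun v _ => hb _ X V a le_rfl hV hX D hD hdp hN y (Rp_le _ hy) hyq v⟩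
  intro v
  exact (hle hx).2 v trivial
end PLen


namespace PLen
section
variable {Y U : Type} [Group Y] [AddCommGroup U] [DistribMulAction Y U]

theorem smul_nsmul_eq (y : Y) (n : ℕ) (u : U) : y • (n • u) = n • (y • u) :=
  map_nsmul (DistribSMul.toAddMonoidHom U y) n u

/-- norm map -/
def nrm (p : ℕ) (c : Y) : U →+ U where
  toFun u := ∑ i ∈ Finset.range p, c ^ i • u
  map_zero' := by simp
  map_add' := by intro a b; simp [smul_add, Finset.sum_add_distrib]

theorem nrm_apply (p : ℕ) (c : Y) (u : U) : nrm p c u = ∑ i ∈ Finset.range p, c ^ i • u := rfl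

/-- kernel of the norm -/
def KN (U : Type) [AddCommGroup U] [DistribMulAction Y U] (p : ℕ) (c : Y) : AddSubgroup U := (nrm p c).ker

theorem mem_KN {p : ℕ} {c : Y} {u : U} : u ∈ KN U p c ↔ ∑ i ∈ Finset.range p, c ^ i • u = 0 := Iff.rfl

theorem nrm_comm {p : ℕ} {c y : Y} (h : c * y = y * c) (u : U) : nrm p c (y • u) = y • nrm p c u := by
  rw [nrm_apply, nrm_apply, Finset.smul_sum]
  refine Finset.sum_congr rfl fun i _ => ?_
  rw [smul_smul, smul_smul]
  congr 1
  exact (Commute.pow_left (show Commute c y from h) i).eq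

theorem KN_inv {p : ℕ} {c y : Y} (h : c * y = y * c) {u : U} (hu : u ∈ KN U p c) : y • u ∈ KN U p c := by
  have hu' : nrm p c u = 0 := hu
  show nrm p c (y • u) = 0
  rw [nrm_comm h, hu', smul_zero]

theorem smul_nrm {p : ℕ} {c : Y} {u : U} (hc : c ^ p • u = u) : c • nrm p c u = nrm p c u := by
  rw [nrm_apply, Finset.smul_sum]
  have h1 := Finset.sum_range_succ (fun i => c ^ i • u) p
  have h2 := Finset.sum_range_succ' (fun i => c ^ i • u) p
  rw [h1, hc, pow_zero, one_smul] at h2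
  have h3 := add_right_cancel h2
  rw [h3]
  refine Finset.sum_congr rfl fun i _ => ?_
  rw [smul_smul, pow_succ']

theorem nrm_of_fix {p : ℕ} {c : Y} {u : U} (hc : c • u = u) : nrm p c u = p • u := by
  rw [nrm_apply, ← Finset.card_range p]
  rw [← Finset.sum_const, Finset.card_range]
  refine Finset.sum_congr rfl fun i _ => ?_
  induction i with
  | zero => simp
  | succ i ih => rw [pow_succ, mul_smul, hc, ih (Finset.mem_range.2 (by have := Finset.mem_range.1 ‹i + 1 ∈ _›; omega))]

theorem sub_mem_KN {p : ℕ} {c : Y} (hc : c ^ p = 1) (u : U) : c • u - u ∈ KN U p c := by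
  show nrm p c (c • u - u) = 0
  rw [map_sub, nrm_comm rfl, smul_nrm (by rw [hc, one_smul]), sub_self]

theorem eq_zero_of_nsmul [Finite U] {p : ℕ} (hp : p.Prime) (hU : ¬ p ∣ Nat.card U) {u : U} (h : p • u = 0) : u = 0 := by
  have h1 : addOrderOf u ∣ p := addOrderOf_dvd_of_nsmul_eq_zero h
  have h2 : addOrderOf u ∣ Nat.card U := addOrderOf_dvd_natCard u
  rcases (Nat.dvd_prime hp).1 h1 with h3 | h3
  · exact AddMonoid.addOrderOf_eq_one_iff.1 h3
  · rw [h3] at h2; exact absurd h2 hU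

theorem pow_mod_natCard_aux {c : Y} {p : ℕ} (hc : c ^ p = 1) (n : ℕ) : c ^ n = c ^ (n % p) := by
  conv_lhs => rw [← Nat.mod_add_div n p]
  rw [pow_add, pow_mul, hc, one_pow, mul_one]

theorem nrm_pow {p : ℕ} (hp : p.Prime) {c : Y} (hc : c ^ p = 1) {l : ℕ} (hl : ¬ p ∣ l) (u : U) :
    nrm p (c ^ l) u = nrm p c u := by
  rw [nrm_apply, nrm_apply]
  have himg : (Finset.range p).image (fun i => (l * i) % p) = Finset.range p := by
    apply Finset.eq_of_subset_of_card_le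
    · intro x hx
      rw [Finset.mem_image] at hx
      obtain ⟨i, -, rfl⟩ := hx
      exact Finset.mem_range.2 (Nat.mod_lt _ hp.pos)
    · rw [Finset.card_image_of_injOn]
      intro i hi j hj h
      have hcop : Nat.gcd p l = 1 := (Nat.Prime.coprime_iff_not_dvd hp).2 hl
      have := Nat.ModEq.cancel_left_of_coprime hcop h
      have hi' := Finset.mem_range.1 hi
      have hj' := Finset.mem_range.1 hj
      have := this
      rw [Nat.ModEq, Nat.mod_eq_of_lt hi', Nat.mod_eq_of_lt hj'] at this
      exact this
  have hinj : Set.InjOn (fun i => (l * i) % p) (Finset.range p : Set ℕ) := by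
    apply Finset.injOn_of_card_image_eq
    rw [himg]
  conv_rhs => rw [← himg, Finset.sum_image hinj]
  refine Finset.sum_congr rfl fun i _ => ?_
  rw [← pow_mul]
  congr 1
  exact (pow_mod_natCard_aux hc (l * i))


/-- the averaging identity -/
theorem avg {p : ℕ} (hp : p.Prime) {c τ : Y} (hc : c ^ p = 1) (hcτ : c * τ = τ * c) {u : U} (hu : u ∈ KN U p c) :
    ∑ i ∈ Finset.range p, nrm p (c ^ i * τ) u = p • u := by
  simp only [nrm_apply]
  rw [Finset.sum_comm]
  have hrow : ∀ l ∈ Finset.range p, l ≠ 0 → ∑ i ∈ Finset.range p, (c ^ i * τ) ^ l • u = 0 := by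
    intro l hl hl0
    have hnd : ¬ p ∣ l := fun h => by
      have := Nat.le_of_dvd (Nat.pos_of_ne_zero hl0) h
      have := Finset.mem_range.1 hl; omega
    have hh : τ ^ l • u ∈ KN U p c := by
      apply KN_inv _ hu
      exact (Commute.pow_right (show Commute c τ from hcτ) l).eq
    have h2 : nrm p c (τ ^ l • u) = 0 := hh
    rw [← nrm_pow hp hc hnd, nrm_apply] at h2
    rw [← h2]
    refine Finset.sum_congr rfl fun i _ => ?_
    rw [smul_smul]
    congr 1
    rw [Commute.mul_pow (Commute.pow_left (show Commute c τ from hcτ) i), ← pow_mul, ← pow_mul, mul_comm]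
  rw [Finset.sum_eq_single 0]
  · simp
  · exact hrow
  · intro h; exact absurd (Finset.mem_range.2 hp.pos) h

theorem avg_zero [Finite U] {p : ℕ} (hp : p.Prime) (hU : ¬ p ∣ Nat.card U) {c τ : Y} (hc : c ^ p = 1) (hcτ : c * τ = τ * c) {u : U} (hu : u ∈ KN U p c)
    (h : ∀ i < p, nrm p (c ^ i * τ) u = 0) : u = 0 := by
  apply eq_zero_of_nsmul hp hU
  rw [← avg hp hc hcτ hu]
  exact Finset.sum_eq_zero fun i hi => h i (Finset.mem_range.1 hi)

theorem KN_fx [Finite U] {p : ℕ} (hp : p.Prime) (hU : ¬ p ∣ Nat.card U) {c : Y} {u : U} (hu : u ∈ KN U p c) (hf : c • u = u) : u = 0 := by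
  apply eq_zero_of_nsmul hp hU
  rw [← nrm_of_fix hf]; exact hu

theorem bj_mem (B : Subgroup Y) {b τ : Y} (hb : b ∈ B) (hB : ∀ x ∈ B, τ * x * τ⁻¹ ∈ B) (M : ℕ) :
    (b * τ) ^ M * (τ ^ M)⁻¹ ∈ B := by
  induction M with
  | zero => simp
  | succ M ih =>
    have : (b * τ) ^ (M + 1) * (τ ^ (M + 1))⁻¹ = b * (τ * ((b * τ) ^ M * (τ ^ M)⁻¹) * τ⁻¹) := by
      rw [pow_succ' (b * τ), pow_succ' τ]
      rw [mul_inv_rev]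
      simp only [mul_assoc]
    rw [this]
    exact B.mul_mem hb (hB _ ih)

theorem pow_conj_mem {B : Subgroup Y} {τ : Y} (hB : ∀ x ∈ B, τ * x * τ⁻¹ ∈ B) (M : ℕ) : ∀ x ∈ B, τ ^ M * x * (τ ^ M)⁻¹ ∈ B := by
  induction M with
  | zero => simp
  | succ M ih =>
    intro x hx
    have := hB _ (ih x hx)
    rw [pow_succ', mul_inv_rev]
    simpa [mul_assoc] using this

theorem pow_smul_mem {U' : AddSubgroup U} {τ : Y} (h : ∀ u ∈ U', τ • u ∈ U') (i : ℕ) : ∀ u ∈ U', τ ^ i • u ∈ U' := by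
  induction i with
  | zero => simp
  | succ M ih =>
    intro u hu
    rw [pow_succ', mul_smul]
    exact h _ (ih u hu)

theorem nrm_mem {U' : AddSubgroup U} {τ : Y} (h : ∀ u ∈ U', τ • u ∈ U') (p : ℕ) {u : U} (hu : u ∈ U') : nrm p τ u ∈ U' := by
  rw [nrm_apply]
  exact sum_mem fun i _ => pow_smul_mem h i u hu

theorem lemA' [Finite Y] [Finite U] {p : ℕ} (hp : p.Prime) (hU : ¬ p ∣ Nat.card U) (k : ℕ) (σ : Y) (hσ : σ ^ p ^ (k + 1) = 1)
    (B : Subgroup Y) (hBp : IsPGroup p B) (hBab : ∀ x ∈ B, ∀ y ∈ B, x * y = y * x) (hBσ : ∀ x ∈ B, σ * x * σ⁻¹ ∈ B)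
    (b0 : Y) (hb0 : b0 ∈ B) (hb0ψ : σ ^ p ^ k * b0 ≠ b0 * σ ^ p ^ k)
    (U' : AddSubgroup U) (hU'B : Inv B U') (hU'σ : ∀ u ∈ U', σ • u ∈ U') :
    ∃ c ∈ B, c ≠ 1 ∧ c ^ p = 1 ∧ c * σ = σ * c ∧
      Nat.card (KN U p c ⊓ U' : AddSubgroup U) ≤ Nat.card (KN U p c ⊓ U' ⊓ fx U σ : AddSubgroup U) ^ p ^ (k + 1) := by
  classical
  haveI := Fact.mk hp
  set ψ := σ ^ p ^ k with hψ
  have hBψ := pow_conj_mem hBσ (p ^ k)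
  rw [← hψ] at hBψ
  -- the subgroup [B, ψ]
  let T : Subgroup Y :=
    { carrier := {c | ∃ b ∈ B, c = b * (ψ * b⁻¹ * ψ⁻¹)}
      one_mem' := ⟨1, B.one_mem, by group⟩
      mul_mem' := by
        rintro _ _ ⟨a, ha, rfl⟩ ⟨b, hb, rfl⟩
        refine ⟨b * a, B.mul_mem hb ha, ?_⟩
        have h1 := hBψ _ (B.inv_mem ha)
        have h2 := hBab _ h1 _ (B.mul_mem hb (hBψ _ (B.inv_mem hb)))
        rw [mul_assoc, h2]
        rw [mul_inv_rev]
        have h3 := hBab a ha b hb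
        have e1 : a * (b * (ψ * b⁻¹ * ψ⁻¹) * (ψ * a⁻¹ * ψ⁻¹)) = (a * b) * (ψ * (b⁻¹ * a⁻¹) * ψ⁻¹) := by group
        rw [e1, h3]
        rw [hBab _ (B.inv_mem hb) _ (B.inv_mem ha)]
      inv_mem' := by
        rintro _ ⟨a, ha, rfl⟩
        refine ⟨a⁻¹, B.inv_mem ha, ?_⟩
        rw [mul_inv_rev]
        have h1 := hBab _ (hBψ _ ha) _ (B.inv_mem ha)
        rw [inv_inv, ← h1]
        group }
  have hTB : T ≤ B := by
    rintro _ ⟨a, ha, rfl⟩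
    exact B.mul_mem ha (hBψ _ (B.inv_mem ha))
  have hTp : IsPGroup p T := hBp.to_le hTB
  have hψσ : Commute ψ σ := Commute.pow_left (Commute.refl σ) _
  have hTσ : ∀ x ∈ T, σ * x * σ⁻¹ ∈ T := by
    rintro _ ⟨a, ha, rfl⟩
    refine ⟨σ * a * σ⁻¹, hBσ a ha, ?_⟩
    have e : ψ * (σ * a * σ⁻¹)⁻¹ * ψ⁻¹ = σ * (ψ * a⁻¹ * ψ⁻¹) * σ⁻¹ := by
      rw [show ψ * (σ * a * σ⁻¹)⁻¹ * ψ⁻¹ = (ψ * σ) * a⁻¹ * (ψ * σ)⁻¹ by group, hψσ.eq]; group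
    rw [e]; group
  obtain ⟨c0, hc0, hc0f⟩ : ∃ c0 ∈ {x : Y | x ∈ T ∧ x ≠ 1}, ∀ x ∈ Subgroup.zpowers σ, x * c0 * x⁻¹ = c0 := by
    refine pfix hp (Subgroup.zpowers σ) (isPGroup_zpowers hσ) (fun x a => x * a * x⁻¹) (by simp) (by intro x y a; group) {x : Y | x ∈ T ∧ x ≠ 1}
      (Set.toFinite _) ?_ ?_
    · rintro x hx a ⟨ha, ha1⟩
      rw [← mem_powers_iff_mem_zpowers] at hx
      obtain ⟨n, rfl⟩ := hx
      refine ⟨pow_conj_mem hTσ n a ha, ?_⟩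
      intro h
      apply ha1
      exact conj_eq_one_iff.1 h
    · have hne : T ≠ ⊥ := by
        intro h
        have : b0 * (ψ * b0⁻¹ * ψ⁻¹) ∈ T := ⟨b0, hb0, rfl⟩
        rw [h, Subgroup.mem_bot] at this
        apply hb0ψ
        have h2 : b0 * ψ = 1 * (ψ * b0) := by rw [← this]; group
        rw [h2, one_mul]
      obtain ⟨j, hj⟩ := hTp.exists_card_eq
      have hj0 : j ≠ 0 := by
        rintro rfl
        exact hne (Subgroup.eq_bot_of_card_eq _ (by simpa using hj))
      have h1 : {x : Y | x ∈ T ∧ x ≠ 1}.ncard + 1 = p ^ j := by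
        have e : {x : Y | x ∈ T ∧ x ≠ 1} = (T : Set Y) \ {1} := by ext; simp
        rw [e, Set.ncard_diff_singleton_add_one (T.one_mem) (Set.toFinite _), ← hj]
        rfl
      intro hd
      have h2 : p ∣ p ^ j := dvd_pow_self p hj0
      rw [← h1, Nat.dvd_add_right hd] at h2
      exact hp.one_lt.ne' (Nat.dvd_one.1 h2)
  -- power of order p
  obtain ⟨c, hcT, hc1, hcp, hcσ⟩ : ∃ c ∈ T, c ≠ 1 ∧ c ^ p = 1 ∧ c * σ = σ * c := by
    obtain ⟨j, hj⟩ : ∃ j : ℕ, orderOf c0 = p ^ j := by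
      obtain ⟨j, hj⟩ := hTp ⟨c0, hc0.1⟩
      have hj' : c0 ^ p ^ j = 1 := congrArg Subtype.val hj
      obtain ⟨i, -, hi⟩ := (Nat.dvd_prime_pow hp).1 (orderOf_dvd_of_pow_eq_one hj')
      exact ⟨i, hi⟩
    have hj0 : j ≠ 0 := by
      rintro rfl
      exact hc0.2 (orderOf_eq_one_iff.1 (by simpa using hj))
    refine ⟨c0 ^ p ^ (j - 1), T.pow_mem hc0.1 _, ?_, ?_, ?_⟩
    · intro h
      have := Nat.le_of_dvd (pow_pos hp.pos _) (orderOf_dvd_of_pow_eq_one h)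
      rw [hj] at this
      exact absurd this (not_le.2 (Nat.pow_lt_pow_right hp.one_lt (by omega)))
    · rw [← pow_mul, ← pow_succ, show j - 1 + 1 = j by omega, ← hj, pow_orderOf_eq_one]
    · have := hc0f σ (Subgroup.mem_zpowers σ)
      have h2 : Commute c0 σ := by
        show c0 * σ = σ * c0
        conv_lhs => rw [← this]
        group
      exact (Commute.pow_left h2 _).eq
  refine ⟨c, hTB hcT, hc1, hcp, hcσ, ?_⟩
  obtain ⟨b, hb, hcb⟩ := hcT
  have hcB : c ∈ B := by rw [hcb]; exact B.mul_mem hb (hBψ _ (B.inv_mem hb))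
  let W : ℕ → AddSubgroup U := fun j => KN U p c ⊓ U' ⊓ fx U (σ ^ p ^ j)
  have step : ∀ j ≤ k, Nat.card (W (j + 1)) ≤ Nat.card (W j) ^ p := by
    intro j hj
    set τ := σ ^ p ^ j with hτ
    have hτp : τ ^ p = σ ^ p ^ (j + 1) := by rw [hτ, ← pow_mul, ← pow_succ]
    have hτψ : τ ^ p ^ (k - j) = ψ := by rw [hτ, ← pow_mul, ← pow_add, hψ]; congr 2; omega
    have hcτ : Commute c τ := Commute.pow_right (show Commute c σ from hcσ) _
    have hBτ : ∀ x ∈ B, τ * x * τ⁻¹ ∈ B := pow_conj_mem hBσ _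
    have hU'τ : ∀ u ∈ U', τ • u ∈ U' := pow_smul_mem hU'σ _
    obtain ⟨β, hβB, hβ⟩ : ∃ β ∈ B, β * τ * β⁻¹ = c * τ := by
      have hm := bj_mem B hb hBτ (p ^ (k - j))
      rw [hτψ] at hm
      refine ⟨_, hm, ?_⟩
      set g := (b * τ) ^ p ^ (k - j) with hg
      have hgc : Commute (b * τ) g := Commute.pow_right (Commute.refl _) _
      set β := g * ψ⁻¹ with hβ
      have hψτ : Commute ψ τ := by rw [hτ]; exact Commute.pow_right hψσ _
      have e1 : τ * β * τ⁻¹ = β * c⁻¹ := by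
        have a1 : τ * β * τ⁻¹ = b⁻¹ * (b * τ * g) * (ψ⁻¹ * τ⁻¹) := by rw [hβ]; group
        have a2 : (ψ⁻¹ * τ⁻¹) = τ⁻¹ * ψ⁻¹ := by rw [← mul_inv_rev, ← mul_inv_rev, hψτ.eq]
        have a3 : τ * β * τ⁻¹ = b⁻¹ * (β * (ψ * b * ψ⁻¹)) := by
          rw [a1, a2, hgc.eq, hβ]; group
        rw [a3, hcb]
        have a4 := hBab _ (B.inv_mem hb) _ (B.mul_mem hm (hBψ b hb))
        rw [a4]
        group
      have e2 : β * τ * β⁻¹ = (τ * β * τ⁻¹)⁻¹ * (τ * β * τ⁻¹) * (β * τ * β⁻¹) := by group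
      have e3 : β * c = c * β := hBab _ hm _ hcB
      have e4 : τ * β = β * c⁻¹ * τ := by rw [← e1]; group
      have e5 : c * τ * β = β * τ := by
        rw [mul_assoc, e4, ← mul_assoc, ← mul_assoc, ← e3, mul_assoc β c, mul_inv_cancel, mul_one]
      rw [← e5]; group
    have hβc : Commute β c := hBab _ hβB _ hcB
    have hβi : ∀ i : ℕ, β ^ i * τ * (β ^ i)⁻¹ = c ^ i * τ := by
      intro i
      induction i with
      | zero => simp
      | succ i ih =>
        have : β ^ (i + 1) * τ * (β ^ (i + 1))⁻¹ = β * (β ^ i * τ * (β ^ i)⁻¹) * β⁻¹ := by rw [pow_succ']; group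
        rw [this, ih]
        have : β * (c ^ i * τ) * β⁻¹ = (β * c ^ i) * β⁻¹ * (β * τ * β⁻¹) := by group
        rw [this, (Commute.pow_right hβc i).eq, hβ, pow_succ]; group
    have hWinv : ∀ u ∈ KN U p c ⊓ U', ∀ i : ℕ, (c ^ i * τ) • u ∈ KN U p c ⊓ U' := by
      rintro u ⟨h1, h2⟩ i
      constructor
      · apply KN_inv _ h1
        exact (Commute.mul_right (Commute.pow_right (Commute.refl c) i) hcτ).eq
      · rw [mul_smul]
        exact hU'B _ (B.pow_mem hcB i) _ (hU'τ u h2)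
    have hWβ : ∀ u ∈ KN U p c ⊓ U', ∀ i : ℕ, (β ^ i)⁻¹ • u ∈ KN U p c ⊓ U' := by
      rintro u ⟨h1, h2⟩ i
      constructor
      · apply KN_inv _ h1
        exact (Commute.inv_right (Commute.pow_right hβc.symm i)).eq
      · exact hU'B _ (B.inv_mem (B.pow_mem hβB i)) _ h2
    have hmem : ∀ u ∈ W (j + 1), ∀ i : ℕ, (β ^ i)⁻¹ • nrm p (c ^ i * τ) u ∈ W j := by
      rintro u ⟨h1, h2⟩ i
      have h2' : τ ^ p • u = u := by rw [hτp]; exact h2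
      refine ⟨hWβ _ (nrm_mem (fun u hu => hWinv u hu i) p h1) i, ?_⟩
      show τ • (β ^ i)⁻¹ • nrm p (c ^ i * τ) u = (β ^ i)⁻¹ • nrm p (c ^ i * τ) u
      have h3 : (c ^ i * τ) • nrm p (c ^ i * τ) u = nrm p (c ^ i * τ) u := by
        apply smul_nrm
        rw [Commute.mul_pow (Commute.pow_left hcτ i), ← pow_mul, mul_comm i p, pow_mul, hcp, one_pow, one_mul, h2']
      have h4 : τ * (β ^ i)⁻¹ = (β ^ i)⁻¹ * (c ^ i * τ) := by rw [← hβi i]; group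
      rw [smul_smul, h4, mul_smul, h3]
    let F : W (j + 1) → (Fin p → W j) := fun u i => ⟨(β ^ (i : ℕ))⁻¹ • nrm p (c ^ (i : ℕ) * τ) (u : U), hmem u u.2 i⟩
    have hFinj : Function.Injective F := by
      intro u v huv
      apply Subtype.ext
      rw [← sub_eq_zero]
      refine avg_zero hp hU hcp hcτ.eq ((KN U p c).sub_mem u.2.1.1 v.2.1.1) ?_
      intro i hi
      have h1 := congrArg Subtype.val (congrFun huv ⟨i, hi⟩)
      have h2 : (β ^ i)⁻¹ • nrm p (c ^ i * τ) (u : U) = (β ^ i)⁻¹ • nrm p (c ^ i * τ) (v : U) := h1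
      rw [map_sub, smul_left_cancel _ h2, sub_self]
    have := Nat.card_le_card_of_injective F hFinj
    rwa [Nat.card_fun, Nat.card_eq_fintype_card (α := Fin p), Fintype.card_fin] at this
  have hall : ∀ j ≤ k + 1, Nat.card (W j) ≤ Nat.card (W 0) ^ p ^ j := by
    intro j
    induction j with
    | zero => intro _; simp
    | succ j ih =>
      intro hj
      refine (step j (by omega)).trans ?_
      rw [pow_succ, pow_mul]
      exact Nat.pow_le_pow_left (ih (by omega)) p
  have h1 := hall (k + 1) le_rfl
  have e1 : W (k + 1) = KN U p c ⊓ U' := by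
    ext u
    simp only [W, hσ, AddSubgroup.mem_inf, mem_fx, one_smul, and_true]
  have e0 : W 0 = KN U p c ⊓ U' ⊓ fx U σ := by simp [W]
  rwa [e1, e0] at h1

theorem pst_index [Finite U] (B : Subgroup Y) (S : AddSubgroup U) (hS : Inv B S) {M : ℕ} (hM : Nat.card S ≤ M) :
    (pst B S).relIndex B ≤ M ^ M := by
  have hb : Inv B (⊥ : AddSubgroup U) := by
    intro x hx w hw
    rw [AddSubgroup.mem_bot] at hw ⊢
    rw [hw, smul_zero]
  have := (tk_index B S ⊥ hS hb (q := M) (by rwa [AddSubgroup.relIndex_bot_left])).1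
  have e : tk B S ⊥ hS hb = pst B S := by
    ext x
    rw [mem_tk, mem_pst]
    simp only [AddSubgroup.mem_bot, sub_eq_zero]
  rwa [e] at this

theorem decomp [Finite U] {p : ℕ} (hp : p.Prime) (hU : ¬ p ∣ Nat.card U) {c : Y} (hc : c ^ p = 1) {U' : AddSubgroup U}
    (hcU : ∀ u ∈ U', c • u ∈ U') {x : Y} (h1 : ∀ u ∈ KN U p c ⊓ U', x • u = u) (h2 : ∀ u ∈ fx U c ⊓ U', x • u = u) :
    ∀ u ∈ U', x • u = u := by
  intro u hu
  have hn : nrm p c u ∈ fx U c ⊓ U' := ⟨smul_nrm (by rw [hc, one_smul]), nrm_mem hcU p hu⟩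
  have hk : p • u - nrm p c u ∈ KN U p c ⊓ U' := by
    refine ⟨?_, U'.sub_mem (U'.nsmul_mem hu p) hn.2⟩
    show nrm p c (p • u - nrm p c u) = 0
    rw [map_sub, map_nsmul, nrm_of_fix hn.1, sub_self]
  have h3 := h1 _ hk
  have h4 := h2 _ hn
  rw [smul_sub, h4, smul_nsmul_eq] at h3
  have h5 := sub_left_inj.1 h3
  rw [← sub_eq_zero]
  apply eq_zero_of_nsmul hp hU
  rw [nsmul_sub, h5, sub_self]
end

theorem factA {p : ℕ} (hp : p.Prime) (k : ℕ) (m : ℕ) : ∃ g : ℕ, ∀ (Y U : Type) [Group Y] [Finite Y] [AddCommGroup U] [Finite U] [DistribMulAction Y U]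
    (hU : ¬ p ∣ Nat.card U) (σ : Y) (hσ : σ ^ p ^ (k + 1) = 1)
    (B : Subgroup Y) (hBp : IsPGroup p B) (hBab : ∀ x ∈ B, ∀ y ∈ B, x * y = y * x) (hBσ : ∀ x ∈ B, σ * x * σ⁻¹ ∈ B)
    (U' : AddSubgroup U) (hU'B : Inv B U') (hU'σ : ∀ u ∈ U', σ • u ∈ U') (hf : ∀ x ∈ B, (∀ u ∈ U', x • u = u) → x = 1)
    (hm : Nat.card (U' ⊓ fx U σ : AddSubgroup U) ≤ m),
    (B ⊓ Subgroup.centralizer {σ ^ p ^ k}).relIndex B ≤ g := by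
  classical
  induction m with
  | zero =>
    refine ⟨0, ?_⟩
    intro Y U _ _ _ _ _ hU σ hσ B hBp hBab hBσ U' hU'B hU'σ hf hm
    have := Nat.card_pos (α := (U' ⊓ fx U σ : AddSubgroup U))
    omega
  | succ m ih =>
    obtain ⟨g, hg⟩ := ih
    set M := (m + 1) ^ p ^ (k + 1) with hM
    refine ⟨g * M ^ M + 1, ?_⟩
    intro Y U _ _ _ _ _ hU σ hσ B hBp hBab hBσ U' hU'B hU'σ hf hm
    set ψ := σ ^ p ^ k with hψ
    by_cases hall : ∀ b ∈ B, ψ * b = b * ψ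
    · have : B ⊓ Subgroup.centralizer {ψ} = B := by
        rw [inf_eq_left]
        intro b hb
        rw [Subgroup.mem_centralizer_iff]
        rintro _ rfl
        exact hall b hb
      rw [this, Subgroup.relIndex_self]
      omega
    · push Not at hall
      obtain ⟨b0, hb0, hb0ψ⟩ := hall
      obtain ⟨c, hcB, hc1, hcp, hcσ, hcard⟩ := lemA' hp hU k σ hσ B hBp hBab hBσ b0 hb0 hb0ψ U' hU'B hU'σ
      have hcU : ∀ u ∈ U', c • u ∈ U' := fun u hu => hU'B c hcB u hu
      have hsmall : Nat.card (KN U p c ⊓ U' ⊓ fx U σ : AddSubgroup U) ≤ m + 1 := by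
        refine le_trans ?_ hm
        exact AddSubgroup.card_le_of_le (inf_le_inf_right _ inf_le_right)
      have hKM : Nat.card (KN U p c ⊓ U' : AddSubgroup U) ≤ M := hcard.trans (Nat.pow_le_pow_left hsmall _)
      have hKinv : Inv B (KN U p c ⊓ U') := fun x hx u hu => ⟨KN_inv (hBab c hcB x hx) hu.1, hU'B x hx u hu.2⟩
      set B' := pst B (KN U p c ⊓ U') with hB'
      have hB'B : B' ≤ B := fun x hx => hx.1
      have hB'i := pst_index B _ hKinv hKM
      have hne : ∃ u ∈ U', c • u ≠ u := by
        by_contra h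
        push Not at h
        exact hc1 (hf c hcB h)
      obtain ⟨u0, hu0, hcu0⟩ := hne
      have hK0 : c • u0 - u0 ∈ KN U p c ⊓ U' := ⟨sub_mem_KN hcp u0, U'.sub_mem (hcU _ hu0) hu0⟩
      have hone : 1 < Nat.card (KN U p c ⊓ U' : AddSubgroup U) := by
        rw [Finite.one_lt_card_iff_nontrivial]
        refine ⟨⟨_, hK0⟩, 0, ?_⟩
        intro h
        exact hcu0 (sub_eq_zero.1 (congrArg Subtype.val h))
      have hone' : Nat.card (KN U p c ⊓ U' ⊓ fx U σ : AddSubgroup U) ≠ 1 := by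
        intro h
        rw [h, one_pow] at hcard
        omega
      have hlt : Nat.card (fx U c ⊓ U' ⊓ fx U σ : AddSubgroup U) < Nat.card (U' ⊓ fx U σ : AddSubgroup U) := by
        have hne : (KN U p c ⊓ U' ⊓ fx U σ : AddSubgroup U) ≠ ⊥ := fun h => hone' (by rw [h]; simp)
        obtain ⟨w, hw⟩ := AddSubgroup.ne_bot_iff_exists_ne_zero.1 hne
        have hss : ((fx U c ⊓ U' ⊓ fx U σ : AddSubgroup U) : Set U) ⊂ ((U' ⊓ fx U σ : AddSubgroup U) : Set U) := by
          refine ⟨fun u hu => ⟨hu.1.2, hu.2⟩, ?_⟩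
          intro h
          have := h (show (w : U) ∈ _ from ⟨w.2.1.2, w.2.2⟩)
          have := KN_fx hp hU w.2.1.1 this.1.1
          exact hw (Subtype.ext this)
        exact Set.ncard_lt_ncard hss (Set.toFinite _)
      have hrec := hg Y U hU σ hσ B' (hBp.to_le hB'B) (fun x hx y hy => hBab x (hB'B hx) y (hB'B hy))
        (by
          intro x hx
          refine ⟨hBσ x hx.1, ?_⟩
          intro u hu
          have hu' : σ⁻¹ • u ∈ KN U p c ⊓ U' := by
            have hpos : 0 < p ^ (k + 1) := pow_pos hp.pos _
            have e : σ⁻¹ = σ ^ (p ^ (k + 1) - 1) := by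
              rw [inv_eq_iff_mul_eq_one, ← pow_succ', Nat.sub_add_cancel hpos, hσ]
            rw [e]
            exact pow_smul_mem (U' := KN U p c ⊓ U') (fun u hu => ⟨KN_inv hcσ hu.1, hU'σ u hu.2⟩) _ u hu
          rw [mul_smul, mul_smul, hx.2 _ hu', smul_inv_smul])
        (fx U c ⊓ U')
        (by
          intro x hx u hu
          refine ⟨?_, hU'B x (hB'B hx) u hu.2⟩
          show c • x • u = x • u
          rw [smul_smul, hBab c hcB x (hB'B hx), mul_smul, show c • u = u from hu.1])
        (by
          intro u hu
          refine ⟨?_, hU'σ u hu.2⟩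
          show c • σ • u = σ • u
          rw [smul_smul, hcσ, mul_smul, show c • u = u from hu.1])
        (by
          intro x hx h
          exact hf x (hB'B hx) (decomp hp hU hcp hcU hx.2 h))
        (by omega)
      have h1 : (B ⊓ Subgroup.centralizer {ψ}).relIndex B ≤ (B' ⊓ Subgroup.centralizer {ψ}).relIndex B := by
        apply Nat.le_of_dvd
        · exact Nat.pos_of_ne_zero (Subgroup.index_ne_zero_of_finite)
        · exact Subgroup.relIndex_dvd_of_le_left _ (inf_le_inf_right _ hB'B)
      have h2 := Subgroup.relIndex_mul_relIndex (B' ⊓ Subgroup.centralizer {ψ}) B' B inf_le_left hB'B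
      rw [← h2] at h1
      rw [← hψ] at hrec
      rw [← hB'] at hB'i
      have := Nat.mul_le_mul hrec hB'i
      omega
end PLen


namespace PLen

theorem zbasis {p : ℕ} (hp : p.Prime) (V : Type) [AddCommGroup V] [Finite V] (h : ∀ v : V, p • v = 0) :
    ∃ (d : ℕ) (e : Fin d → V), Nat.card V = p ^ d ∧ ∀ t : Fin d → ZMod p, ∑ i, (t i).val • e i = 0 → t = 0 := by
  haveI := Fact.mk hp
  letI : Module (ZMod p) V := AddCommGroup.zmodModule (n := p) h
  haveI : Module.Finite (ZMod p) V := Module.Finite.of_finite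
  refine ⟨Module.finrank (ZMod p) V, Module.finBasis (ZMod p) V, ?_, ?_⟩
  · rw [Module.natCard_eq_pow_finrank (K := ZMod p), Nat.card_zmod]
  · intro t ht
    funext i
    refine Fintype.linearIndependent_iff.1 (Module.finBasis (ZMod p) V).linearIndependent t ?_ i
    rw [← ht]
    refine Finset.sum_congr rfl fun i _ => ?_
    rw [← Nat.cast_smul_eq_nsmul (ZMod p), ZMod.natCast_val, ZMod.cast_id', id]

theorem quadForms {p : ℕ} (hp : p.Prime) (E : Type) [Group E] [Finite E] (C : Subgroup E)
    (hcomm : ∀ x y : E, x * y * x⁻¹ * y⁻¹ ∈ C) (hpow : ∀ x : E, x ^ p ∈ C) (r : ℕ)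
    (β : Fin r → E → E → ZMod p) (hβ1 : ∀ s x x' y, β s (x * x') y = β s x y + β s x' y)
    (hβ2 : ∀ s x y y', β s x (y * y') = β s x y + β s x y')
    (h : ∀ x, (∀ s, β s x x = 0) → x ∈ C) : C.index ≤ p ^ (2 * r) := by
  classical
  haveI := Fact.mk hp
  haveI hCn : C.Normal := ⟨fun n hn g => by
    have := C.mul_mem (hcomm g n) hn
    simpa [mul_assoc] using this⟩
  letI : CommGroup (E ⧸ C) :=
    { (inferInstance : Group (E ⧸ C)) with
      mul_comm := by
        intro a b
        obtain ⟨x, rfl⟩ := QuotientGroup.mk_surjective a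
        obtain ⟨y, rfl⟩ := QuotientGroup.mk_surjective b
        show ((x * y : E) : E ⧸ C) = ((y * x : E) : E ⧸ C)
        rw [QuotientGroup.eq]
        have := hcomm y⁻¹ x⁻¹
        simpa [mul_assoc] using this }
  obtain ⟨d, e, hcard0, hind⟩ := zbasis hp (Additive (E ⧸ C)) (by
    intro v
    obtain ⟨x, hx⟩ := QuotientGroup.mk_surjective (Additive.toMul v)
    apply Additive.toMul.injective
    rw [toMul_nsmul, ← hx]
    show ((x ^ p : E) : E ⧸ C) = 1
    exact (QuotientGroup.eq_one_iff _).2 (hpow x))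
  by_contra hcon
  push Not at hcon
  have hcard : C.index = p ^ d := hcard0
  rw [hcard] at hcon
  have hdr : 2 * r < d := (Nat.pow_lt_pow_iff_right hp.one_lt).1 hcon
  choose x hx using fun i => QuotientGroup.mk_surjective (Additive.toMul (e i))
  let w : (Fin d → ZMod p) → E := fun t => (List.ofFn fun i => x i ^ (t i).val).prod
  have hw : ∀ t, Additive.ofMul ((w t : E) : E ⧸ C) = ∑ i, (t i).val • e i := by
    intro t
    have h1 : ((w t : E) : E ⧸ C) = QuotientGroup.mk' C (w t) := rfl
    rw [h1]
    simp only [w]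
    rw [map_list_prod, List.map_ofFn, List.prod_ofFn, ofMul_prod]
    refine Finset.sum_congr rfl fun i _ => ?_
    simp only [Function.comp_apply, map_pow]
    have h2 : (QuotientGroup.mk' C (x i)) = Additive.toMul (e i) := hx i
    rw [h2, ofMul_pow, ofMul_toMul]
  have hβl : ∀ s y t, β s (w t) y = ∑ i, t i * β s (x i) y := by
    intro s y t
    let f : E →* Multiplicative (ZMod p) :=
      { toFun := fun x => Multiplicative.ofAdd (β s x y)
        map_one' := by
          have := hβ1 s 1 1 y
          rw [mul_one] at this
          have h0 : β s 1 y = 0 := by simpa using this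
          rw [h0]; rfl
        map_mul' := fun a b => by rw [hβ1]; rfl }
    have h1 : Multiplicative.ofAdd (β s (w t) y) = f (w t) := rfl
    apply Multiplicative.ofAdd.injective
    rw [h1]
    simp only [w]
    rw [map_list_prod, List.map_ofFn, List.prod_ofFn, ofAdd_sum]
    refine Finset.prod_congr rfl fun i _ => ?_
    simp only [Function.comp_apply, map_pow]
    show (Multiplicative.ofAdd (β s (x i) y)) ^ (t i).val = _
    rw [← ofAdd_nsmul, nsmul_eq_mul, ZMod.natCast_val, ZMod.cast_id', id]
  have hβr : ∀ s y t, β s y (w t) = ∑ i, t i * β s y (x i) := by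
    intro s y t
    let f : E →* Multiplicative (ZMod p) :=
      { toFun := fun x => Multiplicative.ofAdd (β s y x)
        map_one' := by
          have := hβ2 s y 1 1
          rw [mul_one] at this
          have h0 : β s y 1 = 0 := by simpa using this
          rw [h0]; rfl
        map_mul' := fun a b => by rw [hβ2]; rfl }
    have h1 : Multiplicative.ofAdd (β s y (w t)) = f (w t) := rfl
    apply Multiplicative.ofAdd.injective
    rw [h1]
    simp only [w]
    rw [map_list_prod, List.map_ofFn, List.prod_ofFn, ofAdd_sum]
    refine Finset.prod_congr rfl fun i _ => ?_
    simp only [Function.comp_apply, map_pow]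
    show (Multiplicative.ofAdd (β s y (x i))) ^ (t i).val = _
    rw [← ofAdd_nsmul, nsmul_eq_mul, ZMod.natCast_val, ZMod.cast_id', id]
  let f : Fin r → MvPolynomial (Fin d) (ZMod p) := fun s =>
    ∑ i, ∑ j, MvPolynomial.C (β s (x i) (x j)) * (MvPolynomial.X i * MvPolynomial.X j)
  have hdeg : ∀ s, (f s).totalDegree ≤ 2 := by
    intro s
    refine MvPolynomial.totalDegree_finsetSum_le fun i _ => MvPolynomial.totalDegree_finsetSum_le fun j _ => ?_
    refine (MvPolynomial.totalDegree_mul _ _).trans ?_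
    rw [MvPolynomial.totalDegree_C, zero_add]
    refine (MvPolynomial.totalDegree_mul _ _).trans ?_
    rw [MvPolynomial.totalDegree_X, MvPolynomial.totalDegree_X]
  have heval : ∀ s t, MvPolynomial.eval t (f s) = β s (w t) (w t) := by
    intro s t
    rw [hβl]
    simp only [f, map_sum, map_mul, MvPolynomial.eval_C, MvPolynomial.eval_X]
    refine Finset.sum_congr rfl fun i _ => ?_
    rw [hβr, Finset.mul_sum]
    refine Finset.sum_congr rfl fun j _ => ?_
    ring
  have hCW := char_dvd_card_solutions_of_fintype_sum_lt (K := ZMod p) p (f := f) (by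
    rw [Fintype.card_fin]
    refine lt_of_le_of_lt (Finset.sum_le_card_nsmul _ _ 2 (fun s _ => hdeg s)) ?_
    simp; omega)
  -- nonzero solution
  obtain ⟨t, ht, ht0⟩ : ∃ t : Fin d → ZMod p, (∀ s, MvPolynomial.eval t (f s) = 0) ∧ t ≠ 0 := by
    by_contra hno
    push Not at hno
    have hone : Fintype.card { t : Fin d → ZMod p // ∀ i, MvPolynomial.eval t (f i) = 0 } = 1 := by
      rw [Fintype.card_eq_one_iff]
      refine ⟨⟨0, ?_⟩, ?_⟩
      · intro s
        rw [heval, hβl]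
        simp
      · rintro ⟨t, ht⟩
        exact Subtype.ext (hno t ht)
    have hd1 : p ∣ 1 := by
      convert hCW
      rw [← hone]
      exact @Fintype.card_congr _ _ (_) (_) (Equiv.refl _)
    exact hp.one_lt.ne' (Nat.dvd_one.1 hd1)
  have hmem := h (w t) (fun s => by rw [← heval]; exact ht s)
  have h0 := hw t
  rw [(QuotientGroup.eq_one_iff _).2 hmem] at h0
  exact ht0 (hind t h0.symm)

/-- elements whose commutator with ψ centralises E -/
def CC {Y : Type} [Group Y] (E : Subgroup Y) (ψ : Y) : Subgroup Y where
  carrier := {x | x ∈ E ∧ ∀ y ∈ E, (ψ * x * ψ⁻¹ * x⁻¹) * y = y * (ψ * x * ψ⁻¹ * x⁻¹)}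
  one_mem' := ⟨E.one_mem, fun y _ => by simp⟩
  mul_mem' := by
    rintro a b ⟨ha, ha2⟩ ⟨hb, hb2⟩
    refine ⟨E.mul_mem ha hb, ?_⟩
    have e : ψ * (a * b) * ψ⁻¹ * (a * b)⁻¹ = (ψ * a * ψ⁻¹ * a⁻¹) * (ψ * b * ψ⁻¹ * b⁻¹) := by
      have h1 : ψ * (a * b) * ψ⁻¹ * (a * b)⁻¹ = ψ * a * ψ⁻¹ * ((ψ * b * ψ⁻¹ * b⁻¹) * a⁻¹) := by group
      rw [h1, hb2 _ (E.inv_mem ha)]; group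
    intro y hy
    rw [e, mul_assoc, hb2 y hy, ← mul_assoc, ha2 y hy, mul_assoc]
  inv_mem' := by
    rintro a ⟨ha, ha2⟩
    refine ⟨E.inv_mem ha, ?_⟩
    have e : ψ * a⁻¹ * ψ⁻¹ * a⁻¹⁻¹ = (ψ * a * ψ⁻¹ * a⁻¹)⁻¹ := by
      have h1 : ψ * a⁻¹ * ψ⁻¹ * a⁻¹⁻¹ = a⁻¹ * (ψ * a * ψ⁻¹ * a⁻¹)⁻¹ * a := by group
      rw [h1]
      have h2 := ha2 a ha
      have h3 : Commute (ψ * a * ψ⁻¹ * a⁻¹) a := h2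
      rw [mul_assoc, (h3.inv_left).eq, inv_mul_cancel_left]
    intro y hy
    rw [e]
    exact (Commute.inv_left (show Commute _ y from ha2 y hy)).eq

theorem mem_CC {Y : Type} [Group Y] {E : Subgroup Y} {ψ x : Y} :
    x ∈ CC E ψ ↔ x ∈ E ∧ ∀ y ∈ E, (ψ * x * ψ⁻¹ * x⁻¹) * y = y * (ψ * x * ψ⁻¹ * x⁻¹) := Iff.rfl

theorem lemTwo {p : ℕ} (hp : p.Prime) (k m : ℕ) : ∃ N : ℕ, ∀ (Y W : Type) [Group Y] [Finite Y] [AddCommGroup W] [Finite W] [DistribMulAction Y W]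
    (hW : ¬ p ∣ Nat.card W) (E : Subgroup Y) (hEp : IsPGroup p E) (hf : ∀ x ∈ E, (∀ w : W, x • w = w) → x = 1)
    (z : Y) (hzE : z ∈ E) (hzp : z ^ p = 1) (hzf : ∀ w : W, z • w = w → w = 0) (σ : Y) (hσ : σ ^ p ^ (k + 1) = 1)
    (hzc : ∀ x ∈ E, z * x = x * z) (hzσ : z * σ = σ * z)
    (hcomm : ∀ x ∈ E, ∀ y ∈ E, x * y * x⁻¹ * y⁻¹ ∈ Subgroup.zpowers z)
    (hpow : ∀ x ∈ E, ∀ y ∈ E, x ^ p * y = y * x ^ p)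
    (hEσ : ∀ x ∈ E, σ * x * σ⁻¹ ∈ E) (hm : Nat.card (fx W σ) ≤ m),
    (CC E (σ ^ p ^ k)).relIndex E ≤ N := by
  classical
  set M := m ^ p ^ (k + 1) with hM
  refine ⟨p ^ (2 * p ^ (k + 1)) + M ^ M + (M * M) ^ (M * M), ?_⟩
  intro Y W _ _ _ _ _ hW E hEp hf z hzE hzp hzf σ hσ hzc hzσ hcomm hpow hEσ hm
  haveI := Fact.mk hp
  set ψ := σ ^ p ^ k with hψ
  have hEψ : ∀ x ∈ E, ψ * x * ψ⁻¹ ∈ E := pow_conj_mem hEσ _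
  -- powers of z
  have hzgen : ∀ g ∈ Subgroup.zpowers z, g ≠ 1 → ∀ w : W, g • w = w → w = 0 := by
    intro g hg hg1 w hw
    apply hzf
    rw [← mem_powers_iff_mem_zpowers] at hg
    obtain ⟨i, rfl⟩ := hg
    have hi : ¬ p ∣ i := by
      rintro ⟨j, rfl⟩
      apply hg1
      show z ^ (p * j) = 1
      rw [pow_mul, hzp, one_pow]
    have hcop : Nat.gcd i p = 1 := Nat.Coprime.symm ((Nat.Prime.coprime_iff_not_dvd hp).2 hi)
    obtain ⟨j, -, hj⟩ := Nat.exists_mul_mod_eq_one_of_coprime hcop hp.one_lt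
    have h1 : z = (z ^ i) ^ j := by
      rw [← pow_mul, pow_mod_natCard_aux hzp, hj, pow_one]
    rw [h1]
    have : ∀ j : ℕ, (z ^ i) ^ j • w = w := by
      intro j
      induction j with
      | zero => simp
      | succ j ih => rw [pow_succ, mul_smul]; rw [show z ^ i • w = w from hw, ih]
    exact this j
  by_cases hI : ∃ B : Subgroup Y, B ≤ E ∧ (∀ x ∈ B, ∀ y ∈ B, x * y = y * x) ∧ (∀ x ∈ B, σ * x * σ⁻¹ ∈ B) ∧ ∃ b0 ∈ B, ψ * b0 ≠ b0 * ψ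
  · obtain ⟨B, hBE, hBab, hBσ, b0, hb0, hb0ψ⟩ := hI
    obtain ⟨c, hcB, hc1, hcp, hcσ, hcard⟩ := lemA' hp hW k σ hσ B (hEp.to_le hBE) hBab hBσ b0 hb0 hb0ψ ⊤ (fun _ _ _ _ => trivial) (fun _ _ => trivial)
    rw [inf_top_eq] at hcard
    have hcE := hBE hcB
    have hKM : Nat.card (KN W p c) ≤ M := by
      refine hcard.trans (Nat.pow_le_pow_left (le_trans ?_ hm) _)
      exact AddSubgroup.card_le_of_le inf_le_right
    obtain ⟨w0, hw0⟩ : ∃ w : W, c • w ≠ w := by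
      by_contra h
      push Not at h
      exact hc1 (hf c hcE h)
    by_cases hcc : ∀ y ∈ E, c * y = y * c
    · have hKinv : Inv E (KN W p c) := fun x hx u hu => KN_inv (hcc x hx) hu
      have h1 := pst_index E _ hKinv hKM
      have h2 : pst E (KN W p c) ≤ CC E ψ := by
        have hcen : ∀ x ∈ pst E (KN W p c), ∀ y ∈ E, x * y = y * x := by
          rintro x ⟨hx, hx2⟩ y hy
          by_contra hne
          have h3 : x * y * x⁻¹ * y⁻¹ ≠ 1 := by
            intro h
            apply hne
            rw [mul_inv_eq_one, mul_inv_eq_iff_eq_mul] at h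
            exact h
          apply hw0
          rw [← sub_eq_zero]
          apply hzgen _ (hcomm x hx y hy) h3
          have hk := sub_mem_KN hcp w0
          set u := c • w0 - w0 with hu
          have h4 : y⁻¹ • u ∈ KN W p c := hKinv _ (E.inv_mem hy) _ hk
          have h5 : x⁻¹ • y⁻¹ • u = y⁻¹ • u := by rw [inv_smul_eq_iff, hx2 _ h4]
          rw [mul_smul, mul_smul, mul_smul, h5, smul_inv_smul, hx2 _ hk]
        intro x hx
        refine ⟨hx.1, ?_⟩
        intro y hy
        have h6 : ψ⁻¹ * y * ψ ∈ E := by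
          have e : ψ⁻¹ = ψ ^ (p - 1) := by
            rw [inv_eq_iff_mul_eq_one, ← pow_succ', Nat.sub_add_cancel hp.one_le, hψ, ← pow_mul, ← pow_succ, hσ]
          have := pow_conj_mem hEψ (p - 1) y hy
          rw [← e, inv_inv] at this
          exact this
        have h7 := hcen x hx _ h6
        have h8 : ψ * x * ψ⁻¹ * y = y * (ψ * x * ψ⁻¹) := by
          have e1 : ψ * x * ψ⁻¹ * y = ψ * (x * (ψ⁻¹ * y * ψ)) * ψ⁻¹ := by group
          rw [e1, h7]; group
        have h9 : x⁻¹ * y = y * x⁻¹ := (Commute.inv_left (show Commute x y from hcen x hx y hy)).eq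
        rw [mul_assoc, h9, ← mul_assoc, h8, mul_assoc]
      have h3 : (CC E ψ).relIndex E ≤ (pst E (KN W p c)).relIndex E :=
        Nat.le_of_dvd (Nat.pos_of_ne_zero Subgroup.index_ne_zero_of_finite) (Subgroup.relIndex_dvd_of_le_left _ h2)
      omega
    · push Not at hcc
      obtain ⟨y, hy, hcy⟩ := hcc
      have hidx : (fx W c).index ≤ M := by
        let f : W →+ W := DistribSMul.toAddMonoidHom W c - AddMonoidHom.id W
        have hfa : ∀ w, f w = c • w - w := fun _ => rfl
        have hker : f.ker = fx W c := by
          ext w; rw [AddMonoidHom.mem_ker, hfa, mem_fx, sub_eq_zero]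
        rw [← hker, AddSubgroup.index_ker]
        refine le_trans (AddSubgroup.card_le_of_le ?_) hKM
        rintro _ ⟨w, rfl⟩
        exact sub_mem_KN hcp w
      have hfc : Nat.card (fx W c) ≤ M := by
        refine le_trans ?_ hKM
        let F : fx W c → KN W p c := fun w => ⟨c • y • (w : W) - y • (w : W), sub_mem_KN hcp _⟩
        apply Nat.card_le_card_of_injective F
        intro a b hab
        have h1 : c • y • (a : W) - y • (a : W) = c • y • (b : W) - y • (b : W) := congrArg Subtype.val hab
        apply Subtype.ext
        rw [← sub_eq_zero]
        have hd : (a : W) - b ∈ fx W c := (fx W c).sub_mem a.2 b.2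
        have h2 : c • y • ((a : W) - b) = y • ((a : W) - b) := by
          rw [smul_sub, smul_sub, ← sub_eq_zero]
          rw [← sub_eq_zero] at h1
          rw [← h1]; abel
        have hne : c⁻¹ * y⁻¹ * c⁻¹⁻¹ * y⁻¹⁻¹ ≠ 1 := by
          intro h
          apply hcy
          rw [inv_inv, inv_inv] at h
          have : c * y = y * c * (c⁻¹ * y⁻¹ * c * y) := by group
          rw [this, h, mul_one]
        apply hzgen _ (hcomm c⁻¹ (E.inv_mem hcE) y⁻¹ (E.inv_mem hy)) hne
        rw [inv_inv, inv_inv, mul_smul, mul_smul, mul_smul, h2, inv_smul_smul, inv_smul_eq_iff]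
        exact hd.symm
      have hWc : Nat.card (⊤ : AddSubgroup W) ≤ M * M := by
        rw [AddSubgroup.card_top, ← (fx W c).card_mul_index]
        exact Nat.mul_le_mul hfc hidx
      have h1 := pst_index E (⊤ : AddSubgroup W) (fun _ _ _ _ => trivial) hWc
      have h2 : pst E (⊤ : AddSubgroup W) = ⊥ := by
        rw [eq_bot_iff]
        intro x hx
        exact hf x hx.1 fun w => hx.2 w trivial
      rw [h2] at h1
      have h3 : (CC E ψ).relIndex E ≤ (⊥ : Subgroup Y).relIndex E :=
        Nat.le_of_dvd (Nat.pos_of_ne_zero Subgroup.index_ne_zero_of_finite) (Subgroup.relIndex_dvd_of_le_left _ bot_le)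
      omega
  · push Not at hI
    by_cases hz1 : z = 1
    · have : (CC E ψ).relIndex E = 1 := by
        rw [Subgroup.relIndex_eq_one]
        intro x hx
        have : x = 1 := hf x hx fun w => by
          rw [hzf w (by rw [hz1, one_smul]), smul_zero]
        rw [this]; exact Subgroup.one_mem _
      have hpos : 0 < p ^ (2 * p ^ (k + 1)) := pow_pos hp.pos _
      omega
    have hoz : orderOf z = p := orderOf_eq_prime hzp hz1
    have hcent : ∀ g ∈ Subgroup.zpowers z, ∀ x ∈ E, g * x = x * g := by
      rintro _ ⟨i, rfl⟩ x hx
      exact (Commute.zpow_left (show Commute z x from hzc x hx) i).eq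
    have hEs : ∀ (i : ℕ), ∀ x ∈ E, σ ^ i * x * (σ ^ i)⁻¹ ∈ E := fun i => pow_conj_mem hEσ i
    let sg : ℕ → E → E := fun i x => ⟨σ ^ i * x * (σ ^ i)⁻¹, hEs i x x.2⟩
    have hsgm : ∀ i x y, sg i (x * y) = sg i x * sg i y := by
      intro i x y
      apply Subtype.ext
      show σ ^ i * ((x : Y) * y) * (σ ^ i)⁻¹ = (σ ^ i * x * (σ ^ i)⁻¹) * (σ ^ i * y * (σ ^ i)⁻¹)
      group
    choose ν hν using fun x y : E => Subgroup.mem_zpowers_iff.1 (hcomm x x.2 y y.2)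
    have hνeq : ∀ (x y : E) (n : ℤ), z ^ n = (x : Y) * y * (x : Y)⁻¹ * (y : Y)⁻¹ → ((ν x y : ℤ) : ZMod p) = (n : ZMod p) := by
      intro x y n h
      rw [← hν x y] at h
      rw [zpow_eq_zpow_iff_modEq, hoz] at h
      exact ((ZMod.intCast_eq_intCast_iff _ _ _).2 h).symm
    have hν1 : ∀ x x' y : E, ((ν (x * x') y : ℤ) : ZMod p) = ((ν x y : ℤ) : ZMod p) + ((ν x' y : ℤ) : ZMod p) := by
      intro x x' y
      rw [← Int.cast_add]
      apply hνeq
      have h1 := hcent _ (hcomm x' x'.2 y y.2) _ (E.inv_mem x.2)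
      rw [add_comm, zpow_add, hν, hν]
      have e : ((x * x' : E) : Y) * y * ((x * x' : E) : Y)⁻¹ * (y : Y)⁻¹ = x * (((x' : Y) * y * (x' : Y)⁻¹ * (y : Y)⁻¹)) * ((y : Y) * (x : Y)⁻¹ * (y : Y)⁻¹) := by
        rw [Subgroup.coe_mul]; group
      have h2 := hcent _ (hcomm x' x'.2 y y.2) _ x.2
      rw [e, ← h2]; group
    have hν2 : ∀ x y y' : E, ((ν x (y * y') : ℤ) : ZMod p) = ((ν x y : ℤ) : ZMod p) + ((ν x y' : ℤ) : ZMod p) := by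
      intro x y y'
      rw [← Int.cast_add]
      apply hνeq
      rw [zpow_add, hν, hν]
      have h1 := hcent _ (hcomm x x.2 y' y'.2) _ (E.inv_mem y.2)
      have e : (x : Y) * ((y * y' : E) : Y) * (x : Y)⁻¹ * ((y * y' : E) : Y)⁻¹ = (x * y * (x : Y)⁻¹) * (((x : Y) * y' * (x : Y)⁻¹ * (y' : Y)⁻¹) * (y : Y)⁻¹) := by
        rw [Subgroup.coe_mul]; group
      rw [e, h1]; group
    have hq := quadForms hp E ((CC E ψ).subgroupOf E) ?_ ?_ (p ^ (k + 1)) (fun s x y => ((ν x (sg s y) : ℤ) : ZMod p))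
      (fun s x x' y => hν1 x x' _) (fun s x y y' => by
        show ((ν x (sg s (y * y')) : ℤ) : ZMod p) = _
        rw [hsgm, hν2]) ?_
    · have : (CC E ψ).relIndex E ≤ p ^ (2 * p ^ (k + 1)) := hq
      omega
    · -- commutators in CC
      intro x y
      rw [Subgroup.mem_subgroupOf]
      have hg := hcomm x x.2 y y.2
      refine ⟨(x * y * x⁻¹ * y⁻¹ : E).2, ?_⟩
      obtain ⟨i, hi⟩ := Subgroup.mem_zpowers_iff.1 hg
      have hzψ : Commute z ψ := Commute.pow_right (show Commute z σ from hzσ) _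
      have e0 : ((x * y * x⁻¹ * y⁻¹ : E) : Y) = z ^ i := hi.symm
      intro t _
      rw [e0, ((hzψ.zpow_left i).symm).eq]
      simp
    · intro x
      rw [Subgroup.mem_subgroupOf]
      refine ⟨(x ^ p).2, ?_⟩
      intro t ht
      rw [Subgroup.coe_pow]
      have e : ψ * (x : Y) ^ p * ψ⁻¹ = (ψ * x * ψ⁻¹) ^ p := by rw [conj_pow]
      rw [e]
      have h1 : Commute ((ψ * x * ψ⁻¹) ^ p) t := hpow _ (hEψ x x.2) t ht
      have h2 : Commute ((x : Y) ^ p) t := hpow _ x.2 t ht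
      exact (h1.mul_left h2.inv_left).eq
    · intro x hx
      have hc : ∀ s < p ^ (k + 1), Commute (x : Y) (σ ^ s * x * (σ ^ s)⁻¹) := by
        intro s hs
        have h1 := hx ⟨s, hs⟩
        have h2 : ((ν x (sg s x) : ℤ) : ZMod p) = 0 := h1
        rw [ZMod.intCast_zmod_eq_zero_iff_dvd] at h2
        have h3 := hν x (sg s x)
        obtain ⟨j, hj⟩ := h2
        rw [hj, zpow_mul, zpow_natCast, hzp, one_zpow, eq_comm, mul_inv_eq_one, mul_inv_eq_iff_eq_mul] at h3
        exact h3
      have hc' : ∀ s : ℕ, Commute (x : Y) (σ ^ s * x * (σ ^ s)⁻¹) := by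
        intro s
        rw [pow_mod_natCard_aux hσ s]
        exact hc _ (Nat.mod_lt _ (pow_pos hp.pos _))
      have hcj : ∀ a b : ℕ, Commute (σ ^ a * x * (σ ^ a)⁻¹) (σ ^ (a + b) * x * (σ ^ (a + b))⁻¹) := by
        intro a b
        have h1 := (Commute.conj_iff (σ ^ a)).2 (hc' b)
        have e : σ ^ a * (σ ^ b * x * (σ ^ b)⁻¹) * (σ ^ a)⁻¹ = σ ^ (a + b) * x * (σ ^ (a + b))⁻¹ := by rw [pow_add]; group
        rwa [e] at h1
      let O : Set Y := Set.range fun a : ℕ => σ ^ a * x * (σ ^ a)⁻¹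
      have hOc : ∀ a ∈ O, ∀ b ∈ O, a * b = b * a := by
        rintro _ ⟨a, rfl⟩ _ ⟨b, rfl⟩
        rcases le_total a b with h | h
        · obtain ⟨c, rfl⟩ := Nat.exists_eq_add_of_le h
          exact (hcj a c).eq
        · obtain ⟨c, rfl⟩ := Nat.exists_eq_add_of_le h
          exact (hcj b c).eq.symm
      have hB := hI (Subgroup.closure O) (by
          rw [Subgroup.closure_le]
          rintro _ ⟨a, rfl⟩
          exact hEs a x x.2) (by
          intro u hu v hv
          letI := Subgroup.isMulCommutative_closure hOc
          have := (Subgroup.isMulCommutative_closure hOc).is_comm.comm ⟨u, hu⟩ ⟨v, hv⟩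
          exact congrArg Subtype.val this) (by
          intro u hu
          have : Subgroup.closure O ≤ (Subgroup.closure O).comap (MulAut.conj σ).toMonoidHom := by
            rw [Subgroup.closure_le]
            rintro _ ⟨a, rfl⟩
            apply Subgroup.subset_closure
            refine ⟨a + 1, ?_⟩
            simp [pow_succ', mul_assoc]
          exact this hu) (x : Y) (Subgroup.subset_closure ⟨0, by simp⟩)
      rw [Subgroup.mem_subgroupOf]
      refine ⟨x.2, ?_⟩
      intro y _
      rw [hB]
      simp
end PLen


namespace PLen

theorem secAct {X : Type} [Group X] [Finite X] (K E R : Subgroup X) (hRE : R ≤ E)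
    (hcomm : ∀ x ∈ E, ∀ y ∈ E, x * y * x⁻¹ * y⁻¹ ∈ R) (hKE : ∀ k ∈ K, ∀ x ∈ E, k * x * k⁻¹ ∈ E)
    (hKR : ∀ k ∈ K, ∀ x ∈ R, k * x * k⁻¹ ∈ R) :
    ∃ (V : Type) (_ : AddCommGroup V) (_ : Finite V) (_ : DistribMulAction K V) (f : E → V),
      Function.Surjective f ∧ (∀ x y, f (x * y) = f x + f y) ∧ (∀ x, f x = 0 ↔ (x : X) ∈ R) ∧
      (∀ (k : K) (x : E), k • f x = f ⟨k * x * (k : X)⁻¹, hKE k k.2 x x.2⟩) ∧ Nat.card V = R.relIndex E ∧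
      ∀ W : AddSubgroup V, ∃ T : Subgroup X, T ≤ E ∧ (∀ x : E, (x : X) ∈ T ↔ f x ∈ W) ∧ T.relIndex E = W.index := by
  classical
  haveI hCn : (R.subgroupOf E).Normal := ⟨fun n hn g => by
    rw [Subgroup.mem_subgroupOf] at hn ⊢
    have := R.mul_mem (hcomm g g.2 n n.2) hn
    simpa [mul_assoc] using this⟩
  letI : CommGroup (E ⧸ R.subgroupOf E) :=
    { (inferInstance : Group (E ⧸ R.subgroupOf E)) with
      mul_comm := by
        intro a b
        obtain ⟨x, rfl⟩ := QuotientGroup.mk_surjective a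
        obtain ⟨y, rfl⟩ := QuotientGroup.mk_surjective b
        show ((x * y : E) : E ⧸ R.subgroupOf E) = ((y * x : E) : E ⧸ R.subgroupOf E)
        rw [QuotientGroup.eq, Subgroup.mem_subgroupOf]
        have := hcomm (y : X)⁻¹ (E.inv_mem y.2) (x : X)⁻¹ (E.inv_mem x.2)
        simpa [mul_assoc] using this }
  let cjh : K → (E →* E) := fun k =>
    { toFun := fun x => ⟨k * x * (k : X)⁻¹, hKE k k.2 x x.2⟩
      map_one' := Subtype.ext (by simp)
      map_mul' := fun x y => Subtype.ext (by simp) }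
  let cjq : K → (E ⧸ R.subgroupOf E →* E ⧸ R.subgroupOf E) := fun k =>
    QuotientGroup.map _ _ (cjh k) (fun x hx => by
      rw [Subgroup.mem_comap, Subgroup.mem_subgroupOf]
      exact hKR k k.2 x hx)
  have hcjq : ∀ k (x : E), cjq k (x : E ⧸ R.subgroupOf E) = (cjh k x : E) := fun k x => rfl
  let V := Additive (E ⧸ R.subgroupOf E)
  letI iV : AddCommGroup V := inferInstanceAs (AddCommGroup (Additive (E ⧸ R.subgroupOf E)))
  let act : DistribMulAction K V :=
    { smul := fun k v => Additive.ofMul (cjq k (Additive.toMul v))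
      one_smul := fun v => by
        obtain ⟨x, hx⟩ := QuotientGroup.mk_surjective (Additive.toMul v)
        apply Additive.toMul.injective
        show cjq 1 (Additive.toMul v) = _
        rw [← hx, hcjq]
        congr 1
        exact Subtype.ext (by simp [cjh])
      mul_smul := fun k l v => by
        obtain ⟨x, hx⟩ := QuotientGroup.mk_surjective (Additive.toMul v)
        apply Additive.toMul.injective
        show cjq (k * l) (Additive.toMul v) = cjq k (cjq l (Additive.toMul v))
        rw [← hx, hcjq, hcjq, hcjq]
        congr 1
        exact Subtype.ext (by simp [cjh, mul_assoc])
      smul_zero := fun k => by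
        apply Additive.toMul.injective
        exact map_one (cjq k)
      smul_add := fun k v w => by
        apply Additive.toMul.injective
        exact map_mul (cjq k) _ _ }
  refine ⟨V, iV, inferInstanceAs (Finite (E ⧸ R.subgroupOf E)), act, fun x => Additive.ofMul (x : E ⧸ R.subgroupOf E), ?_, ?_, ?_, ?_, ?_, ?_⟩
  · intro v
    obtain ⟨x, hx⟩ := QuotientGroup.mk_surjective (Additive.toMul v)
    exact ⟨x, by show Additive.ofMul (x : E ⧸ R.subgroupOf E) = v; rw [hx]; rfl⟩
  · intro x y; rfl
  · intro x
    rw [← Subgroup.mem_subgroupOf, ← QuotientGroup.eq_one_iff]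
    exact Iff.rfl
  · intro k x; rfl
  · rfl
  · intro W
    let W' : Subgroup (E ⧸ R.subgroupOf E) :=
      { carrier := {q | Additive.ofMul q ∈ W}
        one_mem' := W.zero_mem
        mul_mem' := fun ha hb => W.add_mem ha hb
        inv_mem' := fun ha => W.neg_mem ha }
    refine ⟨(W'.comap (QuotientGroup.mk' _)).map E.subtype, ?_, ?_, ?_⟩
    · exact Subgroup.map_subtype_le _
    · intro x
      constructor
      · rintro ⟨y, hy, hyx⟩
        have : y = x := Subtype.ext hyx
        rw [← this]; exact hy
      · intro h
        exact ⟨x, h, rfl⟩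
    · have h1 : ((W'.comap (QuotientGroup.mk' _)).map E.subtype).relIndex E = W'.index := by
        rw [Subgroup.relIndex]
        have : ((W'.comap (QuotientGroup.mk' _)).map E.subtype).subgroupOf E = W'.comap (QuotientGroup.mk' _) :=
          Subgroup.comap_map_eq_self_of_injective E.subtype_injective _
        rw [this, Subgroup.index_comap_of_surjective _ (QuotientGroup.mk'_surjective _)]
      rw [h1]
      have h2 := W'.card_mul_index
      have h3 := W.card_mul_index
      have h4 : Nat.card W' = Nat.card W := rfl
      have h5 : Nat.card (E ⧸ R.subgroupOf E) = Nat.card V := rfl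
      haveI : Finite V := inferInstanceAs (Finite (E ⧸ R.subgroupOf E))
      rw [h4, h5, ← h3] at h2
      exact Nat.eq_of_mul_eq_mul_left Nat.card_pos h2

/-- elements of `E` whose commutator with `d` is in `R`: any subgroup containing these -/
theorem lemT_sec {p : ℕ} (hp : p.Prime) (N : ℕ) : ∃ b : ℕ, ∀ (X : Type) [Group X] [Finite X] (hX : PSol p X) (K E R : Subgroup X) (hE : IsPGroup p E)
    (hRE : R ≤ E) (hcomm : ∀ x ∈ E, ∀ y ∈ E, x * y * x⁻¹ * y⁻¹ ∈ R) (hKE : ∀ k ∈ K, ∀ x ∈ E, k * x * k⁻¹ ∈ E)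
    (hKR : ∀ k ∈ K, ∀ x ∈ R, k * x * k⁻¹ ∈ R) (D : Set X) (hD : Subgroup.closure D = K) (hdp : ∀ d ∈ D, d ^ p = 1)
    (hN : ∀ d ∈ D, ∀ T : Subgroup X, (∀ x ∈ E, d * x * d⁻¹ * x⁻¹ ∈ R → x ∈ T) → T.relIndex E ≤ N),
    ∀ x ∈ DI p b K, ∀ e ∈ E, x * e * x⁻¹ * e⁻¹ ∈ R := by
  obtain ⟨b, hb⟩ := lemT hp N
  refine ⟨b, ?_⟩
  intro X _ _ hX K E R hE hRE hcomm hKE hKR D hD hdp hN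
  haveI := Fact.mk hp
  obtain ⟨V, _, _, _, f, hfs, hfm, hf0, hfk, hfc, hfW⟩ := secAct K E R hRE hcomm hKE hKR
  have hf1 : f 1 = 0 := by rw [hf0]; exact R.one_mem
  have hsub : ∀ x y : E, f x = f y ↔ (x : X) * (y : X)⁻¹ ∈ R := by
    intro x y
    have h1 := hfm (x * y⁻¹) y
    rw [inv_mul_cancel_right] at h1
    rw [h1]
    have h2 := hf0 (x * y⁻¹)
    rw [add_eq_right, h2]; rfl
  obtain ⟨a, ha⟩ := IsPGroup.iff_card.1 hE
  obtain ⟨a', -, ha'⟩ := (Nat.dvd_prime_pow hp).1 (ha ▸ (R.relIndex_dvd_card E))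
  have hDK : D ⊆ K := hD ▸ Subgroup.subset_closure
  have key := hb K V a' (hfc.trans ha') (hX.subgroup hp K) (K.subtype ⁻¹' D) (by
      apply Subgroup.map_injective K.subtype_injective
      rw [MonoidHom.map_closure, Set.image_preimage_eq_of_subset, hD, ← MonoidHom.range_eq_map, Subgroup.range_subtype]
      intro d hd
      exact ⟨⟨d, hDK hd⟩, rfl⟩) (fun d hd => Subtype.ext (hdp d hd)) (by
      intro d hd
      obtain ⟨T, hTE, hT, hTi⟩ := hfW (fx V d)
      rw [← hTi]
      apply hN d hd
      intro x hx h
      have := (hT ⟨x, hx⟩).2 (by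
        rw [mem_fx, hfk, hsub]
        exact h)
      exact this)
  intro x hx e he
  have hxK := DI_le b K hx
  have hx' : (⟨x, hxK⟩ : K) ∈ DI p b (⊤ : Subgroup K) := by
    have h1 := DI_map hp K.subtype b ⊤
    rw [← MonoidHom.range_eq_map, Subgroup.range_subtype] at h1
    rw [h1] at hx
    obtain ⟨y, hy, hyx⟩ := hx
    have : y = ⟨x, hxK⟩ := Subtype.ext hyx
    rwa [← this]
  have h2 := key _ hx' (f ⟨e, he⟩)
  rw [hfk, hsub] at h2
  exact h2

theorem lemB_sec {p : ℕ} (hp : p.Prime) (M : ℕ) {X : Type} [Group X] [Finite X] (hX : PSol p X) (K E R : Subgroup X)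
    (hRE : R ≤ E) (hcomm : ∀ x ∈ E, ∀ y ∈ E, x * y * x⁻¹ * y⁻¹ ∈ R) (hKE : ∀ k ∈ K, ∀ x ∈ E, k * x * k⁻¹ ∈ E)
    (hKR : ∀ k ∈ K, ∀ x ∈ R, k * x * k⁻¹ ∈ R) (hM : R.relIndex E ≤ M) :
    ∀ x ∈ DI p M.factorial K, ∀ e ∈ E, x * e * x⁻¹ * e⁻¹ ∈ R := by
  obtain ⟨V, _, _, _, f, hfs, hfm, hf0, hfk, hfc, hfW⟩ := secAct K E R hRE hcomm hKE hKR
  have hsub : ∀ x y : E, f x = f y ↔ (x : X) * (y : X)⁻¹ ∈ R := by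
    intro x y
    have h1 := hfm (x * y⁻¹) y
    rw [inv_mul_cancel_right] at h1
    rw [h1]
    have h2 := hf0 (x * y⁻¹)
    rw [add_eq_right, h2]; rfl
  have key := PSol.DI_fix hp (hX.subgroup hp K) (⊤ : Subgroup K) (fun x (v : V) => x • v) (one_smul K) (fun x y v => mul_smul x y v)
    Set.univ Set.finite_univ (fun _ _ _ _ => trivial) (M := M) (by rw [Set.ncard_univ, hfc]; exact hM)
  intro x hx e he
  have hxK := DI_le _ K hx
  have hx' : (⟨x, hxK⟩ : K) ∈ DI p M.factorial (⊤ : Subgroup K) := by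
    have h1 := DI_map hp K.subtype M.factorial ⊤
    rw [← MonoidHom.range_eq_map, Subgroup.range_subtype] at h1
    rw [h1] at hx
    obtain ⟨y, hy, hyx⟩ := hx
    have : y = ⟨x, hxK⟩ := Subtype.ext hyx
    rwa [← this]
  have h2 : (⟨x, hxK⟩ : K) • f ⟨e, he⟩ = f ⟨e, he⟩ := key _ hx' (f ⟨e, he⟩) trivial
  rw [hfk, hsub] at h2
  exact h2

end PLen


namespace PLen

/-- setwise stabiliser -/
def stb {X U : Type} [Group X] [AddCommGroup U] [DistribMulAction X U] (W : AddSubgroup U) : Subgroup X where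
  carrier := {x | ∀ w, x • w ∈ W ↔ w ∈ W}
  one_mem' := fun w => by rw [one_smul]
  mul_mem' := fun {a b} ha hb w => by rw [mul_smul, ha, hb]
  inv_mem' := fun {a} ha w => by rw [← ha (a⁻¹ • w), smul_inv_smul]

theorem mem_stb_of {X U : Type} [Group X] [AddCommGroup U] [DistribMulAction X U] {W : AddSubgroup U} {σ : X} {n : ℕ} (hn : 0 < n)
    (hσ : σ ^ n = 1) (h : ∀ w ∈ W, σ • w ∈ W) : σ ∈ stb (X := X) W := by
  intro w
  refine ⟨fun hw => ?_, h w⟩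
  have : w = σ ^ (n - 1) • σ • w := by
    rw [smul_smul, ← pow_succ, Nat.sub_add_cancel hn, hσ, one_smul]
  rw [this]
  exact pow_smul_mem h _ _ hw

theorem lemTwoS {p : ℕ} (hp : p.Prime) (k m : ℕ) : ∃ N : ℕ, ∀ (X U : Type) [Group X] [Finite X] [AddCommGroup U] [Finite U] [DistribMulAction X U]
    (hU : ¬ p ∣ Nat.card U) (W : AddSubgroup U) (E : Subgroup X) (hEp : IsPGroup p E)
    (z : X) (hzE : z ∈ E) (hzp : z ^ p = 1) (hzf : ∀ w ∈ W, z • w = w → w = 0) (σ : X) (hσ : σ ^ p ^ (k + 1) = 1)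
    (hEW : Inv E W) (hσW : ∀ w ∈ W, σ • w ∈ W) (L : Subgroup X) (hLW : ∀ l ∈ L, ∀ w ∈ W, l • w = w)
    (hzc : ∀ x ∈ E, z * x = x * z) (hzσ : ∃ l ∈ L, z * σ = σ * z * l)
    (hcomm : ∀ x ∈ E, ∀ y ∈ E, ∃ i : ℤ, ∃ l ∈ L, x * y * x⁻¹ * y⁻¹ = z ^ i * l)
    (hpow : ∀ x ∈ E, ∀ y ∈ E, x ^ p * y = y * x ^ p)
    (hEσ : ∀ x ∈ E, σ * x * σ⁻¹ ∈ E) (hm : Nat.card (W ⊓ fx U σ : AddSubgroup U) ≤ m) (T : Subgroup X)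
    (hT : ∀ x ∈ E, (∀ y ∈ E, ∀ w ∈ W, ((σ ^ p ^ k * x * (σ ^ p ^ k)⁻¹ * x⁻¹) * y) • w = (y * (σ ^ p ^ k * x * (σ ^ p ^ k)⁻¹ * x⁻¹)) • w) → x ∈ T),
    T.relIndex E ≤ N := by
  obtain ⟨N, hN⟩ := lemTwo hp k m
  refine ⟨N, ?_⟩
  intro X U _ _ _ _ _ hU W E hEp z hzE hzp hzf σ hσ hEW hσW L hLW hzc hzσ hcomm hpow hEσ hm T hT
  let Y0 : Subgroup X := stb W
  have hEY : E ≤ Y0 := by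
    intro x hx w
    refine ⟨fun hw => ?_, hEW x hx w⟩
    have := hEW _ (E.inv_mem hx) _ hw
    rwa [inv_smul_smul] at this
  have hσY : σ ∈ Y0 := mem_stb_of (pow_pos hp.pos _) hσ hσW
  have hLY : ∀ l ∈ L, l ∈ Y0 := fun l hl w => by
    refine ⟨fun hw => ?_, fun hw => by rw [hLW l hl w hw]; exact hw⟩
    have := hLW _ (L.inv_mem hl) _ hw
    rw [inv_smul_smul] at this
    rw [this]; exact hw
  have hInv : Inv (⊤ : Subgroup Y0) W := fun x _ w hw => (x.2 w).2 hw
  letI := subAct (X := Y0) W hInv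
  have hsm : ∀ (x : Y0) (w : W), ((x • w : W) : U) = (x : X) • (w : U) := fun _ _ => rfl
  letI := imgAct Y0 W
  let π : Y0 →* (MulAction.toPermHom Y0 W).range := (MulAction.toPermHom Y0 W).rangeRestrict
  have hπ : ∀ (x : Y0) (w : W), π x • w = x • w := fun _ _ => rfl
  have hπe : ∀ x y : Y0, (∀ w ∈ W, (x : X) • w = (y : X) • w) → π x = π y := by
    intro x y h
    apply Subtype.ext
    apply Equiv.ext
    intro w
    exact Subtype.ext (h w w.2)
  have hπi : ∀ x y : Y0, π x = π y → (∀ w ∈ W, (x : X) • w = (y : X) • w) := by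
    intro x y h w hw
    have h1 : π x • (⟨w, hw⟩ : W) = π y • ⟨w, hw⟩ := by rw [h]
    exact congrArg Subtype.val h1
  have hπL : ∀ l (hl : l ∈ L), π ⟨l, hLY l hl⟩ = 1 := by
    intro l hl
    rw [← map_one π]
    apply hπe
    intro w hw
    rw [hLW l hl w hw]; simp
  let E' := E.subgroupOf Y0
  have hWU : ¬ p ∣ Nat.card W := fun h => hU (h.trans W.card_addSubgroup_dvd_card)
  have key := hN (MulAction.toPermHom Y0 W).range W hWU (E'.map π) (by
      apply IsPGroup.map
      exact hEp.comap_of_injective Y0.subtype Y0.subtype_injective) (by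
      rintro _ ⟨x, hx, rfl⟩ h
      rw [← map_one π]
      apply hπe
      intro w hw
      have := h ⟨w, hw⟩
      have := congrArg Subtype.val this
      rw [Subgroup.coe_one, one_smul]
      exact this) (π ⟨z, hEY hzE⟩) (Subgroup.mem_map_of_mem _ hzE) (by
      rw [← map_pow, ← map_one π]
      congr 1
      exact Subtype.ext hzp) (by
      intro w hw
      apply Subtype.ext
      exact hzf w w.2 (congrArg Subtype.val hw)) (π ⟨σ, hσY⟩) (by
      rw [← map_pow, ← map_one π]
      congr 1
      exact Subtype.ext hσ) (by
      rintro _ ⟨x, hx, rfl⟩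
      rw [← map_mul, ← map_mul]
      congr 1
      exact Subtype.ext (hzc x hx)) (by
      obtain ⟨l, hl, h⟩ := hzσ
      rw [← map_mul, ← map_mul]
      have e : (⟨z, hEY hzE⟩ : Y0) * ⟨σ, hσY⟩ = ⟨σ, hσY⟩ * ⟨z, hEY hzE⟩ * ⟨l, hLY l hl⟩ := Subtype.ext h
      rw [e, map_mul π _ ⟨l, _⟩, hπL l hl, mul_one]) (by
      rintro _ ⟨x, hx, rfl⟩ _ ⟨y, hy, rfl⟩
      obtain ⟨i, l, hl, h⟩ := hcomm x hx y hy
      have e : x * y * x⁻¹ * y⁻¹ = (⟨z, hEY hzE⟩ : Y0) ^ i * ⟨l, hLY l hl⟩ := Subtype.ext (by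
        push_cast; exact h)
      rw [← map_inv, ← map_inv, ← map_mul, ← map_mul, ← map_mul, e, map_mul, hπL l hl, mul_one, map_zpow]
      exact Subgroup.zpow_mem_zpowers _ _) (by
      rintro _ ⟨x, hx, rfl⟩ _ ⟨y, hy, rfl⟩
      rw [← map_pow, ← map_mul, ← map_mul]
      congr 1
      exact Subtype.ext (hpow x hx y hy)) (by
      rintro _ ⟨x, hx, rfl⟩
      rw [← map_inv, ← map_mul, ← map_mul]
      exact Subgroup.mem_map_of_mem _ (hEσ x hx)) (by
      refine le_trans ?_ hm
      let F : fx W (π ⟨σ, hσY⟩) → (W ⊓ fx U σ : AddSubgroup U) := fun w => ⟨(w : W), (w : W).2, congrArg Subtype.val w.2⟩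
      apply Nat.card_le_card_of_injective F
      intro a b hab
      have h1 : ((a : W) : U) = ((b : W) : U) := congrArg (fun t : (W ⊓ fx U σ : AddSubgroup U) => (t : U)) hab
      exact Subtype.ext (Subtype.ext h1))
  rw [← Subgroup.relIndex_comap] at key
  refine le_trans ?_ key
  have hmap : E = E'.map Y0.subtype := by
    rw [Subgroup.subgroupOf_map_subtype, inf_eq_left.2 hEY]
  have h1 : T.relIndex E = (T.comap Y0.subtype).relIndex E' := by
    rw [Subgroup.relIndex_comap, ← hmap]
  rw [h1]
  set C' := Subgroup.comap π (CC (E'.map π) (π ⟨σ, hσY⟩ ^ p ^ k)) with hC'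
  have h2 : C' ⊓ E' ≤ T.comap Y0.subtype := by
    rintro x ⟨hx, hxE⟩
    apply hT x hxE
    intro y hy w hw
    have h3 := (mem_CC.1 hx).2 (π ⟨y, hEY hy⟩) (Subgroup.mem_map_of_mem _ hy)
    rw [← map_pow, ← map_inv, ← map_inv, ← map_mul, ← map_mul, ← map_mul, ← map_mul, ← map_mul] at h3
    exact hπi _ _ h3 w hw
  rw [← Subgroup.inf_relIndex_right C' E']
  exact Nat.le_of_dvd (Nat.pos_of_ne_zero Subgroup.index_ne_zero_of_finite) (Subgroup.relIndex_dvd_of_le_left _ h2)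

end PLen


namespace PLen

theorem exists_AE {p : ℕ} (hp : p.Prime) {X : Type} [Group X] [Finite X] (P : Subgroup X) (hPn : P.Normal) (hP : IsPGroup p P) :
    ∃ A E : Subgroup X, A.Normal ∧ E.Normal ∧ A ≤ E ∧ E ≤ P ∧ (∀ a ∈ A, ∀ x ∈ E, a * x = x * a) ∧ (∀ x ∈ E, x ^ p ∈ A) ∧
      (∀ x ∈ E, ∀ y ∈ E, x * y * x⁻¹ * y⁻¹ ∈ A) ∧ (∀ x ∈ P, (∀ y ∈ E, x * y = y * x) → x ∈ A) := by
  haveI := Fact.mk hp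
  obtain ⟨A, hA⟩ := (Set.toFinite {A : Subgroup X | A.Normal ∧ A ≤ P ∧ ∀ x ∈ A, ∀ y ∈ A, x * y = y * x}).exists_maximal
    ⟨⊥, inferInstance, bot_le, by
      intro x hx y hy
      rw [Subgroup.mem_bot.1 hx, Subgroup.mem_bot.1 hy]⟩
  obtain ⟨⟨hAn, hAP, hAab⟩, hAmax⟩ := hA
  haveI := hAn
  -- q : X → X/A
  set q := QuotientGroup.mk' A with hq
  have hq1 : ∀ x, q x = 1 ↔ x ∈ A := fun x => QuotientGroup.eq_one_iff x
  have hqc : ∀ x y, x * y * x⁻¹ * y⁻¹ ∈ A ↔ q x * q y = q y * q x := by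
    intro x y
    rw [← hq1, map_mul, map_mul, map_mul, map_inv, map_inv, mul_inv_eq_one, mul_inv_eq_iff_eq_mul]
  let P1 : Subgroup X := P ⊓ Subgroup.centralizer (A : Set X)
  have hmP1 : ∀ x, x ∈ P1 ↔ x ∈ P ∧ ∀ a ∈ A, a * x = x * a := by
    intro x
    rw [Subgroup.mem_inf, Subgroup.mem_centralizer_iff]; rfl
  have hP1n : ∀ x ∈ P1, ∀ g, g * x * g⁻¹ ∈ P1 := by
    intro x hx g
    rw [hmP1] at hx ⊢
    refine ⟨hPn.conj_mem _ hx.1 g, ?_⟩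
    intro a ha
    have h1 := hx.2 (g⁻¹ * a * g⁻¹⁻¹) (hAn.conj_mem _ ha g⁻¹)
    rw [inv_inv] at h1
    have e : a * (g * x * g⁻¹) = g * ((g⁻¹ * a * g) * x) * g⁻¹ := by group
    rw [e, h1]; group
  have hqP : ∀ x y : X, q x * q y = q y * q x → ∀ y', q x * q y' = q y' * q x → q x * q (y * y') = q (y * y') * q x := by
    intro x y h y' h'
    rw [map_mul]
    exact (Commute.mul_right h h' : Commute _ _).eq
  -- E
  let E : Subgroup X :=
    { carrier := {x | x ∈ P1 ∧ q x ^ p = 1 ∧ ∀ y ∈ P1, Commute (q x) (q y)}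
      one_mem' := ⟨P1.one_mem, by simp, fun y _ => by rw [map_one]; exact Commute.one_left _⟩
      mul_mem' := by
        rintro a b ⟨ha, hap, hac⟩ ⟨hb, hbp, hbc⟩
        refine ⟨P1.mul_mem ha hb, ?_, ?_⟩
        · rw [map_mul, (hac b hb).mul_pow, hap, hbp, one_mul]
        · intro y hy
          rw [map_mul]
          exact (hac y hy).mul_left (hbc y hy)
      inv_mem' := by
        rintro a ⟨ha, hap, hac⟩
        refine ⟨P1.inv_mem ha, ?_, ?_⟩
        · rw [map_inv, inv_pow, hap, inv_one]
        · intro y hy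
          rw [map_inv]
          exact (hac y hy).inv_left }
  have hmE : ∀ x, x ∈ E ↔ x ∈ P1 ∧ q x ^ p = 1 ∧ ∀ y ∈ P1, Commute (q x) (q y) := fun _ => Iff.rfl
  have hAP1 : A ≤ P1 := fun a ha => (hmP1 a).2 ⟨hAP ha, fun b hb => hAab b hb a ha⟩
  have hAE : A ≤ E := by
    intro a ha
    have h1 := (hq1 a).2 ha
    refine ⟨hAP1 ha, by rw [h1, one_pow], fun y _ => by rw [h1]; exact Commute.one_left _⟩
  have hEn : E.Normal := ⟨by
    rintro x ⟨hx, hxp, hxc⟩ g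
    refine ⟨hP1n x hx g, ?_, ?_⟩
    · rw [map_mul, map_mul, map_inv, conj_pow, hxp]; simp
    · intro y hy
      have h1 := hxc _ (hP1n y hy g⁻¹)
      have h2 := (Commute.conj_iff (q g)).2 h1
      have e : q g * q (g⁻¹ * y * g⁻¹⁻¹) * (q g)⁻¹ = q y := by
        rw [← map_inv, ← map_mul, ← map_mul]; congr 1; group
      rw [e] at h2
      rw [map_mul, map_mul, map_inv]
      exact h2⟩
  have hEP1 : E ≤ P1 := fun x hx => hx.1
  refine ⟨A, E, hAn, hEn, hAE, fun x hx => ((hmP1 x).1 hx.1).1, fun a ha x hx => ((hmP1 x).1 hx.1).2 a ha,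
    fun x hx => ?_, fun x hx y hy => ?_, ?_⟩
  · rw [← hq1, map_pow]; exact hx.2.1
  · rw [hqc]; exact hx.2.2 y hy.1
  -- C_P(E) ≤ A
  let C : Subgroup X := P ⊓ Subgroup.centralizer (E : Set X)
  have hmC : ∀ x, x ∈ C ↔ x ∈ P ∧ ∀ a ∈ E, a * x = x * a := by
    intro x
    rw [Subgroup.mem_inf, Subgroup.mem_centralizer_iff]; rfl
  have hCn : ∀ x ∈ C, ∀ g, g * x * g⁻¹ ∈ C := by
    intro x hx g
    rw [hmC] at hx ⊢
    refine ⟨hPn.conj_mem _ hx.1 g, ?_⟩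
    intro a ha
    have h1 := hx.2 (g⁻¹ * a * g⁻¹⁻¹) (hEn.conj_mem _ ha g⁻¹)
    rw [inv_inv] at h1
    have e : a * (g * x * g⁻¹) = g * ((g⁻¹ * a * g) * x) * g⁻¹ := by group
    rw [e, h1]; group
  have hCP1 : C ≤ P1 := fun x hx => (hmP1 x).2 ⟨((hmC x).1 hx).1, fun a ha => ((hmC x).1 hx).2 a (hAE ha)⟩
  -- Z(E) ≤ A
  have hZ : ∀ x ∈ E, (∀ y ∈ E, y * x = x * y) → x ∈ A := by
    intro x hx hxc
    have h1 : (C ⊓ E) ≤ A := by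
      apply hAmax
      · refine ⟨⟨fun y hy g => ⟨hCn y hy.1 g, hEn.conj_mem y hy.2 g⟩⟩, fun y hy => ((hmC y).1 hy.1).1, ?_⟩
        intro y hy z hz
        exact ((hmC z).1 hz.1).2 y hy.2
      · intro a ha
        exact ⟨(hmC a).2 ⟨hAP ha, fun y hy => (((hmP1 y).1 hy.1).2 a ha).symm⟩, hAE ha⟩
    exact h1 ⟨(hmC x).2 ⟨((hmP1 x).1 hx.1).1, hxc⟩, hx⟩
  intro x0 hx0 hx0c
  have hx0C : x0 ∈ C := (hmC x0).2 ⟨hx0, fun a ha => (hx0c a ha).symm⟩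
  by_contra hx0A
  -- fixed point
  have hCp : IsPGroup p C := hP.to_le (fun x hx => ((hmC x).1 hx).1)
  have hP1p : IsPGroup p P1 := hP.to_le (fun x hx => ((hmP1 x).1 hx).1)
  obtain ⟨y, ⟨hyC, hy1⟩, hyf⟩ := pfix hp (P1.map q) (hP1p.map q) (fun g a => g * a * g⁻¹) (by simp) (by intros; group)
    ((C.map q : Set (X ⧸ A)) \ {1}) (Set.toFinite _) (by
      rintro _ ⟨g, hg, rfl⟩ _ ⟨⟨c, hc, rfl⟩, hc1⟩
      refine ⟨⟨g * c * g⁻¹, hCn c hc g, by simp⟩, ?_⟩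
      intro h
      apply hc1
      rw [Set.mem_singleton_iff] at h ⊢
      rwa [mul_inv_eq_one, mul_eq_left] at h) (by
      have h1 := Set.ncard_diff_singleton_add_one (s := (C.map q : Set (X ⧸ A))) (a := 1) (one_mem (C.map q)) (Set.toFinite _)
      have h2 : (C.map q : Set (X ⧸ A)).ncard = Nat.card (C.map q) := rfl
      obtain ⟨a, ha⟩ := IsPGroup.iff_card.1 (hCp.map q)
      rw [h2, ha] at h1
      intro hd
      rcases Nat.eq_zero_or_pos a with h0 | h0
      · rw [h0, pow_zero] at ha
        have h3 : C.map q = ⊥ := Subgroup.card_eq_one.1 ha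
        have h4 : q x0 ∈ C.map q := Subgroup.mem_map_of_mem _ hx0C
        rw [h3, Subgroup.mem_bot, hq1] at h4
        exact hx0A h4
      · have h3 : p ∣ p ^ a := dvd_pow_self p h0.ne'
        rw [← h1] at h3
        exact hp.one_lt.ne' (Nat.dvd_one.1 ((Nat.dvd_add_right hd).1 h3)))
  obtain ⟨c, hc, rfl⟩ := hyC
  rw [Set.mem_singleton_iff] at hy1
  have hqcp : ∃ s, q c ^ p ^ s = 1 := by
    obtain ⟨s, hs⟩ := hCp ⟨c, hc⟩
    refine ⟨s, ?_⟩
    have : c ^ p ^ s = 1 := congrArg Subtype.val hs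
    rw [← map_pow, this, map_one]
  classical
  set s := Nat.find hqcp with hs
  have hs1 : q c ^ p ^ s = 1 := Nat.find_spec hqcp
  have hs0 : s ≠ 0 := by
    intro h
    rw [h, pow_zero, pow_one] at hs1
    exact hy1 hs1
  obtain ⟨t, ht⟩ := Nat.exists_eq_succ_of_ne_zero hs0
  have hlt : t < s := by omega
  have ht1 : q c ^ p ^ t ≠ 1 := Nat.find_min hqcp hlt
  have hxC : c ^ p ^ t ∈ C := C.pow_mem hc _
  have hxE : c ^ p ^ t ∈ E := by
    refine ⟨hCP1 hxC, ?_, ?_⟩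
    · rw [map_pow, ← pow_mul, ← pow_succ]
      rw [ht] at hs1
      exact hs1
    · intro u hu
      rw [map_pow]
      apply Commute.pow_left
      have := hyf (q u) (Subgroup.mem_map_of_mem _ hu)
      rw [mul_inv_eq_iff_eq_mul] at this
      exact this.symm
  have hxA := hZ _ hxE ((hmC _).1 hxC).2
  rw [← hq1, map_pow] at hxA
  exact ht1 hxA

end PLen


namespace PLen

section
variable {X U : Type} [Group X] [Finite X] [AddCommGroup U] [DistribMulAction X U]

/-- sum over a subgroup -/
noncomputable def sm (D : Subgroup X) (u : U) : U := ∑ x ∈ (Set.toFinite (D : Set X)).toFinset, x • u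

theorem mem_tf {D : Subgroup X} {x : X} : x ∈ (Set.toFinite (D : Set X)).toFinset ↔ x ∈ D := by simp

theorem sm_zero (D : Subgroup X) : sm D (0 : U) = 0 := by simp [sm]
theorem sm_add (D : Subgroup X) (u v : U) : sm D (u + v) = sm D u + sm D v := by
  simp [sm, Finset.sum_add_distrib]
theorem sm_neg (D : Subgroup X) (u : U) : sm D (-u) = - sm D u := by
  simp [sm]
theorem sm_sum (D : Subgroup X) {ι : Type} (s : Finset ι) (f : ι → U) : sm D (∑ i ∈ s, f i) = ∑ i ∈ s, sm D (f i) := by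
  simp only [sm, Finset.smul_sum]
  rw [Finset.sum_comm]

theorem smul_sm {D : Subgroup X} {d : X} (hd : d ∈ D) (u : U) : d • sm D u = sm D u := by
  simp only [sm, Finset.smul_sum, smul_smul]
  refine Finset.sum_bij' (fun x _ => d * x) (fun x _ => d⁻¹ * x) ?_ ?_ ?_ ?_ ?_
  · intro x hx; rw [mem_tf] at hx ⊢; exact D.mul_mem hd hx
  · intro x hx; rw [mem_tf] at hx ⊢; exact D.mul_mem (D.inv_mem hd) hx
  · intro x _; simp
  · intro x _; simp
  · intro x _; rfl

theorem sm_smul {D : Subgroup X} {d : X} (hd : d ∈ D) (u : U) : sm D (d • u) = sm D u := by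
  simp only [sm, smul_smul]
  refine Finset.sum_bij' (fun x _ => x * d) (fun x _ => x * d⁻¹) ?_ ?_ ?_ ?_ ?_
  · intro x hx; rw [mem_tf] at hx ⊢; exact D.mul_mem hx hd
  · intro x hx; rw [mem_tf] at hx ⊢; exact D.mul_mem hx (D.inv_mem hd)
  · intro x _; simp
  · intro x _; simp
  · intro x _; rfl

theorem sm_conj {D : Subgroup X} {y : X} (h : ∀ d, y * d * y⁻¹ ∈ D ↔ d ∈ D) (u : U) : y • sm D u = sm D (y • u) := by
  simp only [sm, Finset.smul_sum, smul_smul]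
  refine Finset.sum_bij' (fun x _ => y * x * y⁻¹) (fun x _ => y⁻¹ * x * y) ?_ ?_ ?_ ?_ ?_
  · intro x hx; rw [mem_tf] at hx ⊢; exact (h x).2 hx
  · intro x hx
    rw [mem_tf] at hx ⊢
    rw [← h]
    have e : y * (y⁻¹ * x * y) * y⁻¹ = x := by group
    rwa [e]
  · intro x _; group
  · intro x _; group
  · intro x _; congr 1; group

theorem sm_fix {D : Subgroup X} {u : U} (h : ∀ d ∈ D, d • u = u) : sm D u = Nat.card D • u := by
  have : sm D u = ∑ x ∈ (Set.toFinite (D : Set X)).toFinset, u :=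
    Finset.sum_congr rfl fun x hx => h x (mem_tf.1 hx)
  rw [this, Finset.sum_const]
  congr 1
  rw [← Set.ncard_eq_toFinset_card]; rfl

theorem sm_zero_of [Finite U] {p : ℕ} (hp : p.Prime) (hU : ¬ p ∣ Nat.card U) {D : Subgroup X} (hD : IsPGroup p D) {u : U}
    (h : ∀ d ∈ D, d • u = u) (h0 : sm D u = 0) : u = 0 := by
  haveI := Fact.mk hp
  rw [sm_fix h] at h0
  obtain ⟨a, ha⟩ := IsPGroup.iff_card.1 hD
  rw [ha] at h0
  have h1 : addOrderOf u ∣ p ^ a := addOrderOf_dvd_of_nsmul_eq_zero h0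
  have h2 : addOrderOf u ∣ Nat.card U := addOrderOf_dvd_natCard u
  have h3 : Nat.Coprime (p ^ a) (Nat.card U) := Nat.Coprime.pow_left _ ((Nat.Prime.coprime_iff_not_dvd hp).2 hU)
  exact AddMonoid.addOrderOf_eq_one_iff.1 (Nat.eq_one_of_dvd_coprimes h3 h1 h2)

/-- eigen-component -/
def WL (U : Type) [AddCommGroup U] [DistribMulAction X U] (D L : Subgroup X) : AddSubgroup U where
  carrier := {u | (∀ l ∈ L, l • u = u) ∧ sm D u = 0}
  zero_mem' := ⟨fun l _ => smul_zero l, sm_zero D⟩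
  add_mem' := by
    rintro a b ⟨ha, ha'⟩ ⟨hb, hb'⟩
    exact ⟨fun l hl => by rw [smul_add, ha l hl, hb l hl], by rw [sm_add, ha', hb', add_zero]⟩
  neg_mem' := by
    rintro a ⟨ha, ha'⟩
    exact ⟨fun l hl => by rw [smul_neg, ha l hl], by rw [sm_neg, ha', neg_zero]⟩

theorem mem_WL {D L : Subgroup X} {u : U} : u ∈ WL U D L ↔ (∀ l ∈ L, l • u = u) ∧ sm D u = 0 := Iff.rfl

/-- coatoms of `D` -/
def Coat (D L : Subgroup X) : Prop := L ≤ D ∧ L ≠ D ∧ ∀ M, L ≤ M → M ≤ D → M = L ∨ M = D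

theorem Coat.fix {D L : Subgroup X} (h : Coat D L) {d : X} (hd : d ∈ D) (hdL : d ∉ L) {u : U} (hL : ∀ l ∈ L, l • u = u) (hdu : d • u = u) :
    ∀ x ∈ D, x • u = u := by
  have h1 := h.2.2 (D ⊓ MulAction.stabilizer X u) (fun l hl => ⟨h.1 hl, hL l hl⟩) inf_le_left
  have h2 : d ∈ D ⊓ MulAction.stabilizer X u := ⟨hd, hdu⟩
  rcases h1 with h1 | h1
  · rw [h1] at h2; exact absurd h2 hdL
  · intro x hx
    rw [← h1] at hx
    exact hx.2

theorem WL_fpf [Finite U] {p : ℕ} (hp : p.Prime) (hU : ¬ p ∣ Nat.card U) {D L : Subgroup X} (hD : IsPGroup p D) (h : Coat D L)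
    {d : X} (hd : d ∈ D) (hdL : d ∉ L) {u : U} (hu : u ∈ WL U D L) (hdu : d • u = u) : u = 0 :=
  sm_zero_of hp hU hD (h.fix hd hdL hu.1 hdu) hu.2

theorem Coat.exists_diff {D L L' : Subgroup X} (h : Coat D L) (h' : Coat D L') (hne : L' ≠ L) : ∃ l ∈ L', l ∉ L := by
  by_contra hcon
  push Not at hcon
  rcases h'.2.2 L hcon h.1 with h1 | h1
  · exact hne h1.symm
  · exact h.2.1 h1

theorem sm_kill [Finite U] {p : ℕ} (hp : p.Prime) (hU : ¬ p ∣ Nat.card U) {D L L' : Subgroup X} (hD : IsPGroup p D)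
    (hab : ∀ x ∈ D, ∀ y ∈ D, x * y = y * x) (h : Coat D L) (h' : Coat D L') (hne : L' ≠ L) {u : U} (hu : u ∈ WL U D L') :
    sm L u = 0 := by
  obtain ⟨l, hl', hl⟩ := h.exists_diff h' hne
  have hlD := h'.1 hl'
  apply sm_zero_of hp hU hD (u := sm L u)
  · apply h.fix hlD hl (fun x hx => smul_sm hx u)
    rw [sm_conj, hu.1 l hl']
    intro d
    constructor
    · intro hd
      have h1 := h.1 hd
      have h2 : d ∈ D := by
        have := D.mul_mem (D.mul_mem (D.inv_mem hlD) h1) hlD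
        have e : l⁻¹ * (l * d * l⁻¹) * l = d := by group
        rwa [e] at this
      rw [hab l hlD d h2, mul_inv_cancel_right] at hd
      exact hd
    · intro hd
      rw [hab l hlD d (h.1 hd), mul_inv_cancel_right]; exact hd
  · have : sm D (sm L u) = ∑ x ∈ (Set.toFinite (L : Set X)).toFinset, sm D (x • u) := by
      conv_lhs => rw [show sm L u = ∑ x ∈ (Set.toFinite (L : Set X)).toFinset, x • u from rfl]
      rw [sm_sum]
    rw [this]
    refine Finset.sum_eq_zero fun x hx => ?_
    rw [sm_smul (h.1 (mem_tf.1 hx)), hu.2]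

theorem Coat.cj {D L : Subgroup X} (h : Coat D L) (x : X) (hD : ∀ d ∈ D, ∀ g : X, g * d * g⁻¹ ∈ D) : Coat D (PLen.cj x L) := by
  have hDx : ∀ y, PLen.cj y D = D := fun y => cj_eq_of_inv (fun d hd => hD d hd y)
  refine ⟨?_, ?_, ?_⟩
  · rw [← hDx x]; exact cj_mono h.1
  · intro e
    apply h.2.1
    have := congrArg (PLen.cj x⁻¹) e
    rw [← cj_mul, inv_mul_cancel, cj_one, hDx] at this
    exact this
  · intro M hM hMD
    have h1 := h.2.2 (PLen.cj x⁻¹ M) (by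
      have := cj_mono (x := x⁻¹) hM
      rwa [← cj_mul, inv_mul_cancel, cj_one] at this) (by
      have := cj_mono (x := x⁻¹) hMD
      rwa [hDx] at this)
    rcases h1 with h1 | h1
    · left
      rw [← h1, ← cj_mul, mul_inv_cancel, cj_one]
    · right
      rw [← hDx x, ← h1, ← cj_mul, mul_inv_cancel, cj_one]

theorem WL_cj {D L : Subgroup X} (x : X) (hD : ∀ d ∈ D, ∀ g : X, g * d * g⁻¹ ∈ D) {u : U} (hu : u ∈ WL U D L) : x • u ∈ WL U D (PLen.cj x L) := by
  refine ⟨?_, ?_⟩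
  · intro l hl
    rw [mem_cj] at hl
    have := hu.1 _ hl
    rw [mul_smul, mul_smul, inv_smul_eq_iff] at this
    exact this
  · rw [← sm_conj, hu.2, smul_zero]
    intro d
    refine ⟨fun h => ?_, fun h => hD d h x⟩
    have := hD _ h x⁻¹
    have e : x⁻¹ * (x * d * x⁻¹) * x⁻¹⁻¹ = d := by group
    rwa [e] at this

theorem exists_sep [Finite U] {p : ℕ} (hp : p.Prime) (hU : ¬ p ∣ Nat.card U) {D : Subgroup X} (hD : ∀ x ∈ D, x ^ p = 1)
    (hab : ∀ x ∈ D, ∀ y ∈ D, x * y = y * x) (hf : ∀ x ∈ D, (∀ u : U, x • u = u) → x = 1) {e : X} (he : e ∈ D) (he1 : e ≠ 1) :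
    ∃ L, Coat D L ∧ WL U D L ≠ ⊥ ∧ e ∉ L := by
  obtain ⟨L, hL⟩ := (Set.toFinite {L : Subgroup X | L ≤ D ∧ ∃ u : U, u ≠ 0 ∧ (∀ l ∈ L, l • u = u) ∧ u ∈ KN U p e}).exists_maximal (by
    obtain ⟨u, hu⟩ : ∃ u : U, e • u ≠ u := by
      by_contra h
      push Not at h
      exact he1 (hf e he h)
    refine ⟨⊥, bot_le, e • u - u, sub_ne_zero.2 hu, ?_, sub_mem_KN (hD e he) u⟩
    intro l hl
    rw [Subgroup.mem_bot.1 hl, one_smul])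
  obtain ⟨⟨hLD, u, hu0, hLu, hue⟩, hmax⟩ := hL
  have heL : e ∉ L := fun h => hu0 (KN_fx hp hU hue (hLu e h))
  have hex : ∀ d ∈ D, ∃ i : ℕ, e ^ i * d ∈ L := by
    intro d hd
    by_contra hcon
    push Not at hcon
    apply hu0
    apply avg_zero hp hU (hD e he) (hab e he d hd) hue
    intro i _
    by_contra hv
    set τ := e ^ i * d with hτ
    have hτD : τ ∈ D := D.mul_mem (D.pow_mem he i) hd
    set v := nrm p τ u with hvdef
    have hτv : τ • v = v := smul_nrm (by rw [hD τ hτD, one_smul])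
    have hLv : ∀ l ∈ L, l • v = v := by
      intro l hl
      rw [hvdef, ← nrm_comm (hab τ hτD l (hLD hl)), hLu l hl]
    have hve : v ∈ KN U p e := nrm_mem (fun u hu => KN_inv (hab e he τ hτD) hu) p hue
    have h1 : (D ⊓ MulAction.stabilizer X v) ≤ L := by
      apply hmax
      · refine ⟨inf_le_left, v, hv, fun l hl => hl.2, hve⟩
      · exact fun l hl => ⟨hLD hl, hLv l hl⟩
    exact hcon i (h1 ⟨hτD, hτv⟩)
  refine ⟨L, ⟨hLD, fun h => heL (h ▸ he), ?_⟩, ?_, heL⟩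
  · intro M hLM hMD
    by_cases hML : M ≤ L
    · left; exact le_antisymm hML hLM
    · right
      apply le_antisymm hMD
      rw [SetLike.not_le_iff_exists] at hML
      obtain ⟨τ, hτM, hτL⟩ := hML
      obtain ⟨i, hi⟩ := hex τ (hMD hτM)
      have hei : e ^ i ∈ M := by
        have := M.mul_mem (hLM hi) (M.inv_mem hτM)
        rwa [mul_inv_cancel_right] at this
      have hi0 : ¬ p ∣ i := by
        rintro ⟨j, rfl⟩
        rw [pow_mul, hD e he, one_pow, one_mul] at hi
        exact hτL hi
      have heM : e ∈ M := by
        have hcop : Nat.gcd i p = 1 := Nat.Coprime.symm ((Nat.Prime.coprime_iff_not_dvd hp).2 hi0)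
        obtain ⟨j, -, hj⟩ := Nat.exists_mul_mod_eq_one_of_coprime hcop hp.one_lt
        have h1 : e = (e ^ i) ^ j := by
          rw [← pow_mul, pow_mod_natCard_aux (hD e he), hj, pow_one]
        rw [h1]; exact M.pow_mem hei j
      intro d hd
      obtain ⟨i, hi⟩ := hex d hd
      have := M.mul_mem (M.inv_mem (M.pow_mem heM i)) (hLM hi)
      rwa [inv_mul_cancel_left] at this
  · intro hbot
    have : u ∈ WL U D L := by
      refine ⟨hLu, ?_⟩
      have h1 : e • sm D u = sm D u := smul_sm he u
      have h2 : nrm p e (sm D u) = 0 := by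
        rw [nrm_apply]
        have : ∀ i ∈ Finset.range p, e ^ i • sm D u = sm D (e ^ i • u) := by
          intro i _
          rw [smul_sm (D.pow_mem he i), sm_smul (D.pow_mem he i)]
        rw [Finset.sum_congr rfl this, ← sm_sum, ← nrm_apply, show nrm p e u = 0 from hue, sm_zero]
      exact KN_fx hp hU h2 h1
    rw [hbot] at this
    exact hu0 this

theorem WL_orbit [Finite U] {p : ℕ} (hp : p.Prime) (hU : ¬ p ∣ Nat.card U) {D L : Subgroup X} (hD : IsPGroup p D)
    (hab : ∀ x ∈ D, ∀ y ∈ D, x * y = y * x) (hDn : ∀ d ∈ D, ∀ g : X, g * d * g⁻¹ ∈ D) (hL : Coat D L) (k m : ℕ) (φ : X)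
    (hφ : φ ^ p ^ (k + 1) = 1) (hm : Nat.card (fx U φ) ≤ m) :
    ∃ j ≤ k + 1, cj (φ ^ p ^ j) L = L ∧ Nat.card (WL U D L ⊓ fx U (φ ^ p ^ j) : AddSubgroup U) ≤ m := by
  classical
  have hex : ∃ j, cj (φ ^ p ^ j) L = L := ⟨k + 1, by rw [hφ, cj_one]⟩
  set j := Nat.find hex with hj
  have hj1 : cj (φ ^ p ^ j) L = L := Nat.find_spec hex
  refine ⟨j, Nat.find_min' hex (by rw [hφ, cj_one]), hj1, ?_⟩
  have hcjpow : ∀ (x : X) (n : ℕ), cj x L = L → cj (x ^ n) L = L := by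
    intro x n hx
    induction n with
    | zero => rw [pow_zero, cj_one]
    | succ n ih => rw [pow_succ, cj_mul, hx, ih]
  have hdist : ∀ i, 0 < i → i < p ^ j → cj (φ ^ i) L ≠ L := by
    intro i hi0 hij heq
    obtain ⟨t, s, hs, rfl⟩ := Nat.exists_eq_pow_mul_and_not_dvd hi0.ne' p hp.ne_one
    have hs0 : 0 < s := Nat.pos_of_ne_zero (by rintro rfl; exact hs (dvd_zero _))
    have htj : t < j := by
      have : p ^ t < p ^ j := lt_of_le_of_lt (Nat.le_mul_of_pos_right _ hs0) hij
      exact (Nat.pow_lt_pow_iff_right hp.one_lt).1 this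
    apply Nat.find_min hex htj
    have hcop : Nat.gcd s (p ^ (k + 1)) = 1 := (Nat.Coprime.pow_left _ ((Nat.Prime.coprime_iff_not_dvd hp).2 hs)).symm
    obtain ⟨s', -, hs'⟩ := Nat.exists_mul_mod_eq_one_of_coprime hcop (Nat.one_lt_pow (Nat.succ_ne_zero k) hp.one_lt)
    have h1 : φ ^ p ^ t = (φ ^ (p ^ t * s)) ^ s' := by
      have h3 : ((φ ^ p ^ t) ^ (s * s')) = φ ^ p ^ t := by
        rw [pow_mod_natCard_aux (c := φ ^ p ^ t) (p := p ^ (k + 1)) (by rw [← pow_mul, mul_comm, pow_mul, hφ, one_pow]), hs', pow_one]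
      rw [← pow_mul, mul_assoc, pow_mul, h3]
    rw [h1]
    exact hcjpow _ _ heq
  refine le_trans ?_ hm
  let F : (WL U D L ⊓ fx U (φ ^ p ^ j) : AddSubgroup U) → fx U φ := fun w => ⟨nrm (p ^ j) φ (w : U), smul_nrm w.2.2⟩
  apply Nat.card_le_card_of_injective F
  intro a b hab'
  have h1 : nrm (p ^ j) φ (a : U) = nrm (p ^ j) φ (b : U) := congrArg (fun t : fx U φ => (t : U)) hab'
  apply Subtype.ext
  rw [← sub_eq_zero]
  set w := (a : U) - b with hw
  have hwW : w ∈ WL U D L := (WL U D L).sub_mem a.2.1 b.2.1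
  have h2 : nrm (p ^ j) φ w = 0 := by rw [hw, map_sub, h1, sub_self]
  rw [nrm_apply] at h2
  have h3 := congrArg (sm L) h2
  rw [sm_zero, sm_sum, Finset.sum_eq_single 0, pow_zero, one_smul] at h3
  · exact sm_zero_of hp hU (hD.to_le hL.1) hwW.1 h3
  · intro i hi hi0
    exact sm_kill hp hU hD hab hL (hL.cj _ hDn) (hdist i (Nat.pos_of_ne_zero hi0) (Finset.mem_range.1 hi)) (WL_cj _ hDn hwW)
  · intro h
    exact absurd (Finset.mem_range.2 (pow_pos hp.pos j)) h

end
end PLen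

namespace PLen

/-- radical of the commutator form of `E` modulo `L`. -/
def rad {X : Type} [Group X] (E L : Subgroup X) (hc : ∀ l ∈ L, ∀ y ∈ E, l * y = y * l) : Subgroup X where
  carrier := {x | x ∈ E ∧ ∀ y ∈ E, x * y * x⁻¹ * y⁻¹ ∈ L}
  one_mem' := ⟨E.one_mem, fun y _ => by simp [L.one_mem]⟩
  mul_mem' := by
    rintro a b ⟨ha, ha'⟩ ⟨hb, hb'⟩
    refine ⟨E.mul_mem ha hb, fun y hy => ?_⟩
    have h1 := hc _ (hb' y hy) a ha
    have h2 : a * b * y * (a * b)⁻¹ * y⁻¹ = (a * (b * y * b⁻¹ * y⁻¹)) * (y * a⁻¹ * y⁻¹) := by group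
    rw [h2, ← h1]
    have h3 : b * y * b⁻¹ * y⁻¹ * a * (y * a⁻¹ * y⁻¹) = (b * y * b⁻¹ * y⁻¹) * (a * y * a⁻¹ * y⁻¹) := by group
    rw [h3]
    exact L.mul_mem (hb' y hy) (ha' y hy)
  inv_mem' := by
    rintro a ⟨ha, ha'⟩
    refine ⟨E.inv_mem ha, fun y hy => ?_⟩
    have h1 := hc _ (L.inv_mem (ha' y hy)) a ha
    have h2 : a⁻¹ * y * a⁻¹⁻¹ * y⁻¹ = a⁻¹ * ((a * y * a⁻¹ * y⁻¹)⁻¹ * a) := by group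
    rw [h2, h1, inv_mul_cancel_left]
    exact L.inv_mem (ha' y hy)

theorem mem_rad {X : Type} [Group X] {E L : Subgroup X} {hc : ∀ l ∈ L, ∀ y ∈ E, l * y = y * l} {x : X} :
    x ∈ rad E L hc ↔ x ∈ E ∧ ∀ y ∈ E, x * y * x⁻¹ * y⁻¹ ∈ L := Iff.rfl

/-- cosets of a coatom. -/
theorem Coat.decomp {X : Type} [Group X] {D L : Subgroup X} (h : Coat D L) (hab : ∀ x ∈ D, ∀ y ∈ D, x * y = y * x)
    {z : X} (hz : z ∈ D) (hzL : z ∉ L) {d : X} (hd : d ∈ D) : ∃ i : ℤ, ∃ l ∈ L, d = z ^ i * l := by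
  let M : Subgroup X :=
    { carrier := {x | ∃ i : ℤ, ∃ l ∈ L, x = z ^ i * l}
      one_mem' := ⟨0, 1, L.one_mem, by simp⟩
      mul_mem' := by
        rintro _ _ ⟨i, l, hl, rfl⟩ ⟨j, l', hl', rfl⟩
        refine ⟨i + j, l * l', L.mul_mem hl hl', ?_⟩
        have := hab _ (D.zpow_mem hz j) l (h.1 hl)
        rw [zpow_add]
        calc z ^ i * l * (z ^ j * l') = z ^ i * (l * z ^ j) * l' := by group
          _ = z ^ i * (z ^ j * l) * l' := by rw [this]
          _ = _ := by group
      inv_mem' := by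
        rintro _ ⟨i, l, hl, rfl⟩
        refine ⟨-i, l⁻¹, L.inv_mem hl, ?_⟩
        rw [mul_inv_rev, ← zpow_neg]
        exact hab _ (h.1 (L.inv_mem hl)) _ (D.zpow_mem hz _) }
  have hLM : L ≤ M := fun l hl => ⟨0, l, hl, by simp⟩
  have hMD : M ≤ D := by
    rintro _ ⟨i, l, hl, rfl⟩
    exact D.mul_mem (D.zpow_mem hz _) (h.1 hl)
  rcases h.2.2 M hLM hMD with h1 | h1
  · exact absurd (h1 ▸ (⟨1, 1, L.one_mem, by simp⟩ : z ∈ M)) hzL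
  · exact (h1 ▸ hd : d ∈ M)

/-- a `p`-element normalising a coatom centralises the quotient of order `p`. -/
theorem Coat.pel_fix {X : Type} [Group X] {p : ℕ} (hp : p.Prime) {D L : Subgroup X} (h : Coat D L)
    (hab : ∀ x ∈ D, ∀ y ∈ D, x * y = y * x) (hDp : ∀ x ∈ D, x ^ p = 1)
    {z : X} (hz : z ∈ D) (hzL : z ∉ L) {τ : X} {n : ℕ} (hτ : τ ^ p ^ n = 1) (hτD : ∀ d ∈ D, τ * d * τ⁻¹ ∈ D)
    (hτL : ∀ d ∈ L, τ * d * τ⁻¹ ∈ L) : z⁻¹ * (τ * z * τ⁻¹) ∈ L := by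
  haveI := Fact.mk hp
  obtain ⟨i, l, hl, hil⟩ := h.decomp hab hz hzL (hτD z hz)
  have hit : ∀ s : ℕ, ∃ l ∈ L, τ ^ s * z * (τ ^ s)⁻¹ = z ^ (i ^ s) * l := by
    intro s
    induction s with
    | zero => exact ⟨1, L.one_mem, by simp⟩
    | succ s ih =>
      obtain ⟨l', hl', h'⟩ := ih
      have hm : (z ^ i * l) ^ (i ^ s) = z ^ (i * i ^ s) * l ^ (i ^ s) := by
        rw [zpow_mul]
        exact (show Commute (z ^ i) l from hab _ (D.zpow_mem hz _) _ (h.1 hl)).mul_zpow _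
      refine ⟨l ^ (i ^ s) * (τ * l' * τ⁻¹), L.mul_mem (L.zpow_mem hl _) (hτL _ hl'), ?_⟩
      calc τ ^ (s + 1) * z * (τ ^ (s + 1))⁻¹ = τ * (τ ^ s * z * (τ ^ s)⁻¹) * τ⁻¹ := by rw [pow_succ']; group
        _ = (τ * z ^ (i ^ s) * τ⁻¹) * (τ * l' * τ⁻¹) := by rw [h']; group
        _ = (τ * z * τ⁻¹) ^ (i ^ s) * (τ * l' * τ⁻¹) := by rw [conj_zpow]
        _ = _ := by rw [hil, hm, pow_succ']; group
  obtain ⟨l', hl', h'⟩ := hit (p ^ n)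
  rw [hτ, one_mul, inv_one, mul_one] at h'
  have hmem : z ^ (i ^ p ^ n - 1) ∈ L := by
    have : z ^ (i ^ p ^ n - 1) = l'⁻¹ := by
      rw [zpow_sub, zpow_one]
      have h2 : z ^ (i ^ p ^ n) = z * l'⁻¹ := by rw [eq_mul_inv_iff_mul_eq]; exact h'.symm
      rw [h2]
      have := hab z hz l'⁻¹ (h.1 (L.inv_mem hl'))
      rw [this]; group
    rw [this]; exact L.inv_mem hl'
  have hzp : z ^ (p : ℤ) = 1 := by rw [zpow_natCast]; exact hDp z hz
  have hdvd : (p : ℤ) ∣ i ^ p ^ n - 1 := by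
    by_contra hnd
    have hcop : IsCoprime (p : ℤ) (i ^ p ^ n - 1) := by
      rw [Int.isCoprime_iff_gcd_eq_one]
      have := (Nat.Prime.coprime_iff_not_dvd hp (n := (i ^ p ^ n - 1).natAbs)).2 (by rwa [← Int.natCast_dvd])
      simpa [Int.gcd] using this
    obtain ⟨a, b, hab'⟩ := hcop
    apply hzL
    have : z = (z ^ (i ^ p ^ n - 1)) ^ b := by
      rw [← zpow_mul]
      conv_lhs => rw [← zpow_one z, ← hab', zpow_add, mul_comm a, zpow_mul, hzp, one_zpow, one_mul, mul_comm b]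
    rw [this]; exact L.zpow_mem hmem _
  have hdvd2 : (p : ℤ) ∣ i - 1 := by
    rw [← ZMod.intCast_zmod_eq_zero_iff_dvd] at hdvd ⊢
    push_cast at hdvd ⊢
    rwa [ZMod.pow_card_pow] at hdvd
  obtain ⟨c, hc⟩ := hdvd2
  have hzi : z⁻¹ * z ^ i = 1 := by
    rw [← zpow_neg_one, ← zpow_add, show (-1 : ℤ) + i = p * c by linarith, zpow_mul, hzp, one_zpow]
  rw [hil, ← mul_assoc, hzi, one_mul]
  exact hl

theorem dicho {p : ℕ} (hp : p.Prime) (k m : ℕ) : ∃ N : ℕ, ∀ (X U : Type) [Group X] [Finite X] [AddCommGroup U] [Finite U] [DistribMulAction X U]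
    (hU : ¬ p ∣ Nat.card U) (E D L : Subgroup X) (hEn : E.Normal) (hE : IsPGroup p E) (hDE : D ≤ E)
    (hDc : ∀ d ∈ D, ∀ y ∈ E, d * y = y * d) (hDp : ∀ x ∈ D, x ^ p = 1) (hDn : ∀ d ∈ D, ∀ g : X, g * d * g⁻¹ ∈ D)
    (hcomm : ∀ x ∈ E, ∀ y ∈ E, x * y * x⁻¹ * y⁻¹ ∈ D) (hpow : ∀ x ∈ E, ∀ y ∈ E, x ^ p * y = y * x ^ p)
    (hL : Coat D L) (hW : WL U D L ≠ ⊥) (hc : ∀ l ∈ L, ∀ y ∈ E, l * y = y * l) (φ : X) (hφ : φ ^ p ^ (k + 1) = 1) (hm : Nat.card (fx U φ) ≤ m),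
    (rad E L hc).relIndex E ≤ m ^ m ∨ (cj (φ ^ p ^ k) L = L ∧ ∀ T : Subgroup X,
      (∀ x ∈ E, φ ^ p ^ k * x * (φ ^ p ^ k)⁻¹ * x⁻¹ ∈ rad E L hc → x ∈ T) → T.relIndex E ≤ N) := by
  choose N hN using fun k => lemTwoS hp k m
  refine ⟨∑ j ∈ Finset.range (k + 1), N j, ?_⟩
  intro X U _ _ _ _ _ hU E D L hEn hE hDE hDc hDp hDn hcomm hpow hL hW hc φ hφ hm
  have hab : ∀ x ∈ D, ∀ y ∈ D, x * y = y * x := fun x hx y hy => hDc x hx y (hDE hy)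
  have hDpg : IsPGroup p D := hE.to_le hDE
  obtain ⟨j, hj, hjL, hjm⟩ := WL_orbit hp hU hDpg hab hDn hL k m φ hφ hm
  obtain ⟨w0, hw0, hw00⟩ : ∃ w, w ∈ WL U D L ∧ w ≠ 0 := by
    rcases AddSubgroup.bot_or_exists_ne_zero (WL U D L) with h | ⟨a, ha, h⟩
    · exact absurd h hW
    · exact ⟨a, ha, h⟩
  have hEW : Inv E (WL U D L) := by
    intro x hx w hw
    have := WL_cj x hDn hw
    rwa [cj_eq_of_inv (fun y hy => by rw [← hc y hy x hx, mul_inv_cancel_right]; exact hy)] at this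
  have hkey : ∀ x ∈ E, ∀ y ∈ E, (∀ w ∈ WL U D L, (x * y * x⁻¹ * y⁻¹) • w = w) → x * y * x⁻¹ * y⁻¹ ∈ L := by
    intro x hx y hy h
    by_contra hn
    exact hw00 (WL_fpf hp hU hDpg hL (hcomm x hx y hy) hn hw0 (h _ hw0))
  rcases Nat.lt_or_ge k j with hkj | hkj
  · left
    have hjk : j = k + 1 := by omega
    subst hjk
    have hcard : Nat.card (WL U D L) ≤ m := by
      refine le_trans (AddSubgroup.card_le_of_le ?_) hjm
      intro w hw
      refine ⟨hw, ?_⟩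
      show w ∈ fx U _
      rw [mem_fx, hφ, one_smul]
    refine le_trans (Nat.le_of_dvd ?_ (Subgroup.relIndex_dvd_of_le_left E ?_)) (pst_index E (WL U D L) hEW hcard)
    · exact Nat.pos_of_ne_zero Subgroup.index_ne_zero_of_finite
    · rintro x ⟨hx, hx'⟩
      refine ⟨hx, fun y hy => hkey x hx y hy ?_⟩
      intro w hw
      rw [mul_smul, mul_smul, mul_smul]
      have h1 := hEW _ (E.inv_mem hy) w hw
      have h2 : x⁻¹ • y⁻¹ • w = y⁻¹ • w := by rw [inv_smul_eq_iff, hx' _ h1]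
      rw [h2, smul_inv_smul, hx' w hw]
  · right
    have hpj : (φ ^ p ^ j) ^ p ^ (k - j) = φ ^ p ^ k := by
      rw [← pow_mul, ← pow_add]; congr 2; omega
    have hpj1 : (φ ^ p ^ j) ^ p ^ (k - j + 1) = 1 := by
      rw [← pow_mul, ← pow_add, show j + (k - j + 1) = k + 1 by omega, hφ]
    constructor
    · rw [← hpj]
      generalize φ ^ p ^ j = x at hjL
      generalize p ^ (k - j) = n
      induction n with
      | zero => rw [pow_zero, cj_one]
      | succ n ih => rw [pow_succ, cj_mul, hjL, ih]
    · intro T hT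
      obtain ⟨z, hzD, hzL⟩ : ∃ z ∈ D, z ∉ L := by
        by_contra hcon
        push Not at hcon
        exact hL.2.1 (le_antisymm hL.1 hcon)
      refine le_trans (hN (k - j) X U hU (WL U D L) E hE z (hDE hzD) (hDp z hzD) (fun w hw h => WL_fpf hp hU hDpg hL hzD hzL hw h)
        (φ ^ p ^ j) hpj1 hEW ?_ L (fun l hl w hw => hw.1 l hl) (fun x hx => hDc z hzD x hx) ?_ ?_ hpow
        (fun x hx => hEn.conj_mem x hx _) hjm T ?_) ?_
      · intro w hw
        have := WL_cj (φ ^ p ^ j) hDn hw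
        rwa [hjL] at this
      · set σ := φ ^ p ^ j with hσ
        have h1 : z⁻¹ * (σ⁻¹ * z * σ⁻¹⁻¹) ∈ L := by
          refine hL.pel_fix hp hab hDp hzD hzL (τ := σ⁻¹) (n := k - j + 1) (by rw [inv_pow, hpj1, inv_one]) (fun d hd => hDn d hd _) ?_
          intro d hd
          rw [← hjL, mem_cj] at hd
          simpa using hd
        refine ⟨_, h1, ?_⟩
        group
      · intro x hx y hy
        exact hL.decomp hab hzD hzL (hcomm x hx y hy)
      · rw [hpj]
        intro x hx h
        refine hT x hx ⟨E.mul_mem (hEn.conj_mem x hx _) (E.inv_mem hx), ?_⟩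
        intro y hy
        have hcE := E.mul_mem (hEn.conj_mem x hx (φ ^ p ^ k)) (E.inv_mem hx)
        refine hkey _ hcE y hy ?_
        intro w hw
        set c := φ ^ p ^ k * x * (φ ^ p ^ k)⁻¹ * x⁻¹ with hcdef
        have h1 := h y hy (c⁻¹ • y⁻¹ • w) (hEW _ (E.inv_mem hcE) _ (hEW _ (E.inv_mem hy) w hw))
        simp only [mul_smul] at h1 ⊢
        rw [h1, smul_inv_smul, smul_inv_smul]
      · exact Finset.single_le_sum (f := N) (fun _ _ => Nat.zero_le _) (Finset.mem_range.2 (by omega))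

end PLen

namespace PLen

theorem lemM {p : ℕ} (hp : p.Prime) (k m : ℕ) : ∃ b : ℕ, ∀ (X U : Type) [Group X] [Finite X] [AddCommGroup U] [Finite U] [DistribMulAction X U]
    (hX : PSol p X) (hU : ¬ p ∣ Nat.card U) (P : Subgroup X) (hPn : P.Normal) (hP : IsPGroup p P)
    (hf : ∀ x ∈ P, (∀ u : U, x • u = u) → x = 1) (φ : X) (hφ : φ ^ p ^ (k + 1) = 1) (hm : Nat.card (fx U φ) ≤ m),
    ∀ x ∈ DI p b (Subgroup.normalClosure {φ ^ p ^ k}), ∀ y ∈ P, x * y = y * x := by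
  obtain ⟨g, hg⟩ := factA hp k m
  obtain ⟨b0, hb0⟩ := lemT_sec hp g
  obtain ⟨N, hN⟩ := dicho hp k m
  obtain ⟨b1, hb1⟩ := lemT_sec hp N
  refine ⟨(((m ^ m).factorial + b0) + b1) + 1, ?_⟩
  intro X U _ _ _ _ _ hX hU P hPn hP hf φ hφ hm
  obtain ⟨A, E, hAn, hEn, hAE, hEP, hAc, hpA, hcA, hCA⟩ := exists_AE hp P hPn hP
  set K := Subgroup.normalClosure {φ ^ p ^ k} with hK
  -- conjugates
  have hgen : ∀ d ∈ Group.conjugatesOfSet {φ ^ p ^ k}, ∃ σ : X, d = σ ^ p ^ k ∧ σ ^ p ^ (k + 1) = 1 ∧ Nat.card (fx U σ) ≤ m := by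
    intro d hd
    rw [Group.mem_conjugatesOfSet_iff] at hd
    obtain ⟨a, ha, had⟩ := hd
    rw [Set.mem_singleton_iff] at ha
    subst ha
    obtain ⟨c, rfl⟩ := isConj_iff.1 had
    refine ⟨c * φ * c⁻¹, by rw [conj_pow], by rw [conj_pow, hφ, mul_one, mul_inv_cancel], ?_⟩
    refine le_trans ?_ hm
    let F : fx U (c * φ * c⁻¹) → fx U φ := fun u => ⟨c⁻¹ • (u : U), by
      have := u.2
      rw [mem_fx] at this ⊢
      rw [mul_smul, mul_smul] at this
      rw [eq_inv_smul_iff]; exact this⟩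
    apply Nat.card_le_card_of_injective F
    intro u v huv
    have h1 : c⁻¹ • (u : U) = c⁻¹ • (v : U) := congrArg (fun t : fx U φ => (t : U)) huv
    exact Subtype.ext ((smul_left_cancel_iff _).1 h1)
  have hgp : ∀ d ∈ Group.conjugatesOfSet {φ ^ p ^ k}, d ^ p = 1 := by
    intro d hd
    obtain ⟨σ, rfl, h1, -⟩ := hgen d hd
    rw [← pow_mul, ← pow_succ, h1]
  have hAab : ∀ x ∈ A, ∀ y ∈ A, x * y = y * x := fun x hx y hy => hAc x hx y (hAE hy)
  have hApg : IsPGroup p A := hP.to_le (hAE.trans hEP)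
  have hEpg : IsPGroup p E := hP.to_le hEP
  have hfA : ∀ x ∈ A, (∀ u : U, x • u = u) → x = 1 := fun x hx => hf x (hEP (hAE hx))
  -- first: DI b0 K centralises A
  have hKA : ∀ x ∈ DI p b0 K, ∀ a ∈ A, x * a = a * x := by
    intro x hx a ha
    have := hb0 X hX K A ⊥ hApg bot_le (fun x hx y hy => by
      rw [Subgroup.mem_bot, hAab x hx y hy, mul_inv_cancel_right, mul_inv_cancel]) (fun k _ x hx => hAn.conj_mem x hx k)
      (fun k _ x hx => by rw [Subgroup.mem_bot] at hx ⊢; rw [hx, mul_one, mul_inv_cancel]) (Group.conjugatesOfSet {φ ^ p ^ k}) rfl hgp (by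
        intro d hd T hT
        obtain ⟨σ, rfl, h1, h2⟩ := hgen d hd
        refine le_trans (Nat.le_of_dvd (Nat.pos_of_ne_zero Subgroup.index_ne_zero_of_finite) (Subgroup.relIndex_dvd_of_le_left A ?_))
          (hg X U hU σ h1 A hApg hAab (fun x hx => hAn.conj_mem x hx _) ⊤ (fun _ _ _ _ => AddSubgroup.mem_top _)
          (fun _ _ => AddSubgroup.mem_top _) (fun x hx h => hfA x hx (fun u => h u (AddSubgroup.mem_top _))) (by rwa [top_inf_eq]))
        rintro y ⟨hy, hy'⟩
        refine hT y hy ?_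
        have hy' := Subgroup.mem_centralizer_iff.1 (show y ∈ Subgroup.centralizer {σ ^ p ^ k} from hy')
        rw [Subgroup.mem_bot, hy' _ rfl]
        group) x hx a ha
    rw [Subgroup.mem_bot] at this
    rw [← mul_inv_eq_iff_eq_mul, ← mul_inv_eq_one]; exact this
  let D : Subgroup X :=
    { carrier := {a | a ∈ A ∧ a ^ p = 1}
      one_mem' := ⟨A.one_mem, one_pow _⟩
      mul_mem' := by
        rintro a b ⟨ha, ha'⟩ ⟨hb, hb'⟩
        exact ⟨A.mul_mem ha hb, by rw [(show Commute a b from hAab a ha b hb).mul_pow, ha', hb', one_mul]⟩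
      inv_mem' := by
        rintro a ⟨ha, ha'⟩
        exact ⟨A.inv_mem ha, by rw [inv_pow, ha', inv_one]⟩ }
  have hDA : D ≤ A := fun x hx => hx.1
  have hDE : D ≤ E := hDA.trans hAE
  have hDc : ∀ d ∈ D, ∀ y ∈ E, d * y = y * d := fun d hd y hy => hAc d hd.1 y hy
  have hDp : ∀ x ∈ D, x ^ p = 1 := fun x hx => hx.2
  have hDn : ∀ d ∈ D, ∀ g : X, g * d * g⁻¹ ∈ D := fun d hd g =>
    ⟨hAn.conj_mem d hd.1 g, by rw [conj_pow, hd.2, mul_one, mul_inv_cancel]⟩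
  have hpow : ∀ x ∈ E, ∀ y ∈ E, x ^ p * y = y * x ^ p := fun x hx y hy => hAc _ (hpA x hx) y hy
  have hcomm : ∀ x ∈ E, ∀ y ∈ E, x * y * x⁻¹ * y⁻¹ ∈ D := by
    intro x hx y hy
    refine ⟨hcA x hx y hy, ?_⟩
    set c := x * y * x⁻¹ * y⁻¹ with hc
    have h1 : Commute c y := hAc c (hcA x hx y hy) y hy
    have h2 : x * y * x⁻¹ = c * y := by rw [hc, inv_mul_cancel_right]
    have h3 : x * y ^ p * x⁻¹ = c ^ p * y ^ p := by rw [← conj_pow, h2, h1.mul_pow]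
    rw [← hpow y hy x hx, mul_inv_cancel_right] at h3
    exact right_eq_mul.1 h3
  have hab : ∀ x ∈ D, ∀ y ∈ D, x * y = y * x := fun x hx y hy => hAab x hx.1 y hy.1
  set J := DI p ((m ^ m).factorial + b0 + b1) K with hJ
  have hJ0 : J ≤ DI p b0 K := DI_anti (by omega) K
  have hJ1 : J ≤ DI p b1 K := DI_anti (by omega) K
  have hJ2 : J ≤ DI p (m ^ m).factorial (DI p b0 K) := by rw [← DI_add]; exact DI_anti (by omega) K
  have hJrad : ∀ L (hL : Coat D L), WL U D L ≠ ⊥ → ∀ x ∈ J, ∀ e ∈ E, ∀ y ∈ E,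
      (x * e * x⁻¹ * e⁻¹) * y * (x * e * x⁻¹ * e⁻¹)⁻¹ * y⁻¹ ∈ L := by
    intro L hL hW
    have hc : ∀ l ∈ L, ∀ y ∈ E, l * y = y * l := fun l hl => hDc l (hL.1 hl)
    suffices h : ∀ x ∈ J, ∀ e ∈ E, x * e * x⁻¹ * e⁻¹ ∈ rad E L hc from fun x hx e he => (mem_rad.1 (h x hx e he)).2
    have hrc : ∀ x ∈ E, ∀ y ∈ E, x * y * x⁻¹ * y⁻¹ ∈ rad E L hc := by
      intro x hx y hy
      refine ⟨hDE (hcomm x hx y hy), fun t ht => ?_⟩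
      rw [hDc _ (hcomm x hx y hy) t ht, mul_inv_cancel_right, mul_inv_cancel]
      exact L.one_mem
    have hrn : ∀ x : X, (∀ l ∈ L, x * l * x⁻¹ ∈ L) → ∀ y ∈ rad E L hc, x * y * x⁻¹ ∈ rad E L hc := by
      rintro x hx y ⟨hy, hy'⟩
      refine ⟨hEn.conj_mem y hy x, fun t ht => ?_⟩
      have h1 := hx _ (hy' (x⁻¹ * t * x) (by simpa using hEn.conj_mem t ht x⁻¹))
      convert h1 using 1
      group
    have hrE : rad E L hc ≤ E := fun x hx => hx.1
    by_cases hall : (rad E L hc).relIndex E ≤ m ^ m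
    · intro x hx
      exact lemB_sec hp (m ^ m) hX (DI p b0 K) E (rad E L hc) hrE hrc (fun k _ x hx => hEn.conj_mem x hx k)
        (fun x hx => hrn x (fun l hl => by rw [hKA x hx l (hDA (hL.1 hl)), mul_inv_cancel_right]; exact hl)) hall x (hJ2 hx)
    · have hd : ∀ d ∈ Group.conjugatesOfSet {φ ^ p ^ k}, cj d L = L ∧ ∀ T : Subgroup X,
          (∀ x ∈ E, d * x * d⁻¹ * x⁻¹ ∈ rad E L hc → x ∈ T) → T.relIndex E ≤ N := by
        intro d hd
        obtain ⟨σ, rfl, h1, h2⟩ := hgen d hd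
        exact (hN X U hU E D L hEn hEpg hDE hDc hDp hDn hcomm hpow hL hW hc σ h1 h2).resolve_left hall
      have hKL : ∀ x ∈ K, cj x L = L := by
        intro x hx
        induction hx using Subgroup.closure_induction with
        | mem x hx => exact (hd x hx).1
        | one => exact cj_one _
        | mul x y _ _ hx hy => rw [cj_mul, hy, hx]
        | inv x _ hx =>
          conv_lhs => rw [← hx]
          rw [← cj_mul, inv_mul_cancel, cj_one]
      intro x hx
      exact hb1 X hX K E (rad E L hc) hEpg hrE hrc (fun k _ x hx => hEn.conj_mem x hx k)
        (fun x hx => hrn x (fun l hl => by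
          rw [← hKL x hx, mem_cj]
          simpa [mul_assoc] using hl)) (Group.conjugatesOfSet {φ ^ p ^ k}) rfl hgp (fun d h => (hd d h).2) x (hJ1 hx)
  have hJA : ∀ x ∈ J, ∀ e ∈ E, x * e * x⁻¹ * e⁻¹ ∈ A := by
    intro x hx e he
    have hcE : x * e * x⁻¹ * e⁻¹ ∈ E := E.mul_mem (hEn.conj_mem e he x) (E.inv_mem he)
    refine hCA _ (hEP hcE) ?_
    intro y hy
    by_contra hne
    have h1 := hcomm _ hcE y hy
    obtain ⟨L, hL, hW, hnL⟩ := exists_sep hp hU hDp hab (fun x hx => hfA x hx.1) h1 (by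
      intro h
      apply hne
      rw [mul_inv_eq_one, mul_inv_eq_iff_eq_mul] at h
      exact h)
    exact hnL (hJrad L hL hW x hx e he y hy)
  -- p'-elements of J
  have hq : ∀ (x : X) (F : Subgroup X), IsPGroup p F → IsQEl p x → ∀ y, x * y * x⁻¹ * y⁻¹ ∈ F → x * (x * y * x⁻¹ * y⁻¹) = (x * y * x⁻¹ * y⁻¹) * x → x * y = y * x := by
    intro x F hF hx y hc hcx
    set c := x * y * x⁻¹ * y⁻¹ with hcd
    have h1 : ∀ s : ℕ, x ^ s * y * (x ^ s)⁻¹ = c ^ s * y := by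
      intro s
      induction s with
      | zero => simp
      | succ s ih =>
        calc x ^ (s + 1) * y * (x ^ (s + 1))⁻¹ = x * (x ^ s * y * (x ^ s)⁻¹) * x⁻¹ := by rw [pow_succ']; group
          _ = (x * c ^ s) * y * x⁻¹ := by rw [ih]; group
          _ = c ^ s * (x * y * x⁻¹ * y⁻¹) * y := by rw [((show Commute x c from hcx).pow_right s).eq]; group
          _ = _ := by rw [← hcd, pow_succ]
    obtain ⟨s, hs, hxs⟩ := hx
    have h2 := h1 s
    rw [hxs, one_mul, inv_one, mul_one] at h2
    have h3 : c ^ s = 1 := right_eq_mul.1 h2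
    have h4 : c = 1 := eq_one_of_p_q (isPEl_of_mem hF hc) ⟨s, hs, h3⟩
    rw [hcd, mul_inv_eq_one, mul_inv_eq_iff_eq_mul] at h4
    exact h4
  have hfin : ∀ x ∈ J, IsQEl p x → ∀ y ∈ P, x * y = y * x := by
    intro x hx hxq y hy
    have hE1 : ∀ e ∈ E, x * e = e * x := by
      intro e he
      exact hq x A hApg hxq e (hJA x hx e he) (hKA x (hJ0 hx) _ (hJA x hx e he))
    have hcP : x * y * x⁻¹ * y⁻¹ ∈ P := P.mul_mem (hPn.conj_mem y hy x) (P.inv_mem hy)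
    refine hq x P hP hxq y hcP ?_
    refine hKA x (hJ0 hx) _ (hCA _ hcP ?_)
    intro e he
    have h1 : x⁻¹ * e = e * x⁻¹ := by rw [inv_mul_eq_iff_eq_mul, ← mul_assoc, hE1 e he, mul_inv_cancel_right]
    have h2 : y⁻¹ * e * y ∈ E := by simpa using hEn.conj_mem e he y⁻¹
    have h3 : x⁻¹ * (y⁻¹ * e * y) = (y⁻¹ * e * y) * x⁻¹ := by
      rw [inv_mul_eq_iff_eq_mul, ← mul_assoc, hE1 _ h2, mul_inv_cancel_right]
    calc x * y * x⁻¹ * y⁻¹ * e = x * y * (x⁻¹ * (y⁻¹ * e * y)) * y⁻¹ := by group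
      _ = x * e * y * x⁻¹ * y⁻¹ := by rw [h3]; group
      _ = e * (x * y * x⁻¹ * y⁻¹) := by rw [hE1 e he]; group
  intro x hx
  rw [DI_succ'] at hx
  have h1 : DD p J ≤ Subgroup.centralizer (P : Set X) := by
    refine (Subgroup.closure_le _).2 ?_
    rintro t ⟨ht, ht'⟩
    rw [SetLike.mem_coe, Subgroup.mem_centralizer_iff]
    intro y hy
    exact (hfin t (Rp_le _ ht) ht' y hy).symm
  intro y hy
  exact (Subgroup.mem_centralizer_iff.1 (h1 hx) y hy).symm

theorem lemM' {p : ℕ} (hp : p.Prime) (k m : ℕ) : ∃ b : ℕ, ∀ (X U : Type) [Group X] [Finite X] [AddCommGroup U] [Finite U] [DistribMulAction X U]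
    (hX : PSol p X) (hU : ¬ p ∣ Nat.card U) (P : Subgroup X) (hPn : P.Normal) (hP : IsPGroup p P)
    (φ : X) (hφ : φ ^ p ^ (k + 1) = 1) (hm : Nat.card (fx U φ) ≤ m),
    ∀ x ∈ DI p b (Subgroup.normalClosure {φ ^ p ^ k}), ∀ y ∈ P, ∀ u : U, (x * y * x⁻¹ * y⁻¹) • u = u := by
  obtain ⟨b, hb⟩ := lemM hp k m
  refine ⟨b, ?_⟩
  intro X U _ _ _ _ _ hX hU P hPn hP φ hφ hm x hx y hy u
  let f := MulAction.toPermHom X U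
  letI : DistribMulAction f.range U := imgAct X U
  have hfr : ∀ (y : X) (w : U), (f.rangeRestrict y) • w = y • w := fun _ _ => rfl
  have h1 := hb f.range U (hX.of_surj hp f.rangeRestrict f.rangeRestrict_surjective) hU (P.map f.rangeRestrict)
    (hPn.map _ f.rangeRestrict_surjective) (hP.map _) (by
      rintro _ ⟨t, ht, rfl⟩ h
      apply Subtype.ext
      apply Equiv.ext
      intro v
      exact h v) (f.rangeRestrict φ) (by rw [← map_pow, hφ, map_one]) (by
      refine le_trans (AddSubgroup.card_le_of_le ?_) hm
      intro v hv
      exact hv) (f.rangeRestrict x) (by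
      have h2 := Subgroup.mem_map_of_mem f.rangeRestrict hx
      rw [← DI_map hp, Subgroup.map_normalClosure _ _ f.rangeRestrict_surjective, Set.image_singleton, map_pow] at h2
      exact h2) (f.rangeRestrict y) (Subgroup.mem_map_of_mem _ hy)
  rw [← hfr, map_mul, map_mul, map_mul, h1, map_inv, mul_inv_cancel_right, map_inv, mul_inv_cancel, one_smul]

end PLen

namespace PLen

theorem coatom_fratt {G : Type} [Group G] [Finite G] {r : ℕ} (hr : r.Prime) (hG : IsPGroup r G) {M : Subgroup G} (hM : IsCoatom M) (x y : G) :
    x * y * x⁻¹ * y⁻¹ ∈ M ∧ x ^ r ∈ M := by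
  haveI := Fact.mk hr
  haveI : Group.IsNilpotent G := hG.isNilpotent
  haveI hn : M.Normal := Subgroup.NormalizerCondition.normal_of_coatom M Group.normalizerCondition_of_isNilpotent hM
  haveI : Nontrivial (G ⧸ M) := QuotientGroup.nontrivial_iff.2 hM.1
  have hq : IsPGroup r (G ⧸ M) := hG.to_quotient M
  have hd : r ∣ Nat.card (G ⧸ M) := by
    obtain ⟨n, hn⟩ := IsPGroup.iff_card.1 hq
    rw [hn]
    refine dvd_pow_self r ?_
    rintro rfl
    rw [pow_zero, Nat.card_eq_one_iff_unique] at hn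
    exact not_subsingleton _ hn.1
  obtain ⟨c, hc⟩ := exists_prime_orderOf_dvd_card' r hd
  have hcr : c ^ r = 1 := by rw [← hc, pow_orderOf_eq_one]
  have hc1 : c ≠ 1 := by
    rintro rfl
    rw [orderOf_one] at hc
    exact hr.one_lt.ne hc
  have hlt : M < (Subgroup.zpowers c).comap (QuotientGroup.mk' M) := by
    refine lt_of_le_of_ne ?_ ?_
    · intro t ht
      have h0 : QuotientGroup.mk' M t = 1 := (QuotientGroup.eq_one_iff t).2 ht
      rw [Subgroup.mem_comap, h0]
      exact one_mem _
    · intro h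
      obtain ⟨t, rfl⟩ := QuotientGroup.mk'_surjective M c
      apply hc1
      have : t ∈ M := by rw [h, Subgroup.mem_comap]; exact Subgroup.mem_zpowers _
      exact (QuotientGroup.eq_one_iff t).2 this
  have htop := hM.2 _ hlt
  have hall : ∀ t : G, ∃ i : ℤ, c ^ i = QuotientGroup.mk' M t := by
    intro t
    have : t ∈ (Subgroup.zpowers c).comap (QuotientGroup.mk' M) := by rw [htop]; trivial
    exact Subgroup.mem_zpowers_iff.1 this
  obtain ⟨i, hi⟩ := hall x
  obtain ⟨j, hj⟩ := hall y
  constructor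
  · rw [← QuotientGroup.eq_one_iff]
    show QuotientGroup.mk' M (x * y * x⁻¹ * y⁻¹) = 1
    rw [map_mul, map_mul, map_mul, map_inv, map_inv, ← hi, ← hj]
    group
  · rw [← QuotientGroup.eq_one_iff]
    show QuotientGroup.mk' M (x ^ r) = 1
    rw [map_pow, ← hi, ← zpow_natCast, ← zpow_mul, mul_comm, zpow_mul, zpow_natCast, hcr, one_zpow]

theorem exists_fratt {X : Type} [Group X] [Finite X] {r : ℕ} (hr : r.Prime) (R : Subgroup X) (hR : IsPGroup r R) :
    ∃ F : Subgroup X, F ≤ R ∧ (∀ x ∈ R, ∀ y ∈ R, x * y * x⁻¹ * y⁻¹ ∈ F) ∧ (∀ x ∈ R, x ^ r ∈ F) ∧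
      (∀ g : X, (∀ t ∈ R, g * t * g⁻¹ ∈ R) → ∀ t ∈ F, g * t * g⁻¹ ∈ F) ∧
      (∀ C : Subgroup X, C ≤ R → (∀ t ∈ R, ∃ f ∈ F, t * f ∈ C) → C = R) := by
  have hmem : ∀ t : R, (∀ M : Subgroup R, IsCoatom M → t ∈ M) → t ∈ frattini R := by
    intro t h
    simp only [frattini, Order.radical, Subgroup.mem_iInf]
    exact h
  refine ⟨(frattini R).map R.subtype, ?_, ?_, ?_, ?_, ?_⟩
  · rintro _ ⟨t, _, rfl⟩
    exact t.2
  · intro x hx y hy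
    exact ⟨⟨x, hx⟩ * ⟨y, hy⟩ * ⟨x, hx⟩⁻¹ * ⟨y, hy⟩⁻¹, hmem _ fun M hM => (coatom_fratt hr hR hM _ _).1, rfl⟩
  · intro x hx
    exact ⟨⟨x, hx⟩ ^ r, hmem _ fun M hM => (coatom_fratt hr hR hM _ 1).2, rfl⟩
  · intro g hg t ht
    obtain ⟨t, ht, rfl⟩ := ht
    have hgn : g ∈ Subgroup.normalizer (R : Set X) := by
      rw [Subgroup.mem_normalizer_iff]
      have := cj_eq_of_inv hg
      intro h
      refine ⟨hg h, fun h' => ?_⟩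
      rw [← this, mem_cj] at h'
      simpa [mul_assoc] using h'
    have h1 := Subgroup.characteristic_iff_map_eq.1 (inferInstance : (frattini R).Characteristic) (R.normalizerMonoidHom ⟨g, hgn⟩)
    refine ⟨R.normalizerMonoidHom ⟨g, hgn⟩ t, ?_, rfl⟩
    rw [← h1]
    exact Subgroup.mem_map_of_mem _ ht
  · intro C hC h
    have h1 : C.subgroupOf R ⊔ frattini R = ⊤ := by
      rw [eq_top_iff]
      intro t _
      obtain ⟨_, ⟨f, hf, rfl⟩, htf⟩ := h t t.2
      have h2 : t = (t * f) * f⁻¹ := by group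
      rw [h2]
      exact Subgroup.mul_mem_sup (Subgroup.mem_subgroupOf.2 htf) ((frattini R).inv_mem hf)
    have h2 := frattini_nongenerating h1
    exact le_antisymm hC (Subgroup.subgroupOf_eq_top.1 h2)

/-- every elementary abelian `p'`-section centralised by `φ` has order at most `m`. -/
def Star {X : Type} [Group X] (p m : ℕ) (φ : X) : Prop :=
  ∀ r : ℕ, r.Prime → r ≠ p → ∀ C B : Subgroup X, B ≤ C → (∀ x ∈ B, φ * x * φ⁻¹ ∈ B) →
    (∀ a ∈ C, ∀ b ∈ C, a * b * a⁻¹ * b⁻¹ ∈ B) → (∀ a ∈ C, a ^ r ∈ B) → (∀ x ∈ C, φ * x * φ⁻¹ * x⁻¹ ∈ B) → B.relIndex C ≤ m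

theorem Star.map {X Y : Type} [Group X] [Group Y] {p m : ℕ} {φ : X} (h : Star p m φ) (f : X →* Y) (hf : Function.Surjective f) :
    Star p m (f φ) := by
  intro r hr hrp C B hBC hB hab hpow hfix
  have := h r hr hrp (C.comap f) (B.comap f) (Subgroup.comap_mono hBC) (fun x hx => by
      rw [Subgroup.mem_comap] at hx ⊢
      simpa using hB _ hx) (fun a ha b hb => by
      rw [Subgroup.mem_comap] at ha hb ⊢
      simpa using hab _ ha _ hb) (fun a ha => by
      rw [Subgroup.mem_comap] at ha ⊢
      simpa using hpow _ ha) (fun x hx => by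
      rw [Subgroup.mem_comap] at hx ⊢
      simpa using hfix _ hx)
  rwa [Subgroup.relIndex_comap, Subgroup.map_comap_eq_self_of_surjective hf] at this

/-- the local action -/
theorem local_act {X : Type} [Group X] [Finite X] {p : ℕ} (hp : p.Prime) {m : ℕ} {φ : X} (hs : Star p m φ) {r : ℕ} (hr : r.Prime) (hrp : r ≠ p)
    (R N : Subgroup X) (hR : IsPGroup r R) (hφ : φ ∈ N) (hNR : ∀ x ∈ N, ∀ t ∈ R, x * t * x⁻¹ ∈ R) :
    ∃ (V : Type) (_ : AddCommGroup V) (_ : Finite V) (_ : DistribMulAction N V), ¬ p ∣ Nat.card V ∧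
      Nat.card (fx V (⟨φ, hφ⟩ : N)) ≤ m ∧ ∀ z : N, IsPEl p (z : X) → (∀ v : V, z • v = v) → ∀ t ∈ R, (z : X) * t = t * z := by
  haveI := Fact.mk hr
  obtain ⟨F, hFR, hFc, hFp, hFn, hFg⟩ := exists_fratt hr R hR
  have hpR : ∀ T : Subgroup X, T ≤ R → ¬ p ∣ Nat.card T := by
    intro T hT hd
    obtain ⟨n, hn⟩ := IsPGroup.iff_card.1 (hR.to_le hT)
    rw [hn] at hd
    exact hrp ((Nat.prime_dvd_prime_iff_eq hp hr).1 (hp.dvd_of_dvd_pow hd)).symm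
  have hNF : ∀ k ∈ N, ∀ x ∈ F, k * x * k⁻¹ ∈ F := fun k hk => hFn k (hNR k hk)
  obtain ⟨V, _, _, _, f, hfs, hfm, hf0, hfk, hfc, hfW⟩ := secAct N R F hFR hFc hNR hNF
  have hsub : ∀ x y : R, f x = f y ↔ (x : X) * (y : X)⁻¹ ∈ F := by
    intro x y
    have h1 := hfm (x * y⁻¹) y
    rw [inv_mul_cancel_right] at h1
    rw [h1]
    have h2 := hf0 (x * y⁻¹)
    rw [add_eq_right, h2]; rfl
  refine ⟨V, ‹_›, ‹_›, ‹_›, ?_, ?_, ?_⟩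
  · rw [hfc]
    intro hd
    apply hpR R le_rfl
    rw [← card_mul_relIndex' hFR]
    exact hd.mul_left _
  · obtain ⟨T, hTR, hT, hTi⟩ := hfW (fx V (⟨φ, hφ⟩ : N))
    have hFT : F ≤ T := by
      intro x hx
      refine (hT ⟨x, hFR hx⟩).2 ?_
      rw [(hf0 ⟨x, hFR hx⟩).2 hx]
      exact zero_mem _
    have h1 : F.relIndex T ≤ m := by
      refine hs r hr hrp T F hFT (hNF φ hφ) (fun a ha b hb => hFc a (hTR ha) b (hTR hb)) (fun a ha => hFp a (hTR ha)) ?_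
      intro x hx
      have h2 := (hT ⟨x, hTR hx⟩).1 hx
      rw [mem_fx, hfk, hsub] at h2
      exact h2
    have h2 := Subgroup.relIndex_mul_relIndex F T R hFT hTR
    have h3 := (fx V (⟨φ, hφ⟩ : N)).card_mul_index
    rw [hfc, ← h2, hTi] at h3
    have h4 : 0 < (fx V (⟨φ, hφ⟩ : N)).index := Nat.pos_of_ne_zero AddSubgroup.index_ne_zero_of_finite
    rw [Nat.eq_of_mul_eq_mul_right h4 h3]
    exact h1
  · intro z hz hzv
    have h1 : ∀ t ∈ R, (z : X) * t * (z : X)⁻¹ * t⁻¹ ∈ F := by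
      intro t ht
      have := hzv (f ⟨t, ht⟩)
      rw [hfk, hsub] at this
      exact this
    have hC := hFg (R ⊓ Subgroup.centralizer {(z : X)}) inf_le_left (by
      intro t ht
      obtain ⟨k, hk⟩ := hz
      have hzl : ∀ x ∈ Subgroup.zpowers (z : X), ∀ t ∈ R, x * t * x⁻¹ * t⁻¹ ∈ F := by
        intro x hx t ht
        obtain ⟨i, rfl⟩ := Subgroup.mem_zpowers_iff.1 hx
        have h3 : z ^ i ∈ MulAction.stabilizer N (f ⟨t, ht⟩) := Subgroup.zpow_mem _ (hzv _) i
        have h4 : z ^ i • f ⟨t, ht⟩ = f ⟨t, ht⟩ := h3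
        rw [hfk, hsub] at h4
        exact h4
      obtain ⟨s, hs, hfix⟩ := coset_fix hp (Subgroup.zpowers (z : X)) F (isPGroup_zpowers hk) (hpR F hFR)
        (fun x hx => hNF x ((Subgroup.zpowers_le.2 z.2) hx)) t (by
          intro x hx
          have h2 := hFn t⁻¹ (fun s hs => R.mul_mem (R.mul_mem (R.inv_mem ht) hs) (R.inv_mem (R.inv_mem ht))) _ (hzl x hx t ht)
          convert h2 using 1
          group)
      refine ⟨s, hs, R.mul_mem ht (hFR hs), ?_⟩
      refine Subgroup.mem_centralizer_iff.2 ?_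
      rintro _ rfl
      have := hfix z (Subgroup.mem_zpowers _)
      rw [mul_inv_eq_iff_eq_mul] at this
      exact this)
    intro t ht
    rw [← hC] at ht
    exact Subgroup.mem_centralizer_iff.1 ht.2 _ rfl

end PLen

namespace PLen

theorem DD_eq_bot_of_pgroup {X : Type} [Group X] [Finite X] {p : ℕ} (hp : p.Prime) {P : Subgroup X} (hP : IsPGroup p P) : DD p P = ⊥ := by
  unfold DD
  rw [Rq_bot_iff hp]
  intro x hx hq
  exact eq_one_of_p_q (isPEl_of_mem hP (Rp_le _ hx)) hq

/-- Frattini argument: a subgroup normalising both `P` and `R` supplements `Q`. -/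
theorem supp {X : Type} [Group X] [Finite X] {p r : ℕ} (hp : p.Prime) (hr : r.Prime) (Q F P R : Subgroup X) (hQn : Q.Normal) (hFn : F.Normal)
    (hQp : ¬ p ∣ Nat.card Q) (hP : IsPGroup p P) (hPF : IsSyl p F P) (hF : ∀ f ∈ F, ∃ q ∈ Q, ∃ s ∈ P, f = q * s)
    (hR : IsSyl r Q R) (hPR : ∀ x ∈ P, ∀ t ∈ R, x * t * x⁻¹ ∈ R) (g : X) :
    ∃ q ∈ Q, cj (q * g) P = P ∧ cj (q * g) R = R := by
  have hcjS : ∀ (s : ℕ) (A B : Subgroup X), A.Normal → IsSyl s A B → ∀ g, IsSyl s A (cj g B) := by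
    rintro s A B hA ⟨h1, h2, h3⟩ g
    have h4 : cj g B ≤ A := by
      intro x hx
      rw [mem_cj] at hx
      have := hA.conj_mem _ (h1 hx) g
      simpa [mul_assoc] using this
    refine ⟨h4, h2.map _, ?_⟩
    have e1 := card_mul_relIndex' h1
    have e2 := card_mul_relIndex' h4
    rw [cj_card, ← e1] at e2
    rwa [Nat.eq_of_mul_eq_mul_left Nat.card_pos e2]
  obtain ⟨f, hf, hfP⟩ := syl_conj hp hPF (hcjS p F P hFn hPF g)
  obtain ⟨q, hq, s, hs, rfl⟩ := hF f hf
  rw [cj_mul, cj_eq_of_inv (x := s) (fun y hy => P.mul_mem (P.mul_mem hs hy) (P.inv_mem hs))] at hfP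
  set g' := q⁻¹ * g with hg'
  have hg'P : cj g' P = P := by rw [hg', cj_mul, ← hfP, ← cj_mul, inv_mul_cancel, cj_one]
  obtain ⟨c, hc, hcR⟩ := syl_conj hr hR (hcjS r Q R hQn hR g')
  have hxR : ∀ x ∈ P, cj x R = R := fun x hx => cj_eq_of_inv (hPR x hx)
  have hxR' : ∀ x ∈ P, cj x (cj g' R) = cj g' R := by
    intro x hx
    rw [← cj_mul, show x * g' = g' * (g'⁻¹ * x * g') by group, cj_mul, hxR]
    rw [← hg'P, mem_cj] at hx
    exact hx
  let T : Subgroup X :=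
    { carrier := {x | x ∈ Q ∧ cj x R = R}
      one_mem' := ⟨Q.one_mem, cj_one _⟩
      mul_mem' := by
        rintro a b ⟨ha, ha'⟩ ⟨hb, hb'⟩
        exact ⟨Q.mul_mem ha hb, by rw [cj_mul, hb', ha']⟩
      inv_mem' := by
        rintro a ⟨ha, ha'⟩
        refine ⟨Q.inv_mem ha, ?_⟩
        conv_lhs => rw [← ha']
        rw [← cj_mul, inv_mul_cancel, cj_one] }
  have hTQ : T ≤ Q := fun x hx => hx.1
  obtain ⟨t, ht, hfix⟩ := coset_fix hp P T hP (fun h => hQp (h.trans (Subgroup.card_dvd_of_le hTQ))) (by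
      rintro x hx t ⟨ht, ht'⟩
      refine ⟨hQn.conj_mem t ht x, ?_⟩
      rw [cj_mul, cj_mul, hxR _ (P.inv_mem hx), ht', hxR x hx]) c (by
      intro x hx
      refine ⟨Q.mul_mem (Q.inv_mem hc) (hQn.conj_mem c hc x), ?_⟩
      rw [cj_mul, cj_mul, cj_mul, hxR _ (P.inv_mem hx), hcR, hxR' x hx, ← hcR, ← cj_mul, inv_mul_cancel, cj_one])
  refine ⟨(c * t)⁻¹ * q⁻¹, Q.mul_mem (Q.inv_mem (Q.mul_mem hc ht.1)) (Q.inv_mem hq), ?_, ?_⟩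
  · rw [mul_assoc, ← hg', cj_mul, hg'P]
    refine cj_eq_of_inv fun y hy => ?_
    have h1 := hfix y hy
    rw [mul_inv_eq_iff_eq_mul] at h1
    have : (c * t)⁻¹ * y * (c * t)⁻¹⁻¹ = y := by
      rw [inv_inv, mul_assoc, h1, inv_mul_cancel_left]
    rw [this]; exact hy
  · rw [mul_assoc, ← hg', cj_mul, ← hcR]
    have h1 : cj (c * t) R = cj c R := by rw [cj_mul, ht.2]
    rw [← h1, ← cj_mul, inv_mul_cancel, cj_one]

theorem core {X : Type} [Group X] [Finite X] {p : ℕ} (hp : p.Prime) (hX : PSol p X)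
    (hOp : ∀ N : Subgroup X, N.Normal → IsPGroup p N → N = ⊥) (φ : X) (e : ℕ) (hφ : φ ^ p ^ e = 1) (K : Subgroup X) (b : ℕ)
    (hloc : ∀ (Q : Subgroup X) (_ : Q.Normal) (r : ℕ), r.Prime → r ≠ p → ∀ R P N : Subgroup X, φ ∈ N → P ≤ N → IsPGroup p P → IsPGroup r R →
      (∀ x ∈ N, ∀ t ∈ R, x * t * x⁻¹ ∈ R) → (∀ x ∈ N, ∀ t ∈ P, x * t * x⁻¹ ∈ P) → N.map (QuotientGroup.mk' Q) = ⊤ →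
      ∃ K' ≤ N, K.map (QuotientGroup.mk' Q) ≤ K'.map (QuotientGroup.mk' Q) ∧
        ∀ k ∈ DI p b K', ∀ y ∈ P, ∀ t ∈ R, (k * y * k⁻¹ * y⁻¹) * t = t * (k * y * k⁻¹ * y⁻¹)) :
    DI p (b + 2) K = ⊥ := by
  haveI := Fact.mk hp
  obtain ⟨Q, hQn, hQp, hQmax⟩ := exists_Oq (X := X) hp
  have hQC := HH1 hp hX hOp Q hQn hQp hQmax
  set π := QuotientGroup.mk' Q with hπ
  have hπs : Function.Surjective π := QuotientGroup.mk'_surjective Q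
  have hπ1 : ∀ x, π x = 1 ↔ x ∈ Q := fun x => QuotientGroup.eq_one_iff x
  obtain ⟨F', hFn', hFp', hFmax'⟩ := exists_Op (X := X ⧸ Q) hp
  have hFC := HH2 hp (hX.quot hp Q) (by
    intro N hN hNp
    have h1 : N.comap π ≤ Q := by
      refine hQmax _ (hN.comap π) ?_
      rw [hπ, card_comap_mk]
      intro hd
      exact (hp.dvd_mul.1 hd).elim hQp hNp
    rw [eq_bot_iff]
    intro x hx
    obtain ⟨y, rfl⟩ := hπs x
    exact (hπ1 y).2 (h1 hx)) F' hFn' hFp' hFmax'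
  set F := F'.comap π with hF
  have hFn : F.Normal := hFn'.comap π
  have hQF : Q ≤ F := by
    intro x hx
    rw [hF, Subgroup.mem_comap, (hπ1 x).2 hx]
    exact one_mem _
  obtain ⟨S, hS⟩ := (isPGroup_zpowers hφ).exists_le_sylow
  set P : Subgroup X := (S : Subgroup X) ⊓ F with hP
  have hPp : IsPGroup p P := S.2.to_le inf_le_left
  have hPF : IsSyl p F P := by
    refine ⟨inf_le_right, hPp, ?_⟩
    rw [hP, Subgroup.inf_relIndex_right]
    intro hd
    apply S.not_dvd_index
    have h1 := Subgroup.relIndex_mul_relIndex (S ⊓ F : Subgroup X) F (S ⊔ F) inf_le_right le_sup_right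
    have h2 := Subgroup.relIndex_mul_relIndex (S ⊓ F : Subgroup X) S (S ⊔ F) inf_le_left le_sup_left
    rw [Subgroup.inf_relIndex_right, Subgroup.relIndex_sup_right] at h1
    rw [Subgroup.inf_relIndex_left, ← h1, mul_comm] at h2
    have h3 := Nat.eq_of_mul_eq_mul_right (Nat.pos_of_ne_zero Subgroup.index_ne_zero_of_finite) h2
    rw [← h3] at hd
    exact hd.trans (Subgroup.relIndex_dvd_index_of_le le_sup_left)
  have hPQ : ∀ x ∈ P, x ∈ Q → x = 1 := fun x hx hx' => eq_one_of_p_q (isPEl_of_mem hPp hx) (isQEl_of_mem hp hQp hx')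
  have hFdec : ∀ f ∈ F, ∃ q ∈ Q, ∃ s ∈ P, f = q * s := by
    have h1 : (Q ⊔ P).relIndex F = 1 := by
      have hle : Q ⊔ P ≤ F := sup_le hQF inf_le_right
      have d1 : (Q ⊔ P).relIndex F ∣ Q.relIndex F := Subgroup.relIndex_dvd_of_le_left F le_sup_left
      have d2 : (Q ⊔ P).relIndex F ∣ P.relIndex F := Subgroup.relIndex_dvd_of_le_left F le_sup_right
      have hQF' : Q.relIndex F = Nat.card F' := by
        have e1 := card_mul_relIndex' hQF
        have e2 := card_comap_mk Q F'
        rw [← hπ, ← hF, ← e1] at e2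
        exact Nat.eq_of_mul_eq_mul_left Nat.card_pos e2
      obtain ⟨n, hn⟩ := IsPGroup.iff_card.1 hFp'
      rw [hQF', hn] at d1
      obtain ⟨i, -, hi⟩ := (Nat.dvd_prime_pow hp).1 d1
      rw [hi]
      rcases Nat.eq_zero_or_pos i with h0 | h0
      · rw [h0, pow_zero]
      · exfalso
        apply hPF.2.2
        refine dvd_trans ?_ d2
        rw [hi]
        exact dvd_pow_self p h0.ne'
    intro f hf
    have h2 := Subgroup.relIndex_eq_one.1 h1 hf
    obtain ⟨q, hq, s, hs, h⟩ := Subgroup.mem_sup_of_normal_left.1 h2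
    exact ⟨q, hq, s, hs, h.symm⟩
  have hloc' : ∀ r : ℕ, r.Prime → r ≠ p → ∃ R N : Subgroup X, IsSyl r Q R ∧ (∀ x ∈ N, ∀ t ∈ P, x * t * x⁻¹ ∈ P) ∧
      ∃ K' ≤ N, K.map π ≤ K'.map π ∧
        ∀ k ∈ DI p b K', ∀ y ∈ P, ∀ t ∈ R, (k * y * k⁻¹ * y⁻¹) * t = t * (k * y * k⁻¹ * y⁻¹) := by
    intro r hr hrp
    obtain ⟨R, hR, hSR⟩ := exists_inv_syl hp hr (S : Subgroup X) Q S.2 hQp (fun x _ t ht => hQn.conj_mem t ht x)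
    let N : Subgroup X :=
      { carrier := {x | cj x P = P ∧ cj x R = R}
        one_mem' := ⟨cj_one _, cj_one _⟩
        mul_mem' := by
          rintro a b ⟨ha, ha'⟩ ⟨hb, hb'⟩
          exact ⟨by rw [cj_mul, hb, ha], by rw [cj_mul, hb', ha']⟩
        inv_mem' := by
          rintro a ⟨ha, ha'⟩
          constructor
          · conv_lhs => rw [← ha]
            rw [← cj_mul, inv_mul_cancel, cj_one]
          · conv_lhs => rw [← ha']
            rw [← cj_mul, inv_mul_cancel, cj_one] }
    have hSN : (S : Subgroup X) ≤ N := by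
      intro x hx
      refine ⟨cj_eq_of_inv fun y hy => ⟨?_, ?_⟩, cj_eq_of_inv (hSR x hx)⟩
      · exact (S : Subgroup X).mul_mem ((S : Subgroup X).mul_mem hx hy.1) ((S : Subgroup X).inv_mem hx)
      · exact hFn.conj_mem y hy.2 x
    have hPN : P ≤ N := inf_le_left.trans hSN
    refine ⟨R, N, hR, fun x hx => mem_of_cj_eq hx.1, ?_⟩
    refine hloc Q hQn r hr hrp R P N (hSN (hS (Subgroup.mem_zpowers φ))) hPN hPp hR.2.1 (fun x hx => mem_of_cj_eq hx.2) (fun x hx => mem_of_cj_eq hx.1) ?_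
    rw [eq_top_iff]
    intro x _
    obtain ⟨g, rfl⟩ := hπs x
    obtain ⟨q, hq, h1, h2⟩ := supp hp hr Q F P R hQn hFn hQp hPp hPF hFdec hR (fun x hx => hSR x hx.1) g
    refine ⟨q * g, ⟨h1, h2⟩, ?_⟩
    show π (q * g) = π g
    rw [map_mul, (hπ1 q).2 hq, one_mul]
  have hcent : DI p b (K.map π) ≤ Subgroup.centralizer (F' : Set (X ⧸ Q)) := by
    intro kb hk
    rw [Subgroup.mem_centralizer_iff]
    intro yb hy
    obtain ⟨f, rfl⟩ := hπs yb
    obtain ⟨q, hq, y, hyP, rfl⟩ := hFdec f hy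
    rw [map_mul, (hπ1 q).2 hq, one_mul]
    have hz : ∀ r : ℕ, r.Prime → r ≠ p → ∃ R, IsSyl r Q R ∧ ∃ z ∈ P, π z = kb * π y * kb⁻¹ * (π y)⁻¹ ∧ ∀ t ∈ R, z * t = t * z := by
      intro r hr hrp
      obtain ⟨R, N, hR, hNP, K', hK'N, hKK', hc⟩ := hloc' r hr hrp
      have h1 := DI_mono b hKK' hk
      rw [DI_map hp] at h1
      obtain ⟨k, hk', rfl⟩ := h1
      refine ⟨R, hR, k * y * k⁻¹ * y⁻¹, ?_, ?_, hc k hk' y hyP⟩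
      · exact P.mul_mem (hNP k (hK'N (DI_le _ _ hk')) y hyP) (P.inv_mem hyP)
      · simp only [map_mul, map_inv]
    obtain ⟨r0, hr0, hr0p⟩ : ∃ r : ℕ, r.Prime ∧ r ≠ p := by
      by_cases h : p = 2
      · exact ⟨3, Nat.prime_three, by omega⟩
      · exact ⟨2, Nat.prime_two, fun h' => h h'.symm⟩
    obtain ⟨-, -, z, hzP, hzπ, -⟩ := hz r0 hr0 hr0p
    have hzR : ∀ r : ℕ, r.Prime → r ≠ p → ∃ R, IsSyl r Q R ∧ ∀ t ∈ R, z * t = t * z := by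
      intro r hr hrp
      obtain ⟨R, hR, z', hz'P, hz'π, hz'⟩ := hz r hr hrp
      have h1 : z⁻¹ * z' = 1 := by
        refine hPQ _ (P.mul_mem (P.inv_mem hzP) hz'P) ?_
        rw [← hπ1, map_mul, map_inv, hzπ, hz'π, inv_mul_cancel]
      have h2 : z = z' := by rwa [inv_mul_eq_one] at h1
      exact ⟨R, hR, h2 ▸ hz'⟩
    have hzQ : Q ≤ Subgroup.centralizer {z} := by
      rw [← Subgroup.relIndex_eq_one]
      by_contra hne
      obtain ⟨r, hr, hrd⟩ := Nat.exists_prime_and_dvd hne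
      by_cases hrp : r = p
      · subst hrp
        have h1 : (Subgroup.centralizer {z}).relIndex Q ∣ Nat.card Q := Subgroup.relIndex_dvd_card _ _
        exact hQp (hrd.trans h1)
      · obtain ⟨R, hR, hRz⟩ := hzR r hr hrp
        apply hR.2.2
        refine hrd.trans (Subgroup.relIndex_dvd_of_le_left Q ?_)
        intro t ht
        rw [Subgroup.mem_centralizer_iff]
        rintro _ rfl
        exact hRz t ht
    have hz1 : z = 1 := by
      refine hPQ z hzP (hQC ?_)
      rw [Subgroup.mem_centralizer_iff]
      intro t ht
      exact (Subgroup.mem_centralizer_iff.1 (hzQ ht) z rfl).symm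
    rw [hz1, map_one] at hzπ
    rw [eq_comm, mul_inv_eq_one, mul_inv_eq_iff_eq_mul] at hzπ
    exact hzπ.symm
  have h1 : DI p (b + 1) (K.map π) = ⊥ := by
    rw [DI_succ', eq_bot_iff, ← DD_eq_bot_of_pgroup hp hFp']
    exact DD_mono (hcent.trans hFC)
  have h2 : DI p (b + 1) K ≤ Q := by
    rw [DI_map hp, Subgroup.map_eq_bot_iff] at h1
    intro x hx
    exact (hπ1 x).1 (h1 hx)
  rw [show b + 2 = (b + 1) + 1 from rfl, DI_succ', eq_bot_iff, ← DD_eq_bot_of_pprime hp hQp]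
  exact DD_mono h2

end PLen

namespace PLen

theorem Op_quot {X : Type} [Group X] [Finite X] {p : ℕ} (hp : p.Prime) (M : Subgroup X) [M.Normal] (hM : IsPGroup p M)
    (hmax : ∀ N : Subgroup X, N.Normal → IsPGroup p N → N ≤ M) :
    ∀ N : Subgroup (X ⧸ M), N.Normal → IsPGroup p N → N = ⊥ := by
  haveI := Fact.mk hp
  intro N hN hNp
  have h1 : N.comap (QuotientGroup.mk' M) ≤ M := by
    refine hmax _ (hN.comap _) ?_
    obtain ⟨a, ha⟩ := IsPGroup.iff_card.1 hM
    obtain ⟨c, hc⟩ := IsPGroup.iff_card.1 hNp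
    refine IsPGroup.of_card (n := a + c) ?_
    rw [card_comap_mk, ha, hc, pow_add]
  rw [eq_bot_iff]
  intro x hx
  obtain ⟨y, rfl⟩ := QuotientGroup.mk'_surjective M x
  exact (QuotientGroup.eq_one_iff y).2 (h1 hx)

theorem DI_lift {X : Type} [Group X] [Finite X] {p : ℕ} (hp : p.Prime) (M : Subgroup X) [M.Normal] {b : ℕ}
    (h : DI p b (⊤ : Subgroup (X ⧸ M)) = ⊥) : DI p b (⊤ : Subgroup X) ≤ M := by
  rw [← Subgroup.map_top_of_surjective _ (QuotientGroup.mk'_surjective M), DI_map hp, Subgroup.map_eq_bot_iff] at h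
  intro x hx
  exact (QuotientGroup.eq_one_iff x).1 (h hx)

theorem theta0 (m : ℕ) : ∃ b : ℕ, ∀ (p : ℕ) (hp : p.Prime) (X : Type) [Group X] [Finite X], PSol p X → Star p m (1 : X) →
    DI p b (⊤ : Subgroup X) = ⊥ := by
  refine ⟨(m.factorial + 2) + 1, ?_⟩
  intro p hp X _ _ hX hs
  obtain ⟨M, hMn, hM, hmax⟩ := exists_Op (X := X) hp
  have h := core (X := X ⧸ M) hp (hX.quot hp M) (Op_quot hp M hM hmax) 1 0 (one_pow _) ⊤ m.factorial (by
    intro Q _ r hr hrp R P N h1N hPN hPp hR hNR hNP hNQ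
    refine ⟨N, le_rfl, by rw [hNQ]; exact le_top, ?_⟩
    have hs' : Star p m (1 : X ⧸ M) := by
      have := hs.map (QuotientGroup.mk' M) (QuotientGroup.mk'_surjective M)
      rwa [map_one] at this
    obtain ⟨V, _, _, _, hV, hm, hz⟩ := local_act hp hs' hr hrp R N hR h1N hNR
    have hcV : Nat.card V ≤ m := by
      refine le_trans ?_ hm
      refine Nat.card_le_card_of_injective (fun v => (⟨v, ?_⟩ : fx V (⟨1, h1N⟩ : N))) ?_
      · rw [mem_fx]
        exact one_smul N v
      · intro a b hab
        exact congrArg Subtype.val hab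
    have key := PSol.DI_fix hp ((hX.quot hp M).subgroup hp N) (⊤ : Subgroup N) (fun x (v : V) => x • v) (one_smul N) (fun x y v => mul_smul x y v)
      Set.univ Set.finite_univ (fun _ _ _ _ => trivial) (M := m) (by rw [Set.ncard_univ]; exact hcV)
    intro k hk y hy t ht
    have hkN := DI_le _ N hk
    have hk' : (⟨k, hkN⟩ : N) ∈ DI p m.factorial (⊤ : Subgroup N) := by
      have h1 := DI_map hp N.subtype m.factorial ⊤
      rw [← MonoidHom.range_eq_map, Subgroup.range_subtype] at h1
      rw [h1] at hk
      obtain ⟨y, hy, hyx⟩ := hk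
      have : y = ⟨k, hkN⟩ := Subtype.ext hyx
      rwa [← this]
    have hkv : ∀ v : V, (⟨k, hkN⟩ : N) • v = v := fun v => key _ hk' v trivial
    refine hz (⟨k, hkN⟩ * ⟨y, hPN hy⟩ * ⟨k, hkN⟩⁻¹ * ⟨y, hPN hy⟩⁻¹) ?_ ?_ t ht
    · exact isPEl_of_mem hPp (P.mul_mem (hNP k hkN y hy) (P.inv_mem hy))
    · intro v
      rw [mul_smul, mul_smul, mul_smul, hkv, inv_smul_eq_iff.2 (hkv _).symm, smul_inv_smul])
  rw [DI_succ', eq_bot_iff, ← DD_eq_bot_of_pgroup hp hM]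
  exact DD_mono (DI_lift hp M h)

theorem theta {p : ℕ} (hp : p.Prime) (m n : ℕ) : ∃ b : ℕ, ∀ (X : Type) [Group X] [Finite X], PSol p X → ∀ φ : X, φ ^ p ^ n = 1 → Star p m φ →
    DI p b (⊤ : Subgroup X) = ⊥ := by
  induction n with
  | zero =>
    obtain ⟨b, hb⟩ := theta0 m
    refine ⟨b, fun X _ _ hX φ hφ hs => hb p hp X hX ?_⟩
    rw [pow_zero, pow_one] at hφ
    rwa [hφ] at hs
  | succ k ih =>
    obtain ⟨b', hb'⟩ := ih
    obtain ⟨b, hb⟩ := lemM' hp k m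
    refine ⟨((b + 2) + b') + 1, ?_⟩
    intro X _ _ hX φ hφ hs
    obtain ⟨M, hMn, hM, hmax⟩ := exists_Op (X := X) hp
    set φ' : X ⧸ M := QuotientGroup.mk' M φ with hφ'def
    have hφ' : φ' ^ p ^ (k + 1) = 1 := by rw [hφ'def, ← map_pow, hφ, map_one]
    have hs' : Star p m φ' := hs.map (QuotientGroup.mk' M) (QuotientGroup.mk'_surjective M)
    have hX' := hX.quot hp M
    have h := core (X := X ⧸ M) hp hX' (Op_quot hp M hM hmax) φ' (k + 1) hφ' (Subgroup.normalClosure {φ' ^ p ^ k}) b (by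
      intro Q hQ r hr hrp R P N h1N hPN hPp hR hNR hNP hNQ
      obtain ⟨V, _, _, _, hV, hm, hz⟩ := local_act hp hs' hr hrp R N hR h1N hNR
      refine ⟨(Subgroup.normalClosure {(⟨φ', h1N⟩ : N) ^ p ^ k}).map N.subtype, Subgroup.map_subtype_le _, ?_, ?_⟩
      · have hsurj : Function.Surjective ((QuotientGroup.mk' Q).comp N.subtype) := by
          intro x
          have : x ∈ N.map (QuotientGroup.mk' Q) := by rw [hNQ]; trivial
          obtain ⟨y, hy, rfl⟩ := this
          exact ⟨⟨y, hy⟩, rfl⟩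
        rw [Subgroup.map_map, Subgroup.map_normalClosure _ _ hsurj, Subgroup.map_normalClosure _ _ (QuotientGroup.mk'_surjective Q),
          Set.image_singleton, Set.image_singleton]
        exact le_of_eq rfl
      · intro k' hk' y hy t ht
        rw [DI_map hp] at hk'
        obtain ⟨k', hk', rfl⟩ := hk'
        refine hz (k' * ⟨y, hPN hy⟩ * k'⁻¹ * ⟨y, hPN hy⟩⁻¹) ?_ ?_ t ht
        · exact isPEl_of_mem hPp (P.mul_mem (hNP k' k'.2 y hy) (P.inv_mem hy))
        · refine hb N V (hX'.subgroup hp N) hV (P.subgroupOf N) ⟨?_⟩ ?_ ⟨φ', h1N⟩ ?_ hm k' hk' ⟨y, hPN hy⟩ ?_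
          · intro x hx g
            rw [Subgroup.mem_subgroupOf] at hx ⊢
            exact hNP g g.2 x hx
          · exact hPp.of_equiv (Subgroup.subgroupOfEquivOfLe hPN).symm
          · exact Subtype.ext hφ'
          · exact Subgroup.mem_subgroupOf.2 hy)
    have h2 : DI p b' (⊤ : Subgroup (X ⧸ M)) ≤ Subgroup.normalClosure {φ' ^ p ^ k} := by
      refine DI_lift hp _ (hb' _ (hX'.quot hp _) (QuotientGroup.mk' _ φ') ?_ (hs'.map _ (QuotientGroup.mk'_surjective _)))
      rw [← map_pow]
      exact (QuotientGroup.eq_one_iff _).2 (Subgroup.subset_normalClosure rfl)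
    have h3 : DI p ((b + 2) + b') (⊤ : Subgroup (X ⧸ M)) = ⊥ := by
      rw [DI_add, eq_bot_iff, ← h]
      exact DI_mono _ h2
    rw [DI_succ', eq_bot_iff, ← DD_eq_bot_of_pgroup hp hM]
    exact DD_mono (DI_lift hp M h3)

end PLen

namespace PLen

theorem card_map_mk {X : Type} [Group X] (H K : Subgroup X) [H.Normal] :
    Nat.card (K.map (QuotientGroup.mk' H)) = H.relIndex K := by
  rw [← Subgroup.relIndex_ker, QuotientGroup.ker_mk']

theorem DD_le_of_factor {X : Type} [Group X] [Finite X] {p : ℕ} (hp : p.Prime) (H K : Subgroup X) [H.Normal]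
    (h : (∃ j, H.relIndex K = p ^ j) ∨ ¬ p ∣ H.relIndex K) : DD p K ≤ H := by
  haveI := Fact.mk hp
  have h1 : DD p (K.map (QuotientGroup.mk' H)) = ⊥ := by
    rw [← card_map_mk] at h
    rcases h with ⟨j, h⟩ | h
    · exact DD_eq_bot_of_pgroup hp (IsPGroup.of_card h)
    · exact DD_eq_bot_of_pprime hp h
  rw [DD_map hp, Subgroup.map_eq_bot_iff, QuotientGroup.ker_mk'] at h1
  exact h1

theorem PSol_of_IsPSoluble {X : Type} [Group X] [Finite X] {p : ℕ} (hp : p.Prime) (h : IsPSoluble p X) : PSol p X := by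
  obtain ⟨k, H, h0, hk, hn, hle, hf⟩ := h
  refine ⟨k, le_bot_iff.1 ?_⟩
  have key : ∀ j ≤ k, DI p j (⊤ : Subgroup X) ≤ H (k - j) := by
    intro j
    induction j with
    | zero => intro _; rw [Nat.sub_zero, hk]; exact le_top
    | succ j ih =>
      intro hj
      have h1 := ih (by omega)
      haveI := hn (k - (j + 1))
      have h2 := DD_le_of_factor hp (H (k - (j + 1))) (H (k - (j + 1) + 1)) (hf _ (by omega))
      rw [show k - (j + 1) + 1 = k - j by omega] at h2
      rw [DI_succ']
      exact (DD_mono h1).trans h2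
  have := key k le_rfl
  rwa [Nat.sub_self, h0] at this

theorem relIndex_Rq {X : Type} [Group X] [Finite X] {p : ℕ} (hp : p.Prime) (R : Subgroup X) (hn : (Rq p R).Normal) :
    ∃ j, (Rq p R).relIndex R = p ^ j := by
  haveI := Fact.mk hp
  rw [← card_map_mk]
  refine IsPGroup.iff_card.1 (pgroup_of hp ?_)
  rintro _ ⟨x, hx, rfl⟩ hq
  obtain ⟨n, h1, h2⟩ := exists_lift_q hp _ x hq
  rw [← h2]
  exact (QuotientGroup.eq_one_iff _).2 (Subgroup.subset_closure ⟨R.pow_mem hx n, h1⟩)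

theorem relIndex_Rp {X : Type} [Group X] [Finite X] {p : ℕ} (hp : p.Prime) (R : Subgroup X) (hn : (Rp p R).Normal) :
    ¬ p ∣ (Rp p R).relIndex R := by
  rw [← card_map_mk]
  refine pprime_of hp ?_
  rintro _ ⟨x, hx, rfl⟩ hq
  obtain ⟨n, h1, h2⟩ := exists_lift_p hp _ x hq
  rw [← h2]
  exact (QuotientGroup.eq_one_iff _).2 (Subgroup.subset_closure ⟨R.pow_mem hx n, h1⟩)

/-- the lower `p`-series, reindexed as an ascending series -/
def Ser {X : Type} [Group X] (p b : ℕ) (i : ℕ) : Subgroup X :=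
  if 2 * b ≤ i then ⊤ else if i % 2 = 0 then DI p (b - i / 2) ⊤ else Rp p (DI p (b - i / 2 - 1) ⊤)

theorem Ser_even {X : Type} [Group X] (p b : ℕ) {j : ℕ} (hj : j ≤ b) :
    (Ser p b (2 * j) : Subgroup X) = DI p (b - j) ⊤ := by
  unfold Ser
  split_ifs with h1 h2
  · rw [show b - j = 0 by omega]; rfl
  · rw [show 2 * j / 2 = j by omega]
  · omega

theorem Ser_odd {X : Type} [Group X] (p b : ℕ) {j : ℕ} (hj : j < b) :
    (Ser p b (2 * j + 1) : Subgroup X) = Rp p (DI p (b - (j + 1)) ⊤) := by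
  unfold Ser
  split_ifs with h1 h2
  · omega
  · omega
  · rw [show b - (2 * j + 1) / 2 - 1 = b - (j + 1) by omega]

theorem PLengthLE_of_DI {X : Type} [Group X] [Finite X] {p : ℕ} (hp : p.Prime) {b : ℕ}
    (h : DI p b (⊤ : Subgroup X) = ⊥) : PLengthLE p X b := by
  have hnD : ∀ j, (DI p j (⊤ : Subgroup X)).Normal := fun j => DI_normal hp inferInstance j
  have hnR : ∀ j, (Rp p (DI p j (⊤ : Subgroup X))).Normal := fun j => Rp_normal hp (hnD j)
  have hE : ∀ j < b, (Ser p b (2 * j) : Subgroup X) = Rq p (Ser p b (2 * j + 1)) := by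
    intro j hj
    rw [Ser_even p b hj.le, Ser_odd p b hj, show b - j = (b - (j + 1)) + 1 by omega, DI_succ']
    rfl
  have hO : ∀ j < b, (Ser p b (2 * j + 1) : Subgroup X) = Rp p (Ser p b (2 * j + 2)) := by
    intro j hj
    rw [show 2 * j + 2 = 2 * (j + 1) by ring, Ser_even p b hj, Ser_odd p b hj]
  have hn : ∀ i, (Ser p b i : Subgroup X).Normal := by
    intro i
    unfold Ser
    split_ifs
    · infer_instance
    · exact hnD _
    · exact hnR _
  have hT : ∀ i, 2 * b ≤ i → (Ser p b i : Subgroup X) = ⊤ := fun i hi => if_pos hi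
  have hfE : ∀ j < b, ∃ a, (Ser p b (2 * j) : Subgroup X).relIndex (Ser p b (2 * j + 1)) = p ^ a := by
    intro j hj
    have := hn (2 * j)
    rw [hE j hj] at this ⊢
    exact relIndex_Rq hp _ this
  have hfO : ∀ j < b, ¬ p ∣ (Ser p b (2 * j + 1) : Subgroup X).relIndex (Ser p b (2 * j + 2)) := by
    intro j hj
    have := hn (2 * j + 1)
    rw [hO j hj] at this ⊢
    exact relIndex_Rp hp _ this
  have hcase : ∀ i < 2 * b, ∃ j < b, i = 2 * j ∨ i = 2 * j + 1 := by
    intro i hi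
    exact ⟨i / 2, by omega, by omega⟩
  refine ⟨2 * b, Ser p b, ⟨?_, hT _ le_rfl, hn, ?_, ?_⟩, ?_⟩
  · have := Ser_even (X := X) p b (Nat.zero_le b)
    rw [Nat.sub_zero, h] at this
    exact this
  · intro i
    rcases Nat.lt_or_ge i (2 * b) with hi | hi
    · obtain ⟨j, hj, rfl | rfl⟩ := hcase i hi
      · rw [hE j hj]; exact Rq_le _
      · rw [hO j hj]; exact Rp_le _
    · rw [hT (i + 1) (by omega)]; exact le_top
  · intro i hi
    obtain ⟨j, hj, rfl | rfl⟩ := hcase i hi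
    · exact Or.inl (hfE j hj)
    · exact Or.inr (hfO j hj)
  · have hsub : ((Finset.range (2 * b)).filter (fun i => p ∣ Nat.card ((Ser p b (i + 1) : Subgroup X) ⧸
        (Ser p b i : Subgroup X).subgroupOf (Ser p b (i + 1))))) ⊆ (Finset.range b).image (fun j => 2 * j) := by
      intro i hi
      rw [Finset.mem_filter, Finset.mem_range] at hi
      obtain ⟨j, hj, rfl | rfl⟩ := hcase i hi.1
      · exact Finset.mem_image.2 ⟨j, Finset.mem_range.2 hj, rfl⟩
      · exact absurd hi.2 (hfO j hj)
    refine (Finset.card_le_card hsub).trans (Finset.card_image_le.trans ?_)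
    rw [Finset.card_range]

theorem PSol_ext {X Y P : Type} [Group X] [Group Y] [Group P] [Finite X] [Finite Y] [Finite P] {p : ℕ} (hp : p.Prime)
    (f : Y →* X) (g : X →* P) (hfg : g.ker ≤ f.range) (hP : IsPGroup p P) (h : PSol p Y) : PSol p X := by
  obtain ⟨k, hk⟩ := h
  refine ⟨k + 1, le_bot_iff.1 ?_⟩
  rw [DI_succ]
  have h1 : DD p (⊤ : Subgroup X) ≤ f.range := by
    refine le_trans ?_ hfg
    rw [← Subgroup.map_eq_bot_iff, ← DD_map hp]
    exact DD_eq_bot_of_pgroup hp (hP.to_subgroup _)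
  refine (DI_mono k h1).trans ?_
  rw [MonoidHom.range_eq_map, DI_map hp, hk, Subgroup.map_bot]

theorem Star_of_sections {X G P : Type} [Group X] [Group G] [Group P] [Finite X] [Finite G] {p m : ℕ} (hp : p.Prime)
    (f : G →* X) (hf : Function.Injective f) (g : X →* P) (hfg : g.ker ≤ f.range) (hP : IsPGroup p P)
    (φ : MulAut G) (t : X) (ht : ∀ x, t * f x * t⁻¹ = f (φ x))
    (h : ∀ A B : Subgroup G, PhiInvariant φ A → PhiInvariant φ B →
            IsElemAbelianPPrimeSection p A B → sectionFixedCard φ A B ≤ m) : Star p m t := by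
  intro r hr hrp C B hBC hB hab hexp hfix
  have inv : ∀ A : Subgroup G, (∀ x ∈ A, φ x ∈ A) → PhiInvariant φ A := by
    intro A hA
    refine Subgroup.eq_of_le_of_card_ge ?_ ?_
    · rintro _ ⟨x, hx, rfl⟩; exact hA x hx
    · exact (Nat.card_congr (A.equivMapOfInjective φ.toMonoidHom φ.injective).toEquiv).le
  have hA : PhiInvariant φ (C.comap f) := by
    refine inv _ fun x hx => ?_
    have := C.mul_mem (hBC (hfix _ hx)) hx
    rw [inv_mul_cancel_right, ht] at this
    exact this
  have hB' : PhiInvariant φ (B.comap f) := by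
    refine inv _ fun x hx => ?_
    have := hB _ hx
    rw [ht] at this
    exact this
  have hnorm : ∀ a ∈ C, ∀ b ∈ B, a * b * a⁻¹ ∈ B := by
    intro a ha b hb
    have := B.mul_mem (hab a ha b (hBC hb)) hb
    rwa [inv_mul_cancel_right] at this
  refine le_trans ?_ (h _ _ hA hB' ⟨Subgroup.comap_mono hBC, ?_, r, hr, hrp, ?_, ?_⟩)
  · have hrep : ∀ c : C, ∃ a : G, f a ∈ C ∧ (c : X)⁻¹ * f a ∈ B := by
      intro c
      obtain ⟨k, hk⟩ := hP (g c)
      have h1 : (c : X) ^ p ^ k ∈ f.range := hfg (by rw [MonoidHom.mem_ker, map_pow, hk])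
      have hc : IsCoprime ((p ^ k : ℕ) : ℤ) (r : ℤ) :=
        Nat.isCoprime_iff_coprime.2 (Nat.Coprime.pow_left _ ((Nat.coprime_primes hp hr).2 (Ne.symm hrp)))
      obtain ⟨u, v, huv⟩ := hc
      have h2 : (c : X) ^ (u * ((p ^ k : ℕ) : ℤ)) ∈ f.range := by
        rw [mul_comm, zpow_mul, zpow_natCast]; exact f.range.zpow_mem h1 u
      have h3 : (c : X) ^ (v * (r : ℤ)) ∈ B := by
        rw [mul_comm, zpow_mul, zpow_natCast]; exact B.zpow_mem (hexp _ c.2) v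
      obtain ⟨a, ha⟩ := h2
      refine ⟨a, ?_, ?_⟩
      · rw [ha]; exact C.zpow_mem c.2 _
      · rw [ha, show u * ((p ^ k : ℕ) : ℤ) = 1 - v * r by linarith, zpow_sub, zpow_one, inv_mul_cancel_left]
        exact B.inv_mem h3
    have hrep2 : ∀ q : C ⧸ B.subgroupOf C, ∃ a : G, ∃ ha : f a ∈ C, (QuotientGroup.mk (⟨f a, ha⟩ : C) : C ⧸ B.subgroupOf C) = q := by
      intro q
      obtain ⟨c, rfl⟩ := QuotientGroup.mk_surjective q
      obtain ⟨a, ha, hca⟩ := hrep c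
      refine ⟨a, ha, Eq.symm (QuotientGroup.eq.2 ?_)⟩
      exact hca
    choose a ha hq using hrep2
    have hfx : ∀ x, f x ∈ C → x⁻¹ * φ x ∈ B.comap f := by
      intro x hx
      have h1 := hfix _ hx
      rw [ht] at h1
      have h2 := hnorm _ (C.inv_mem hx) _ h1
      rw [inv_inv, mul_assoc, inv_mul_cancel_right] at h2
      rw [Subgroup.mem_comap, map_mul, map_inv]
      exact h2
    refine Nat.card_le_card_of_injective (α := C ⧸ B.subgroupOf C)
      (fun q => ⟨QuotientGroup.mk (⟨a q, ha q⟩ : C.comap f), ⟨a q, ha q⟩, rfl, hfx _ (ha q)⟩) ?_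
    intro q q' hqq
    have h1 := QuotientGroup.eq.1 (congrArg Subtype.val hqq)
    rw [← hq q, ← hq q']
    refine QuotientGroup.eq.2 ?_
    have h2 : f ((a q)⁻¹ * a q') ∈ B := h1
    rw [map_mul, map_inv] at h2
    exact h2
  · intro x hx y hy
    have := hnorm _ hx _ hy
    rw [Subgroup.mem_comap, map_mul, map_mul, map_inv]
    exact this
  · intro x hx y hy
    have := hab _ (C.inv_mem hx) _ (C.inv_mem hy)
    rw [inv_inv, inv_inv] at this
    rw [Subgroup.mem_comap, map_mul, map_mul, map_mul, map_inv, map_inv]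
    exact this
  · intro x hx
    rw [Subgroup.mem_comap, map_pow]
    exact hexp _ hx

theorem mk_semi {G : Type} [Group G] [Finite G] {p n m : ℕ} (hp : p.Prime) (hG : PSol p G) (φ : MulAut G)
    (hφ : orderOf φ = p ^ n)
    (h : ∀ A B : Subgroup G, PhiInvariant φ A → PhiInvariant φ B →
            IsElemAbelianPPrimeSection p A B → sectionFixedCard φ A B ≤ m) :
    ∃ (X : Type) (_ : Group X) (_ : Finite X) (t : X) (f : G →* X), Function.Injective f ∧ PSol p X ∧
      t ^ p ^ n = 1 ∧ Star p m t := by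
  haveI := Fact.mk hp
  let Z := Subgroup.zpowers φ
  have hZ : Nat.card Z = p ^ n := by rw [Nat.card_zpowers, hφ]
  haveI : Finite Z := Nat.finite_of_card_ne_zero (by rw [hZ]; exact (pow_pos hp.pos n).ne')
  have hZp : IsPGroup p Z := IsPGroup.of_card hZ
  let X := SemidirectProduct G Z Z.subtype
  haveI : Finite X := Finite.of_equiv _ (SemidirectProduct.equivProd (φ := Z.subtype)).symm
  let f : G →* X := SemidirectProduct.inl
  let g : X →* Z := SemidirectProduct.rightHom
  have hfg : g.ker ≤ f.range := (SemidirectProduct.range_inl_eq_ker_rightHom).ge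
  let z : Z := ⟨φ, Subgroup.mem_zpowers φ⟩
  let t : X := SemidirectProduct.inr z
  have ht : ∀ x, t * f x * t⁻¹ = f (φ x) := by
    intro x
    have := SemidirectProduct.inl_aut (φ := Z.subtype) z x
    rw [map_inv] at this
    exact this.symm
  refine ⟨X, inferInstance, inferInstance, t, f, SemidirectProduct.inl_injective, PSol_ext hp f g hfg hZp hG, ?_,
    Star_of_sections hp f SemidirectProduct.inl_injective g hfg hZp φ t ht h⟩
  have hz : z ^ p ^ n = 1 := by
    apply Subtype.ext
    change φ ^ p ^ n = 1
    rw [← hφ, pow_orderOf_eq_one]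
  change (SemidirectProduct.inr z) ^ p ^ n = 1
  rw [← map_pow, hz, map_one]

theorem DI_pull {G X : Type} [Group G] [Group X] [Finite G] [Finite X] {p b : ℕ} (hp : p.Prime) (f : G →* X)
    (hf : Function.Injective f) (h : DI p b (⊤ : Subgroup X) = ⊥) : DI p b (⊤ : Subgroup G) = ⊥ := by
  have h1 : (DI p b (⊤ : Subgroup G)).map f ≤ ⊥ := by
    rw [← DI_map hp, ← h]
    exact DI_mono b le_top
  rw [le_bot_iff, Subgroup.map_eq_bot_iff] at h1
  rw [(MonoidHom.ker_eq_bot_iff f).2 hf] at h1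
  exact le_bot_iff.1 h1

theorem final_bound (q m : ℕ) : ∃ b : ℕ, ∀ p n : ℕ, p.Prime → q = p ^ n → ∀ (X : Type) [Group X] [Finite X],
    PSol p X → ∀ t : X, t ^ p ^ n = 1 → Star p m t → DI p b (⊤ : Subgroup X) = ⊥ := by
  by_cases hq : q = 1
  · obtain ⟨b, hb⟩ := theta0 m
    refine ⟨b, ?_⟩
    intro p n hp h X _ _ hX t ht hS
    rw [← h, hq, pow_one] at ht
    subst ht
    exact hb p hp X hX hS
  · by_cases hpp : ∃ p n : ℕ, p.Prime ∧ q = p ^ n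
    · obtain ⟨p, n, hp, hpn⟩ := hpp
      obtain ⟨b, hb⟩ := theta hp m n
      refine ⟨b, ?_⟩
      intro p' n' hp' h X _ _ hX t ht hS
      have hn' : n' ≠ 0 := by rintro rfl; exact hq (by rw [h, pow_zero])
      have hpe : p' = p := by
        have : p' ∣ p ^ n := by rw [← hpn, h]; exact dvd_pow_self p' hn'
        exact (Nat.prime_dvd_prime_iff_eq hp' hp).1 (hp'.dvd_of_dvd_pow this)
      subst hpe
      rw [← h, hpn] at ht
      exact hb X hX t ht hS
    · exact ⟨0, fun p n hp h => absurd ⟨p, n, hp, h⟩ hpp⟩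

end PLen

theorem pLength_bounded_of_almost_fixed_point_free_on_pPrime_sections :
    ∃ f : ℕ × ℕ → ℕ, ∀ (p n m : ℕ), p.Prime →
      ∀ (G : Type) [Group G] [Finite G], IsPSoluble p G →
        ∀ φ : MulAut G, orderOf φ = p ^ n →
          (∀ A B : Subgroup G, PhiInvariant φ A → PhiInvariant φ B →
            IsElemAbelianPPrimeSection p A B → sectionFixedCard φ A B ≤ m) →
          PLengthLE p G (f (p ^ n, m)) := by
  choose F hF using PLen.final_bound
  refine ⟨fun x => F x.1 x.2, ?_⟩
  intro p n m hp G _ _ hG φ hφ h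
  obtain ⟨X, _, _, t, f, hf, hX, ht, hS⟩ := PLen.mk_semi hp (PLen.PSol_of_IsPSoluble hp hG) φ hφ h
  exact PLen.PLengthLE_of_DI hp (PLen.DI_pull hp f hf (hF (p ^ n) m p n hp rfl X hX t ht hS))
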